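/- Let α ∈ (0,1) be a Liouville number and let λ > 1. For every lift g of an orientation-preserving C^∞ circle diffeomorphism with rotation number ρ(g) = α, every r ∈ ℕ and every ε > 0, there exists a lift f of an orientation-preserving C^∞ circle diffeomorphism with rotation number ρ(f) = α such that d_r(f, g) < ε and the circle diffeomorphism induced by f has ratio set r(f) = {λⁿ : n ∈ ℤ} ∪ {0} (i.e. it is of type III_λ). -/

import Mathlib

noncomputable section
open MeasureTheory Filter Topology

/-- A lift of an orientation-preserving `C^∞` circle diffeomorphism: a `C^∞` map
`f : ℝ → ℝ` with `f (x+1) = f x + 1` and everywhere positive derivative. -/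
def IsCircleDiffeoLift (f : ℝ → ℝ) : Prop :=
  ContDiff ℝ (⊤ : ℕ∞) f ∧ (∀ x : ℝ, f (x + 1) = f x + 1) ∧ ∀ x : ℝ, 0 < deriv f x

/-- The `C^r` norm `‖φ‖_r = max_{0 ≤ i ≤ r} sup_x |φ^{(i)}(x)|`. -/
def CrNorm (r : ℕ) (φ : ℝ → ℝ) : ℝ :=
  (Finset.range (r + 1)).sup' (Finset.nonempty_range_iff.mpr r.succ_ne_zero)
    fun i => ⨆ x : ℝ, |iteratedDeriv i φ x|

/-- `d_r(f, g) = max {‖f - g‖_r, ‖f⁻¹ - g⁻¹‖_r}`. -/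
def liftDist (r : ℕ) (f g : ℝ → ℝ) : ℝ :=
  max (CrNorm r (fun x => f x - g x))
    (CrNorm r (fun x => Function.invFun f x - Function.invFun g x))

/-- `|f|_r = max {‖f - id‖_r, ‖f⁻¹ - id‖_r, 1}`. -/
def liftNorm (r : ℕ) (f : ℝ → ℝ) : ℝ :=
  max (max (CrNorm r (fun x => f x - x)) (CrNorm r (fun x => Function.invFun f x - x))) 1

/-- The lift `x ↦ x + a` of the rotation by `a`. -/
def RotLift (a : ℝ) : ℝ → ℝ := fun x => x + a

/-- The rotation number of the circle diffeomorphism induced by the lift `f` equals `a`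
(mod 1): the translation number `lim (fⁿ(0) - 0)/n` equals `a + k` for some integer `k`. -/
def HasRotationNumber (f : ℝ → ℝ) (a : ℝ) : Prop :=
  ∃ k : ℤ, Tendsto (fun n : ℕ => f^[n] 0 / (n : ℝ)) atTop (nhds (a + k))

/-- The lift of the `i`-th iterate (`i ∈ ℤ`) of the circle diffeomorphism induced by `f`. -/
def zpowLift (f : ℝ → ℝ) : ℤ → ℝ → ℝ := fun i =>
  if 0 ≤ i then f^[i.toNat] else (Function.invFun f)^[(-i).toNat]

/-- The ratio set of a circle diffeomorphism, described through the family `Fz i` of its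
iterates (`i ∈ ℤ`) and the family `D i` of the derivatives of its iterates: `t ≥ 0` lies in
the ratio set iff for every Borel `A` of positive Haar measure and every `ε > 0` there are a
Borel `B ⊆ A` of positive measure and `i ∈ ℤ` with `Fz i '' B ⊆ A` and `|D i x - t| < ε`
on `B`. -/
def ratioSet (Fz : ℤ → UnitAddCircle → UnitAddCircle) (D : ℤ → UnitAddCircle → ℝ) : Set ℝ :=
  {t : ℝ | 0 ≤ t ∧ ∀ A : Set UnitAddCircle, MeasurableSet A → 0 < volume A →
    ∀ ε : ℝ, 0 < ε → ∃ B : Set UnitAddCircle, MeasurableSet B ∧ B ⊆ A ∧ 0 < volume B ∧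
      ∃ i : ℤ, Fz i '' B ⊆ A ∧ ∀ x ∈ B, |D i x - t| < ε}

/-- A lift of an orientation-preserving `C¹` circle diffeomorphism. -/
def IsC1CircleLift (f : ℝ → ℝ) : Prop :=
  ContDiff ℝ 1 f ∧ (∀ x : ℝ, f (x + 1) = f x + 1) ∧ ∀ x : ℝ, 0 < deriv f x

namespace CircleIII
open scoped ContDiff

/-- The `r`-jet of `u` at `x` is bounded by `K` at the length scale `1 / B`. -/
def JetBound (r : ℕ) (K B : ℝ) (u : ℝ → ℝ) (x : ℝ) : Prop :=
  ∀ j ≤ r, |iteratedDeriv j u x| ≤ K * B ^ j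

theorem smooth_deriv {u : ℝ → ℝ} (hu : ContDiff ℝ ∞ u) : ContDiff ℝ ∞ (deriv u) :=
  (contDiff_infty_iff_deriv.1 hu).2

theorem smooth_id : ContDiff ℝ ∞ (fun y : ℝ => y) := contDiff_id

theorem deriv_id_eq : deriv (fun y : ℝ => y) = fun _ => (1 : ℝ) := by
  funext y; simp

theorem smooth_diff {u : ℝ → ℝ} (hu : ContDiff ℝ ∞ u) : Differentiable ℝ u :=
  (contDiff_infty_iff_deriv.1 hu).1

theorem smooth_hasDeriv {u : ℝ → ℝ} (hu : ContDiff ℝ ∞ u) (x : ℝ) :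
    HasDerivAt u (deriv u x) x :=
  (smooth_diff hu x).hasDerivAt

theorem smooth_at {u : ℝ → ℝ} (hu : ContDiff ℝ ∞ u) (n : ℕ) (x : ℝ) :
    ContDiffAt ℝ n u x :=
  (hu.of_le (by exact_mod_cast le_top)).contDiffAt

theorem smooth_iter {u : ℝ → ℝ} (hu : ContDiff ℝ ∞ u) (n : ℕ) :
    ContDiff ℝ ∞ (iteratedDeriv n u) := by
  induction n generalizing u with
  | zero => simpa using hu
  | succ n ih => rw [iteratedDeriv_succ']; exact ih (smooth_deriv hu)

theorem deriv_comp_eq {u v : ℝ → ℝ} (hu : ContDiff ℝ ∞ u) (hv : ContDiff ℝ ∞ v) :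
    deriv (fun y => u (v y)) = fun y => deriv u (v y) * deriv v y := by
  funext y
  exact ((smooth_hasDeriv hu (v y)).comp y (smooth_hasDeriv hv y)).deriv

theorem deriv_mul_eq {u v : ℝ → ℝ} (hu : ContDiff ℝ ∞ u) (hv : ContDiff ℝ ∞ v) :
    deriv (fun y => u y * v y) = fun y => deriv u y * v y + u y * deriv v y := by
  funext y
  exact ((smooth_hasDeriv hu y).mul (smooth_hasDeriv hv y)).deriv

theorem JetBound.val {r : ℕ} {K B x : ℝ} {u : ℝ → ℝ} (h : JetBound r K B u x) : |u x| ≤ K := by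
  simpa using h 0 (Nat.zero_le _)

theorem JetBound.nonneg {r : ℕ} {K B x : ℝ} {u : ℝ → ℝ} (h : JetBound r K B u x) : 0 ≤ K :=
  (abs_nonneg _).trans h.val

theorem jetBound_succ {r : ℕ} {K B x : ℝ} {u : ℝ → ℝ} :
    JetBound (r + 1) K B u x ↔ |u x| ≤ K ∧ JetBound r (K * B) B (deriv u) x := by
  constructor
  · intro h
    refine ⟨h.val, fun j hj => ?_⟩
    have := h (j + 1) (by omega)
    rw [iteratedDeriv_succ'] at this
    calc _ ≤ _ := this
      _ = _ := by ring
  · rintro ⟨h0, h1⟩ j hj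
    cases j with
    | zero => simpa using h0
    | succ j =>
      rw [iteratedDeriv_succ']
      calc _ ≤ _ := h1 j (by omega)
        _ = _ := by ring

theorem jetBound_zero {K B x : ℝ} {u : ℝ → ℝ} : JetBound 0 K B u x ↔ |u x| ≤ K := by
  constructor
  · exact fun h => h.val
  · intro h j hj
    obtain rfl : j = 0 := by omega
    simpa using h

theorem JetBound.mono {r r' : ℕ} {K K' B B' x : ℝ} {u : ℝ → ℝ} (h : JetBound r K B u x)
    (hr : r' ≤ r) (hK : K ≤ K') (hB0 : 0 ≤ B) (hB : B ≤ B') : JetBound r' K' B' u x := by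
  intro j hj
  have h0 := h.nonneg
  calc _ ≤ K * B ^ j := h j (by omega)
    _ ≤ _ := by gcongr; linarith

theorem JetBound.le {r : ℕ} {K K' B x : ℝ} {u : ℝ → ℝ} (h : JetBound r K B u x)
    (hB : 0 ≤ B) (hK : K ≤ K') : JetBound r K' B u x :=
  h.mono le_rfl hK hB le_rfl

theorem JetBound.of_le {r r' : ℕ} {K B x : ℝ} {u : ℝ → ℝ} (h : JetBound r K B u x)
    (hr : r' ≤ r) : JetBound r' K B u x :=
  fun j hj => h j (hj.trans hr)

theorem JetBound.congr {r : ℕ} {K B x : ℝ} {u v : ℝ → ℝ} (h : JetBound r K B u x)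
    (he : u =ᶠ[𝓝 x] v) : JetBound r K B v x := by
  intro j hj
  rw [← he.iteratedDeriv_eq j]
  exact h j hj

theorem JetBound.add {r : ℕ} {K K' B x : ℝ} {u v : ℝ → ℝ} (hu : ContDiff ℝ ∞ u)
    (hv : ContDiff ℝ ∞ v) (h : JetBound r K B u x) (h' : JetBound r K' B v x) :
    JetBound r (K + K') B (fun y => u y + v y) x := by
  intro j hj
  rw [iteratedDeriv_fun_add (smooth_at hu j x) (smooth_at hv j x)]
  rw [add_mul]
  exact (abs_add_le _ _).trans (add_le_add (h j hj) (h' j hj))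

theorem JetBound.neg {r : ℕ} {K B x : ℝ} {u : ℝ → ℝ} (h : JetBound r K B u x) :
    JetBound r K B (fun y => -u y) x := by
  intro j hj
  rw [iteratedDeriv_fun_neg, abs_neg]
  exact h j hj

theorem JetBound.sub {r : ℕ} {K K' B x : ℝ} {u v : ℝ → ℝ} (hu : ContDiff ℝ ∞ u)
    (hv : ContDiff ℝ ∞ v) (h : JetBound r K B u x) (h' : JetBound r K' B v x) :
    JetBound r (K + K') B (fun y => u y - v y) x := by
  simpa [sub_eq_add_neg] using h.add hu hv.neg h'.neg

theorem JetBound.sum {ι : Type*} {r : ℕ} {B x : ℝ} (s : Finset ι) {K : ι → ℝ}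
    {u : ι → ℝ → ℝ} (hu : ∀ i ∈ s, ContDiff ℝ ∞ (u i)) (h : ∀ i ∈ s, JetBound r (K i) B (u i) x) :
    JetBound r (∑ i ∈ s, K i) B (fun y => ∑ i ∈ s, u i y) x := by
  intro j hj
  rw [iteratedDeriv_fun_sum fun i hi => smooth_at (hu i hi) j x, Finset.sum_mul]
  exact (Finset.abs_sum_le_sum_abs _ _).trans (Finset.sum_le_sum fun i hi => h i hi j hj)

theorem JetBound.mul {r : ℕ} {K K' B x : ℝ} {u v : ℝ → ℝ} (hu : ContDiff ℝ ∞ u)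
    (hv : ContDiff ℝ ∞ v) (h : JetBound r K B u x) (h' : JetBound r K' B v x) :
    JetBound r (2 ^ r * K * K') B (fun y => u y * v y) x := by
  induction r generalizing K K' u v with
  | zero =>
    rw [jetBound_zero] at *
    rw [abs_mul]; simpa using mul_le_mul h h' (abs_nonneg _) ((abs_nonneg _).trans h)
  | succ r ih =>
    have hK := h.nonneg
    have hK' := h'.nonneg
    have h1 := jetBound_succ.1 h
    have h2 := jetBound_succ.1 h'
    rw [jetBound_succ]
    constructor
    · rw [abs_mul]
      calc _ ≤ K * K' := mul_le_mul h1.1 h2.1 (abs_nonneg _) hK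
        _ = 1 * (K * K') := by ring
        _ ≤ 2 ^ (r + 1) * (K * K') := by gcongr; exact one_le_pow₀ (by norm_num)
        _ = _ := by ring
    · rw [deriv_mul_eq hu hv]
      have hu' := smooth_deriv hu
      have hv' := smooth_deriv hv
      have a := ih hu' hv h1.2 (h'.of_le (Nat.le_succ r))
      have b := ih hu hv' (h.of_le (Nat.le_succ r)) h2.2
      have := a.add (hu'.mul hv) (hu.mul hv') b
      convert this using 1
      ring

theorem jetBound_const (r : ℕ) {B : ℝ} (hB : 0 ≤ B) (c x : ℝ) :
    JetBound r |c| B (fun _ => c) x := by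
  intro j _
  rw [iteratedDeriv_const]
  split_ifs with h
  · subst h; simp
  · simpa using by positivity

theorem JetBound.const_mul {r : ℕ} {K B x : ℝ} {u : ℝ → ℝ} (c : ℝ)
    (h : JetBound r K B u x) : JetBound r (|c| * K) B (fun y => c * u y) x := by
  intro j hj
  rw [iteratedDeriv_const_mul_field, abs_mul, mul_assoc]
  exact mul_le_mul_of_nonneg_left (h j hj) (abs_nonneg _)

theorem jetBound_comp (r : ℕ) (κ : ℝ) : ∃ C : ℝ, 1 ≤ C ∧ ∀ (K b B : ℝ) (u v : ℝ → ℝ) (x : ℝ),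
    0 < b → 0 ≤ B → ContDiff ℝ ∞ u → ContDiff ℝ ∞ v → JetBound r K b u (v x) →
    (0 < r → JetBound (r - 1) (κ * B / b) B (deriv v) x) →
    JetBound r (C * K) B (fun y => u (v y)) x := by
  induction r with
  | zero =>
    refine ⟨1, le_rfl, fun K b B u v x hb hB hu hv h _ => ?_⟩
    rw [jetBound_zero] at *
    simpa using h
  | succ r ih =>
    obtain ⟨C, hC1, hC⟩ := ih
    refine ⟨max 1 (2 ^ r * C * κ), le_max_left _ _, fun K b B u v x hb hB hu hv h hv' => ?_⟩
    have hK := h.nonneg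
    have h1 := jetBound_succ.1 h
    rw [jetBound_succ]
    constructor
    · calc _ ≤ 1 * K := by simpa using h1.1
        _ ≤ _ := by gcongr; exact le_max_left _ _
    · rw [deriv_comp_eq hu hv]
      have hvr : JetBound r (κ * B / b) B (deriv v) x := hv' (Nat.succ_pos r)
      have a := hC (K * b) b B (deriv u) v x hb hB (smooth_deriv hu) hv h1.2
        (fun _ => hvr.of_le (Nat.sub_le _ _))
      have := a.mul ((smooth_deriv hu).comp hv) (smooth_deriv hv) hvr
      refine this.le hB ?_
      calc 2 ^ r * (C * (K * b)) * (κ * B / b) = (2 ^ r * C * κ) * (K * B) := by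
            field_simp
        _ ≤ max 1 (2 ^ r * C * κ) * (K * B) := by gcongr; exact le_max_right _ _
        _ = _ := by ring

theorem jetBound_exp (r : ℕ) (κ : ℝ) : ∃ C : ℝ, 1 ≤ C ∧ ∀ (B : ℝ) (L : ℝ → ℝ) (x : ℝ),
    0 ≤ B → ContDiff ℝ ∞ L → (0 < r → JetBound (r - 1) (κ * B) B (deriv L) x) →
    JetBound r (C * Real.exp (L x)) B (fun y => Real.exp (L y)) x := by
  obtain ⟨C, hC1, hC⟩ := jetBound_comp r κ
  refine ⟨C, hC1, fun B L x hB hL h => ?_⟩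
  refine hC (Real.exp (L x)) 1 B Real.exp L x one_pos hB Real.contDiff_exp hL ?_ (by simpa using h)
  intro j _
  rw [iteratedDeriv_eq_iterate, Real.iter_deriv_exp]
  simp

theorem jetBound_inv (r : ℕ) (K a : ℝ) (ha : 0 < a) : ∃ C : ℝ, 0 < C ∧
    ∀ (B : ℝ) (u : ℝ → ℝ) (x : ℝ), 0 ≤ B → ContDiff ℝ ∞ u → (∀ y, 0 < u y) → a ≤ u x →
    JetBound r K B u x → JetBound r C B (fun y => (u y)⁻¹) x := by
  induction r with
  | zero =>
    refine ⟨a⁻¹, by positivity, fun B u x hB hu hu0 hx h => ?_⟩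
    rw [jetBound_zero, abs_of_pos (inv_pos.2 (hu0 x))]
    exact inv_anti₀ ha hx
  | succ r ih =>
    obtain ⟨C, hC1, hC⟩ := ih
    refine ⟨max a⁻¹ (4 ^ r * K * C * C), lt_max_of_lt_left (by positivity),
      fun B u x hB hu hu0 hx h => ?_⟩
    rw [jetBound_succ]
    constructor
    · rw [abs_of_pos (inv_pos.2 (hu0 x))]
      exact (inv_anti₀ ha hx).trans (le_max_left _ _)
    · have h1 := jetBound_succ.1 h
      have hi : ContDiff ℝ ∞ (fun y => (u y)⁻¹) := hu.inv fun y => (hu0 y).ne'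
      have hd : deriv (fun y => (u y)⁻¹) = fun y => -(deriv u y * (u y)⁻¹ * (u y)⁻¹) := by
        funext y
        rw [((smooth_hasDeriv hu y).fun_inv (hu0 y).ne').deriv]
        have := (hu0 y).ne'
        field_simp
      rw [hd]
      have a1 := hC B u x hB hu hu0 hx (h.of_le (Nat.le_succ r))
      have hu' := smooth_deriv hu
      have := ((h1.2.mul hu' hi a1).mul (hu'.mul hi) hi a1).neg
      refine this.le hB ?_
      calc _ = (4 ^ r * K * C * C) * B := by
            rw [show (4 : ℝ) = 2 * 2 by norm_num, mul_pow]; ring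
        _ ≤ _ := by gcongr; exact le_max_right _ _

theorem abs_sub_le_of_deriv {u : ℝ → ℝ} (hu : Differentiable ℝ u) {K x y : ℝ}
    (h : ∀ z ∈ Set.uIcc x y, |deriv u z| ≤ K) : |u x - u y| ≤ K * |x - y| := by
  have := (convex_uIcc x y).norm_image_sub_le_of_norm_deriv_le (f := u) (C := K)
    (fun z _ => hu z) h (Set.right_mem_uIcc) (Set.left_mem_uIcc)
  simpa using this

theorem jetBound_comp_sub (r : ℕ) (κ : ℝ) : ∃ C : ℝ, 1 ≤ C ∧
    ∀ (K b B δ : ℝ) (u v w : ℝ → ℝ) (x : ℝ),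
    0 < b → 0 ≤ B → ContDiff ℝ ∞ u → ContDiff ℝ ∞ v → ContDiff ℝ ∞ w →
    (∀ y ∈ Set.uIcc (v x) (w x), JetBound r K b (deriv u) y) →
    (0 < r → JetBound (r - 1) (κ * B / b) B (deriv v) x) →
    (0 < r → JetBound (r - 1) (κ * B / b) B (deriv w) x) →
    JetBound r δ B (fun y => v y - w y) x →
    JetBound r (C * (K * δ)) B (fun y => u (v y) - u (w y)) x := by
  induction r with
  | zero =>
    refine ⟨1, le_rfl, fun K b B δ u v w x hb hB hu hv hw h _ _ hd => ?_⟩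
    rw [jetBound_zero] at *
    have hKb : 0 ≤ K := (h _ Set.left_mem_uIcc).nonneg
    calc _ ≤ K * |v x - w x| := abs_sub_le_of_deriv (smooth_diff hu)
          fun z hz => (h z hz).val
      _ ≤ _ := by rw [one_mul]; gcongr
  | succ r ih =>
    obtain ⟨C, hC1, hC⟩ := ih
    obtain ⟨C', hC1', hC'⟩ := jetBound_comp r κ
    refine ⟨max 1 (2 ^ r * C * κ + 2 ^ r * C'), le_max_left _ _,
      fun K b B δ u v w x hb hB hu hv hw h hv' hw' hd => ?_⟩
    have hKb : 0 ≤ K := (h _ Set.left_mem_uIcc).nonneg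
    have hδ := hd.nonneg
    have hd1 := jetBound_succ.1 hd
    rw [jetBound_succ]
    constructor
    · calc _ ≤ K * |v x - w x| := abs_sub_le_of_deriv (smooth_diff hu)
            fun z hz => (h z hz).val
        _ ≤ 1 * (K * δ) := by rw [one_mul]; gcongr; exact hd1.1
        _ ≤ _ := by gcongr; exact le_max_left _ _
    · have hu' := smooth_deriv hu
      have hV := smooth_deriv hv
      have hW := smooth_deriv hw
      have e : deriv (fun y => u (v y) - u (w y)) = fun y =>
          (deriv u (v y) - deriv u (w y)) * deriv v y
            + deriv u (w y) * (deriv v y - deriv w y) := by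
        funext y
        refine (((smooth_hasDeriv hu (v y)).comp y (smooth_hasDeriv hv y)).sub
          ((smooth_hasDeriv hu (w y)).comp y (smooth_hasDeriv hw y))).deriv.trans ?_
        ring
      rw [e]
      have e2 : deriv (fun y => v y - w y) = fun y => deriv v y - deriv w y := by
        funext y
        exact ((smooth_hasDeriv hv y).sub (smooth_hasDeriv hw y)).deriv
      have hvr : JetBound r (κ * B / b) B (deriv v) x := hv' (Nat.succ_pos r)
      have hwr : JetBound r (κ * B / b) B (deriv w) x := hw' (Nat.succ_pos r)
      have a := hC (K * b) b B δ (deriv u) v w x hb hB hu' hv hw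
        (fun y hy => (jetBound_succ.1 (h y hy)).2)
        (fun _ => hvr.of_le (Nat.sub_le _ _)) (fun _ => hwr.of_le (Nat.sub_le _ _))
        (hd.of_le (Nat.le_succ r))
      have a' := hC' K b B (deriv u) w x hb hB hu' hw
        ((h _ Set.right_mem_uIcc).of_le (Nat.le_succ r))
        (fun _ => hwr.of_le (Nat.sub_le _ _))
      have s1 := a.mul ((hu'.comp hv).sub (hu'.comp hw)) hV hvr
      have s2 := a'.mul (hu'.comp hw) (hV.sub hW) (e2 ▸ hd1.2)
      refine (s1.add (((hu'.comp hv).sub (hu'.comp hw)).mul hV)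
        ((hu'.comp hw).mul (hV.sub hW)) s2).le hB ?_
      calc _ = (2 ^ r * C * κ + 2 ^ r * C') * (K * δ * B) := by field_simp
        _ ≤ max 1 (2 ^ r * C * κ + 2 ^ r * C') * (K * δ * B) := by
            gcongr; exact le_max_right _ _
        _ = _ := by ring

theorem jetBound_inverse (r : ℕ) (κ a : ℝ) (ha : 0 < a) : ∃ C : ℝ, 0 < C ∧
    ∀ (B : ℝ) (k u : ℝ → ℝ) (y : ℝ), 0 < B → ContDiff ℝ ∞ k → ContDiff ℝ ∞ u →
    (∀ x, 0 < deriv k x) → (∀ x, k (u x) = x) → (∀ x, u (k x) = x) → a ≤ deriv k y →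
    JetBound r κ B (deriv k) y → JetBound r C B (deriv u) (k y) := by
  have key : ∀ (k u : ℝ → ℝ), ContDiff ℝ ∞ k → ContDiff ℝ ∞ u →
    (∀ x, 0 < deriv k x) → (∀ x, k (u x) = x) →
      deriv u = fun x => (deriv k (u x))⁻¹ := by
    intro k u hk hu hk0 hku
    funext x
    have h := (smooth_hasDeriv hk (u x)).comp x (smooth_hasDeriv hu x)
    have h2 : k ∘ u = fun x => x := funext hku
    rw [h2] at h
    have := h.unique (hasDerivAt_id' x)
    exact eq_inv_of_mul_eq_one_right this
  induction r with
  | zero =>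
    refine ⟨a⁻¹, by positivity, fun B k u y hB hk hu hk0 hku huk hy h => ?_⟩
    rw [jetBound_zero, key k u hk hu hk0 hku]
    simp only [huk]
    rw [abs_of_pos (inv_pos.2 (hk0 y))]
    exact inv_anti₀ ha hy
  | succ r ih =>
    obtain ⟨C, hC0, hC⟩ := ih
    obtain ⟨C1, hC1, hC1'⟩ := jetBound_inv (r + 1) κ a ha
    obtain ⟨C2, hC2, hC2'⟩ := jetBound_comp (r + 1) C
    refine ⟨C2 * C1, by positivity, fun B k u y hB hk hu hk0 hku huk hy h => ?_⟩
    have a1 := hC B k u y hB hk hu hk0 hku huk hy (h.of_le (Nat.le_succ r))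
    have hk' := smooth_deriv hk
    have a2 := hC1' B (deriv k) y hB.le hk' hk0 hy h
    rw [key k u hk hu hk0 hku]
    refine hC2' C1 B B (fun x => (deriv k x)⁻¹) u (k y) hB hB.le
      (hk'.inv fun y => (hk0 y).ne') hu (by rw [huk]; exact a2) (fun _ => ?_)
    rw [mul_div_assoc, div_self hB.ne', mul_one]
    exact a1

/-- Lifts of orientation-preserving smooth circle diffeomorphisms, with their inverses. -/
structure SLift where
  /-- The underlying function. -/
  toFun : ℝ → ℝ
  /-- The inverse function. -/
  invFun : ℝ → ℝ
  smooth' : ContDiff ℝ ∞ toFun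
  smooth_inv' : ContDiff ℝ ∞ invFun
  map_add_one' : ∀ x, toFun (x + 1) = toFun x + 1
  right_inv' : ∀ x, toFun (invFun x) = x
  left_inv' : ∀ x, invFun (toFun x) = x
  deriv_pos' : ∀ x, 0 < deriv toFun x

namespace SLift

instance : CoeFun SLift (fun _ => ℝ → ℝ) := ⟨toFun⟩

theorem ext' {f g : SLift} (h : ∀ x, f x = g x) : f = g := by
  have h1 : f.toFun = g.toFun := funext h
  have h2 : f.invFun = g.invFun := by
    funext x
    have := f.left_inv' (g.invFun x)
    rw [h, g.right_inv'] at this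
    exact this
  cases f; cases g; simp_all

theorem deriv_invFun (f : SLift) (x : ℝ) : deriv f.invFun x = (deriv f (f.invFun x))⁻¹ := by
  have h := (smooth_hasDeriv f.smooth' (f.invFun x)).comp x (smooth_hasDeriv f.smooth_inv' x)
  have h2 : f.toFun ∘ f.invFun = fun x => x := funext f.right_inv'
  rw [h2] at h
  exact eq_inv_of_mul_eq_one_right (h.unique (hasDerivAt_id' x))

theorem deriv_comp (f g : SLift) (x : ℝ) :
    deriv (fun y => f (g y)) x = deriv f (g x) * deriv g x :=
  congrFun (deriv_comp_eq f.smooth' g.smooth') x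

instance : Mul SLift := ⟨fun f g =>
  { toFun := fun x => f (g x)
    invFun := fun x => g.invFun (f.invFun x)
    smooth' := f.smooth'.comp g.smooth'
    smooth_inv' := g.smooth_inv'.comp f.smooth_inv'
    map_add_one' := fun x => by rw [g.map_add_one', f.map_add_one']
    right_inv' := fun x => by rw [g.right_inv', f.right_inv']
    left_inv' := fun x => by rw [f.left_inv', g.left_inv']
    deriv_pos' := fun x => by
      rw [deriv_comp]; exact mul_pos (f.deriv_pos' _) (g.deriv_pos' _) }⟩

instance : One SLift := ⟨
  { toFun := fun x => x
    invFun := fun x => x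
    smooth' := contDiff_id
    smooth_inv' := contDiff_id
    map_add_one' := fun _ => rfl
    right_inv' := fun _ => rfl
    left_inv' := fun _ => rfl
    deriv_pos' := fun x => by simp }⟩

instance : Inv SLift := ⟨fun f =>
  { toFun := f.invFun
    invFun := f.toFun
    smooth' := f.smooth_inv'
    smooth_inv' := f.smooth'
    map_add_one' := fun x => by
      have := f.map_add_one' (f.invFun x)
      rw [f.right_inv'] at this
      rw [← this, f.left_inv']
    right_inv' := f.left_inv'
    left_inv' := f.right_inv'
    deriv_pos' := fun x => by
      rw [deriv_invFun]; exact inv_pos.2 (f.deriv_pos' _) }⟩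

instance : Group SLift :=
  Group.ofLeftAxioms (fun _ _ _ => rfl) (fun _ => rfl) (fun f => ext' fun x => f.left_inv' x)

theorem mul_apply (f g : SLift) (x : ℝ) : (f * g) x = f (g x) := rfl

theorem one_apply (x : ℝ) : (1 : SLift) x = x := rfl

theorem inv_apply_self (f : SLift) (x : ℝ) : f⁻¹ (f x) = x := f.left_inv' x

theorem apply_inv_self (f : SLift) (x : ℝ) : f (f⁻¹ x) = x := f.right_inv' x

theorem smooth (f : SLift) : ContDiff ℝ ∞ f := f.smooth'

theorem dsmooth (f : SLift) : ContDiff ℝ ∞ (deriv f) := smooth_deriv f.smooth'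

theorem dpos (f : SLift) (x : ℝ) : 0 < deriv f x := f.deriv_pos' x

theorem hasDeriv (f : SLift) (x : ℝ) : HasDerivAt f (deriv f x) x := smooth_hasDeriv f.smooth x

theorem continuous (f : SLift) : Continuous f := f.smooth.continuous

theorem deriv_mul (f g : SLift) (x : ℝ) : deriv (f * g : SLift) x = deriv f (g x) * deriv g x :=
  deriv_comp f g x

theorem deriv_inv (f : SLift) (x : ℝ) : deriv (f⁻¹ : SLift) x = (deriv f (f⁻¹ x))⁻¹ :=
  deriv_invFun f x

theorem deriv_inv_apply (f : SLift) (x : ℝ) : deriv (f⁻¹ : SLift) (f x) = (deriv f x)⁻¹ := by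
  rw [deriv_inv, inv_apply_self]

theorem strictMono (f : SLift) : StrictMono f := strictMono_of_deriv_pos f.dpos

theorem map_add_one (f : SLift) (x : ℝ) : f (x + 1) = f x + 1 := f.map_add_one' x

theorem map_add_int (f : SLift) (x : ℝ) (n : ℤ) : f (x + n) = f x + n := by
  induction n with
  | zero => simp
  | succ i ih => push_cast at *; rw [← add_assoc, map_add_one, ih]; ring
  | pred i ih =>
    push_cast at *
    have := f.map_add_one (x + (-(i : ℝ) - 1))
    rw [show x + (-(i : ℝ) - 1) + 1 = x + -i by ring, ih] at this
    linarith

theorem map_sub_int (f : SLift) (x : ℝ) (n : ℤ) : f (x - n) = f x - n := by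
  have := f.map_add_int x (-n)
  push_cast at this
  simpa [sub_eq_add_neg] using this

theorem deriv_add_int (f : SLift) (x : ℝ) (n : ℤ) : deriv f (x + n) = deriv f x := by
  have h : (fun y => f (y + n)) = fun y => f y + n := funext fun y => f.map_add_int y n
  rw [← deriv_comp_add_const, h, deriv_add_const]

/-- The rotation by `a`. -/
def rot (a : ℝ) : SLift where
  toFun x := x + a
  invFun x := x - a
  smooth' := contDiff_id.add contDiff_const
  smooth_inv' := contDiff_id.sub contDiff_const
  map_add_one' x := by ring
  right_inv' x := by ring
  left_inv' x := by ring
  deriv_pos' x := by simp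

theorem rot_apply (a x : ℝ) : rot a x = x + a := rfl

theorem deriv_rot (a x : ℝ) : deriv (rot a) x = 1 := by
  change deriv (fun y => y + a) x = 1
  simp

theorem rot_mul (a b : ℝ) : rot a * rot b = rot (a + b) :=
  ext' fun x => by simp only [mul_apply, rot_apply]; ring

theorem rot_zero : rot 0 = 1 := ext' fun x => by simp [rot_apply, one_apply]

theorem rot_inv (a : ℝ) : (rot a)⁻¹ = rot (-a) := by
  rw [inv_eq_iff_mul_eq_one, rot_mul, add_neg_cancel, rot_zero]

theorem rot_zpow (a : ℝ) (i : ℤ) : rot a ^ i = rot (i * a) := by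
  induction i with
  | zero => simp [rot_zero]
  | succ i ih => rw [zpow_add_one, ih, rot_mul]; congr 1; push_cast; ring
  | pred i ih => rw [zpow_sub_one, ih, rot_inv, rot_mul]; congr 1; push_cast; ring

theorem rot_int_comm (f : SLift) (n : ℤ) : f * rot n = rot n * f :=
  ext' fun x => by simp only [mul_apply, rot_apply, map_add_int]

/-- A circle diffeomorphism moves differences by at most one. -/
theorem abs_apply_sub_apply (f : SLift) (x y : ℝ) : |f y - f x - (y - x)| ≤ 1 := by
  have key : ∀ u v : ℝ, f u - f v - (u - v) ≤ 1 := by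
    intro u v
    have h1 : u ≤ v + (⌊u - v⌋ + 1 : ℤ) := by
      push_cast; linarith [Int.lt_floor_add_one (u - v)]
    have h2 := f.strictMono.monotone h1
    rw [map_add_int] at h2
    push_cast at h2
    linarith [Int.floor_le (u - v)]
  rw [abs_le]
  constructor
  · linarith [key x y]
  · exact key y x

/-- The lift attached to a smooth circle diffeomorphism. -/
theorem exists_of {f : ℝ → ℝ} (h : ContDiff ℝ ∞ f) (h1 : ∀ x, f (x + 1) = f x + 1)
    (h2 : ∀ x, 0 < deriv f x) : ∃ F : SLift, F.toFun = f := by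
  have mono : StrictMono f := strictMono_of_deriv_pos h2
  have hshift : ∀ n : ℕ, f n = f 0 + n ∧ f (-n) = f 0 - n := by
    intro n
    induction n with
    | zero => simp
    | succ n ih =>
      constructor
      · push_cast; rw [h1, ih.1]; ring
      · push_cast
        have := h1 (-((n : ℝ) + 1))
        rw [show -((n : ℝ) + 1) + 1 = -n by ring, ih.2] at this
        linarith
  have surj : Function.Surjective f := by
    intro y
    obtain ⟨n, hn⟩ := exists_nat_gt |y - f 0|
    have a1 := abs_lt.1 hn
    have := intermediate_value_Icc (a := -(n : ℝ)) (b := n)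
        (by linarith [Nat.cast_nonneg (α := ℝ) n])
      h.continuous.continuousOn
    rw [(hshift n).1, (hshift n).2] at this
    obtain ⟨x, -, hx⟩ := this (show y ∈ _ by constructor <;> linarith [a1.1, a1.2])
    exact ⟨x, hx⟩
  let e : ℝ ≃o ℝ := StrictMono.orderIsoOfSurjective f mono surj
  have hs : ContDiff ℝ ∞ e.symm := Homeomorph.contDiff_symm_deriv e.toHomeomorph (f' := deriv f)
      (fun x => (h2 x).ne')
    (fun x => smooth_hasDeriv h x) h
  exact ⟨⟨f, e.symm, h, hs, h1, fun x => e.apply_symm_apply x, fun x => e.symm_apply_apply x, h2⟩,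
    rfl⟩

end SLift

theorem bounded_of_periodic {u : ℝ → ℝ} (hu : Continuous u) (hp : Function.Periodic u 1) :
    ∃ K, 0 < K ∧ ∀ x, |u x| ≤ K := by
  obtain ⟨K, hK⟩ := (isCompact_Icc (a := (0 : ℝ)) (b := 1)).exists_bound_of_continuousOn
    hu.continuousOn
  refine ⟨max K 1, lt_max_of_lt_right one_pos, fun x => ?_⟩
  obtain ⟨y, hy, hxy⟩ := hp.exists_mem_Ico₀ one_pos x
  rw [hxy]
  exact (hK y ⟨hy.1, hy.2.le⟩).trans (le_max_left _ _)

theorem periodic_iteratedDeriv {u : ℝ → ℝ} (hp : Function.Periodic u 1) (j : ℕ) :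
    Function.Periodic (iteratedDeriv j u) 1 := by
  intro x
  have h : (fun y => u (y + 1)) = u := funext hp
  conv_rhs => rw [← h]
  rw [iteratedDeriv_comp_add_const]

theorem jets_bounded_of_periodic {u : ℝ → ℝ} (hu : ContDiff ℝ ∞ u)
    (hp : Function.Periodic u 1) (r : ℕ) : ∃ K, 1 ≤ K ∧ ∀ x, JetBound r K 1 u x := by
  choose K _ hK using fun j =>
    bounded_of_periodic (smooth_iter hu j).continuous (periodic_iteratedDeriv hp j)
  refine ⟨1 + ∑ j ∈ Finset.range (r + 1), |K j|, ?_, fun x j hj => ?_⟩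
  · linarith [Finset.sum_nonneg (s := Finset.range (r + 1)) fun j _ => abs_nonneg (K j)]
  · have := Finset.single_le_sum (f := fun j => |K j|) (fun j _ => abs_nonneg (K j))
      (Finset.mem_range.2 (Nat.lt_succ_of_le hj))
    rw [one_pow, mul_one]
    linarith [hK j x, le_abs_self (K j)]

theorem SLift.dperiodic (f : SLift) : Function.Periodic (deriv f) 1 := fun x => by
  simpa using f.deriv_add_int x 1

theorem SLift.jets_bounded (f : SLift) (r : ℕ) : ∃ K, 1 ≤ K ∧ ∀ x, JetBound r K 1 (deriv f) x :=
  jets_bounded_of_periodic f.dsmooth f.dperiodic r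

theorem SLift.deriv_lower (f : SLift) : ∃ a, 0 < a ∧ ∀ x, a ≤ deriv f x := by
  obtain ⟨K, hK, h⟩ := (f⁻¹).jets_bounded 0
  refine ⟨K⁻¹, by positivity, fun x => ?_⟩
  have := (h (f x)).val
  rw [SLift.deriv_inv_apply, abs_of_pos (inv_pos.2 (f.dpos x))] at this
  exact inv_le_of_inv_le₀ (f.dpos x) this

/-- Uniform closeness of all derivatives up to order `r`. -/
def CloseTo (r : ℕ) (ε : ℝ) (f g : ℝ → ℝ) : Prop :=
  ∀ x, JetBound r ε 1 (fun y => f y - g y) x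

theorem CloseTo.mono {r r' : ℕ} {ε ε' : ℝ} {f g : ℝ → ℝ} (h : CloseTo r ε f g) (hr : r' ≤ r)
    (hε : ε ≤ ε') : CloseTo r' ε' f g := fun x => (h x).mono hr hε zero_le_one le_rfl

theorem CloseTo.symm {r : ℕ} {ε : ℝ} {f g : ℝ → ℝ} (h : CloseTo r ε f g) : CloseTo r ε g f := by
  intro x
  simpa using (h x).neg

theorem CloseTo.refl (r : ℕ) {ε : ℝ} (hε : 0 ≤ ε) (f : ℝ → ℝ) : CloseTo r ε f f := by
  intro x
  have := jetBound_const r zero_le_one 0 x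
  simp only [sub_self]
  exact this.le zero_le_one (by simpa using hε)

theorem CloseTo.trans {r : ℕ} {ε ε' : ℝ} {f g h : ℝ → ℝ} (hf : ContDiff ℝ ∞ f)
    (hg : ContDiff ℝ ∞ g) (hh : ContDiff ℝ ∞ h) (h1 : CloseTo r ε f g) (h2 : CloseTo r ε' g h) :
    CloseTo r (ε + ε') f h := by
  intro x
  have := (h1 x).add (hf.sub hg) (hg.sub hh) (h2 x)
  simpa using this

theorem CloseTo.abs_sub {r : ℕ} {ε : ℝ} {f g : ℝ → ℝ} (h : CloseTo r ε f g) (x : ℝ) :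
    |f x - g x| ≤ ε := (h x).val

theorem deriv_sub_eq {u v : ℝ → ℝ} (hu : ContDiff ℝ ∞ u) (hv : ContDiff ℝ ∞ v) :
    deriv (fun y => u y - v y) = fun y => deriv u y - deriv v y := by
  funext y
  exact ((smooth_hasDeriv hu y).sub (smooth_hasDeriv hv y)).deriv

theorem CloseTo.deriv {r : ℕ} {ε : ℝ} {f g : ℝ → ℝ} (hf : ContDiff ℝ ∞ f) (hg : ContDiff ℝ ∞ g)
    (h : CloseTo (r + 1) ε f g) : CloseTo r ε (deriv f) (deriv g) := by
  intro x
  have := (jetBound_succ.1 (h x)).2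
  rw [deriv_sub_eq hf hg] at this
  simpa using this

theorem CloseTo.jetBound {r : ℕ} {ε K x : ℝ} {f g : ℝ → ℝ} (hf : ContDiff ℝ ∞ f)
    (hg : ContDiff ℝ ∞ g) (h : CloseTo r ε f g) (hK : JetBound r K 1 g x) :
    JetBound r (ε + K) 1 f x := by
  have := (h x).add (hf.sub hg) hg hK
  simpa using this

/-- Inversion is continuous for the `C^r` topology. -/
theorem close_inv (g : SLift) (r : ℕ) (ε : ℝ) (hε : 0 < ε) : ∃ δ, 0 < δ ∧
    ∀ f : SLift, CloseTo (r + 1) δ f g → CloseTo r ε (f⁻¹ : SLift) (g⁻¹ : SLift) := by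
  obtain ⟨K, hK1, hK⟩ := g.jets_bounded r
  obtain ⟨a, ha, hga⟩ := g.deriv_lower
  obtain ⟨K', hK1', hK'⟩ := (g⁻¹).jets_bounded r
  obtain ⟨C1, hC1, hC1'⟩ := jetBound_inverse r (a / 2 + K) (a / 2) (by positivity)
  obtain ⟨C2, hC2, hC2'⟩ := jetBound_comp r C1
  obtain ⟨C3, hC3, hC3'⟩ := jetBound_comp_sub r (C2 * (a / 2) + 1)
  set C := C3 * (K' * C2) with hC
  have hCpos : 0 < C := by positivity
  refine ⟨min (a / 2) (ε / C), by positivity, fun f hf x => ?_⟩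
  set δ := min (a / 2) (ε / C) with hδ
  have hδ0 : 0 < δ := by positivity
  have hδa : δ ≤ a / 2 := min_le_left _ _
  have hfd := hf.deriv f.smooth g.smooth
  have dfb : ∀ y, JetBound r (a / 2 + K) 1 (deriv f) y := fun y =>
    (hfd.jetBound f.dsmooth g.dsmooth (hK y)).le zero_le_one (by linarith)
  have dfl : ∀ y, a / 2 ≤ deriv f y := fun y => by
    have := abs_le.1 (hfd.abs_sub y)
    linarith [hga y, this.1]
  have dfi : ∀ y, JetBound r C1 1 (deriv (f⁻¹ : SLift)) y := fun y => by
    have := hC1' 1 f (f⁻¹ : SLift) (f⁻¹ y) one_pos f.smooth (f⁻¹).smooth f.dpos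
      f.apply_inv_self f.inv_apply_self (dfl _) (dfb _)
    rwa [f.apply_inv_self] at this
  -- `v = g ∘ f⁻¹` is close to the identity
  have hv : ContDiff ℝ ∞ (fun y => g (f⁻¹ y)) := g.smooth.comp (f⁻¹).smooth
  have hvw : ∀ y, JetBound r (C2 * δ) 1 (fun y => g (f⁻¹ y) - y) y := fun y => by
    have := hC2' δ 1 1 (fun y => g y - f y) (f⁻¹ : SLift) y one_pos zero_le_one
      (g.smooth.sub f.smooth) (f⁻¹).smooth ((hf.symm _).of_le (Nat.le_succ r))
      (fun _ => by simpa using (dfi y).of_le (Nat.sub_le _ _))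
    simpa only [SLift.apply_inv_self] using this
  have hw' : JetBound r 1 1 (deriv fun y : ℝ => y) x := by
    rw [deriv_id_eq]; simpa using jetBound_const r zero_le_one 1 x
  have hv' : 0 < r → JetBound (r - 1) (C2 * (a / 2) + 1) 1 (deriv fun y => g (f⁻¹ y)) x := by
    intro hr
    obtain ⟨s, rfl⟩ : ∃ s, r = s + 1 := ⟨r - 1, by omega⟩
    have h1 := (jetBound_succ.1 (hvw x)).2
    rw [deriv_sub_eq hv smooth_id] at h1
    have h2 := h1.add ((smooth_deriv hv).sub (smooth_deriv smooth_id))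
      (smooth_deriv smooth_id) (hw'.of_le (Nat.le_succ s))
    simp only [sub_add_cancel] at h2
    refine h2.le zero_le_one ?_
    rw [mul_one]
    gcongr
  have := hC3' K' 1 1 (C2 * δ) (g⁻¹ : SLift) (fun y => g (f⁻¹ y)) (fun y => y) x one_pos
    zero_le_one (g⁻¹).smooth hv smooth_id (fun y _ => hK' y) (by simpa using hv')
    (fun _ => hw'.mono (Nat.sub_le _ _) (by
      rw [mul_one, div_one, le_add_iff_nonneg_left]; positivity) zero_le_one le_rfl) (hvw x)
  simp only [SLift.inv_apply_self] at this
  refine this.le zero_le_one ?_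
  calc C3 * (K' * (C2 * δ)) = C * δ := by rw [hC]; ring
    _ ≤ C * (ε / C) := by gcongr; exact min_le_right _ _
    _ = ε := by field_simp

theorem exists_lift_of_density {u : ℝ → ℝ} (hu : ContDiff ℝ ∞ u) (hp : Function.Periodic u 1)
    (hpos : ∀ x, 0 < u x) (hmean : ∫ x in (0 : ℝ)..1, u x = 1) :
    ∃ k : SLift, deriv k = u := by
  have hd : ∀ x, HasDerivAt (fun x => ∫ t in (0 : ℝ)..x, u t) (u x) x := fun x =>
    intervalIntegral.integral_hasDerivAt_right (hu.continuous.intervalIntegrable _ _)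
      (hu.continuous.stronglyMeasurableAtFilter _ _) hu.continuous.continuousAt
  have hde : deriv (fun x => ∫ t in (0 : ℝ)..x, u t) = u := funext fun x => (hd x).deriv
  obtain ⟨k, hk⟩ := SLift.exists_of (f := fun x => ∫ t in (0 : ℝ)..x, u t)
    (contDiff_infty_iff_deriv.2 ⟨fun x => (hd x).differentiableAt, by rw [hde]; exact hu⟩)
    (fun x => by
      rw [← intervalIntegral.integral_add_adjacent_intervals
        (hu.continuous.intervalIntegrable _ _) (hu.continuous.intervalIntegrable x _),
        hp.intervalIntegral_add_eq x 0, zero_add, hmean])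
    (fun x => by rw [hde]; exact hpos x)
  exact ⟨k, by rw [hk, hde]⟩

/-- A circle diffeomorphism which is piecewise linear with slopes `c` and `c * lam`, up to a small
set. -/
theorem exists_two_slope {lam : ℝ} (hlam : 1 < lam) {s : ℝ} (hs : 0 < s) :
    ∃ k : SLift, ∃ c : ℝ, 0 < c ∧ (∀ x, lam⁻¹ ≤ deriv k x ∧ deriv k x ≤ lam) ∧
      (∀ x, s ≤ Real.sin (2 * Real.pi * x) → deriv k x = c) ∧
      (∀ x, Real.sin (2 * Real.pi * x) ≤ -s → deriv k x = c * lam) := by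
  set w : ℝ → ℝ := fun x =>
    Real.smoothTransition ((1 - Real.sin (2 * Real.pi * x) / s) / 2) with hw
  set v : ℝ → ℝ := fun x => 1 + (lam - 1) * w x with hv
  have hws : ContDiff ℝ ∞ w := by
    refine Real.smoothTransition.contDiff.comp ?_
    fun_prop
  have hvs : ContDiff ℝ ∞ v := contDiff_const.add (contDiff_const.mul hws)
  have hv1 : ∀ x, 1 ≤ v x := fun x => by
    have := mul_nonneg (sub_nonneg.2 hlam.le)
      (Real.smoothTransition.nonneg ((1 - Real.sin (2 * Real.pi * x) / s) / 2))
    simp only [hv, hw]; linarith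
  have hv2 : ∀ x, v x ≤ lam := fun x => by
    have := mul_le_mul_of_nonneg_left
      (Real.smoothTransition.le_one ((1 - Real.sin (2 * Real.pi * x) / s) / 2))
      (sub_nonneg.2 hlam.le)
    simp only [hv, hw]; linarith
  have hvp : Function.Periodic v 1 := fun x => by
    simp only [hv, hw]
    rw [mul_add, mul_one, Real.sin_add_two_pi]
  set I := ∫ x in (0 : ℝ)..1, v x with hI
  have hvi : IntervalIntegrable v volume 0 1 := hvs.continuous.intervalIntegrable _ _
  have hI1 : 1 ≤ I := by
    have := intervalIntegral.integral_mono_on (a := 0) (b := 1) zero_le_one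
      (intervalIntegrable_const (c := (1 : ℝ))) hvi (fun x _ => hv1 x)
    simpa using this
  have hI2 : I ≤ lam := by
    have := intervalIntegral.integral_mono_on (a := 0) (b := 1) zero_le_one hvi
      (intervalIntegrable_const (c := lam)) (fun x _ => hv2 x)
    simpa using this
  have hI0 : 0 < I := by linarith
  obtain ⟨k, hk⟩ := exists_lift_of_density (u := fun x => I⁻¹ * v x) (contDiff_const.mul hvs)
    (fun x => by simp only [hvp x]) (fun x => mul_pos (inv_pos.2 hI0) (by linarith [hv1 x]))
    (by rw [intervalIntegral.integral_const_mul, ← hI, inv_mul_cancel₀ hI0.ne'])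
  refine ⟨k, I⁻¹, inv_pos.2 hI0, fun x => ?_, fun x hx => ?_, fun x hx => ?_⟩
  · rw [hk]
    constructor
    · calc lam⁻¹ ≤ I⁻¹ * 1 := by rw [mul_one]; exact inv_anti₀ hI0 hI2
        _ ≤ I⁻¹ * v x := by gcongr; exact hv1 x
    · calc I⁻¹ * v x ≤ 1 * lam := by
            gcongr
            · linarith [hv1 x]
            · exact inv_le_one_of_one_le₀ hI1
            · exact hv2 x
        _ = lam := one_mul _
  · have : w x = 0 := Real.smoothTransition.zero_of_nonpos (by
      rw [← div_self hs.ne'] ; have := (div_le_div_iff_of_pos_right hs).2 hx; linarith)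
    rw [hk]; simp [hv, this]
  · have : w x = 1 := Real.smoothTransition.one_of_one_le (by
      have := (div_le_div_iff_of_pos_right hs).2 hx
      rw [neg_div, div_self hs.ne'] at this; linarith)
    rw [hk]; simp [hv, this]

/-- Conjugation of `k` by multiplication by `q`. -/
def SLift.scale (k : SLift) (q : ℕ) (hq : 0 < q) : SLift where
  toFun x := k (q * x) / q
  invFun x := k⁻¹ (q * x) / q
  smooth' := (k.smooth.comp (contDiff_const.mul contDiff_id)).div_const _
  smooth_inv' := ((k⁻¹).smooth.comp (contDiff_const.mul contDiff_id)).div_const _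
  map_add_one' x := by
    have := k.map_add_int (q * x) q
    push_cast at this
    rw [mul_add, mul_one, this]
    field_simp
  right_inv' x := by
    rw [mul_div_cancel₀ _ (by positivity), k.apply_inv_self]; field_simp
  left_inv' x := by
    rw [mul_div_cancel₀ _ (by positivity), k.inv_apply_self]; field_simp
  deriv_pos' x := by
    have hq' : (0 : ℝ) < q := by exact_mod_cast hq
    have := ((k.hasDeriv (q * x)).comp x ((hasDerivAt_id' x).const_mul (q : ℝ))).div_const (q : ℝ)
    have h := this.deriv
    simp only [Function.comp_def] at h
    rw [h]
    have := k.dpos (q * x)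
    positivity

theorem SLift.scale_apply (k : SLift) (q : ℕ) (hq : 0 < q) (x : ℝ) :
    k.scale q hq x = k (q * x) / q := rfl

theorem SLift.scale_inv_apply (k : SLift) (q : ℕ) (hq : 0 < q) (x : ℝ) :
    (k.scale q hq)⁻¹ x = k⁻¹ (q * x) / q := rfl

theorem SLift.deriv_scale (k : SLift) (q : ℕ) (hq : 0 < q) (x : ℝ) :
    deriv (k.scale q hq) x = deriv k (q * x) := by
  have hq' : (q : ℝ) ≠ 0 := by positivity
  have := ((k.hasDeriv (q * x)).comp x ((hasDerivAt_id' x).const_mul (q : ℝ))).div_const (q : ℝ)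
  have h := this.deriv
  simp only [Function.comp_def] at h
  refine Eq.trans ?_ (h.trans ?_)
  · rfl
  · field_simp

/-- The `i`-th iterate of the conjugate by `H` of the rotation by `α`. -/
def conj (H : SLift) (α : ℝ) (i : ℤ) : SLift := H * SLift.rot (i * α) * H⁻¹

theorem conj_apply (H : SLift) (α : ℝ) (i : ℤ) (x : ℝ) : conj H α i x = H (H⁻¹ x + i * α) := rfl

theorem conj_add (H : SLift) (α : ℝ) (i j : ℤ) : conj H α (i + j) = conj H α i * conj H α j := by
  simp only [conj]
  push_cast
  rw [add_mul, ← SLift.rot_mul]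
  group

theorem deriv_conj (H : SLift) (α : ℝ) (i : ℤ) (x : ℝ) :
    deriv (conj H α i) x = deriv H (H⁻¹ x + i * α) / deriv H (H⁻¹ x) := by
  rw [conj, SLift.deriv_mul, SLift.deriv_mul, SLift.deriv_inv, SLift.deriv_rot, mul_one]
  rfl

/-- Conjugation by a fixed diffeomorphism is Lipschitz at rotations. -/
theorem close_conj (H : SLift) (r : ℕ) : ∃ C, 0 < C ∧ ∀ (δ : ℝ) (P : SLift) (a : ℝ), δ ≤ 1 →
    CloseTo r δ P (SLift.rot a) →
    CloseTo r (C * δ) (H * P * H⁻¹ : SLift) (H * SLift.rot a * H⁻¹ : SLift) := by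
  obtain ⟨K, hK1, hK⟩ := H.jets_bounded r
  obtain ⟨K', hK1', hK'⟩ := (H⁻¹).jets_bounded r
  obtain ⟨C2, hC2, hC2'⟩ := jetBound_comp r K'
  obtain ⟨C3, hC3, hC3'⟩ := jetBound_comp_sub r 2
  refine ⟨C2 * (C3 * K), by positivity, fun δ P a hδ1 hP x => ?_⟩
  have hδ : 0 ≤ δ := (hP 0).nonneg
  have hR : deriv (SLift.rot a) = fun _ => (1 : ℝ) := funext fun x => SLift.deriv_rot a x
  have hR' : ∀ y, JetBound (r - 1) 1 1 (deriv (SLift.rot a)) y := fun y => by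
    rw [hR]; simpa using jetBound_const (r - 1) zero_le_one 1 y
  have hPd : 0 < r → ∀ y, JetBound (r - 1) 2 1 (deriv P) y := fun hr y => by
    obtain ⟨s, rfl⟩ : ∃ s, r = s + 1 := ⟨r - 1, by omega⟩
    have := hP.deriv P.smooth (SLift.rot a).smooth
    exact (this.jetBound P.dsmooth (SLift.rot a).dsmooth (hR' y)).le zero_le_one (by linarith)
  have a1 : ∀ y, JetBound r (C3 * (K * δ)) 1 (fun y => H (P y) - H (SLift.rot a y)) y := fun y =>
    hC3' K 1 1 δ H P (SLift.rot a) y one_pos zero_le_one H.smooth P.smooth (SLift.rot a).smooth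
      (fun z _ => hK z) (fun hr => by simpa using hPd hr y)
      (fun _ => (hR' y).le zero_le_one (by norm_num)) (hP y)
  have := hC2' (C3 * (K * δ)) 1 1 (fun y => H (P y) - H (SLift.rot a y)) (H⁻¹ : SLift) x one_pos
    zero_le_one ((H.smooth.comp P.smooth).sub (H.smooth.comp (SLift.rot a).smooth)) (H⁻¹).smooth
    (a1 _) (fun _ => by simpa using (hK' x).of_le (Nat.sub_le _ _))
  refine this.le zero_le_one (le_of_eq ?_)
  ring

theorem close_scale_rot (k : SLift) (r : ℕ) : ∃ C, 0 < C ∧ ∀ (q : ℕ) (hq : 0 < q) (a τ : ℝ) (p : ℤ),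
    q * a = p + q * τ →
    CloseTo r (C * q ^ (r + 1) * |τ|)
      (k.scale q hq * SLift.rot a * (k.scale q hq)⁻¹ : SLift) (SLift.rot a) := by
  obtain ⟨K, hK1, hK⟩ := k.jets_bounded r
  obtain ⟨K', hK1', hK'⟩ := (k⁻¹).jets_bounded r
  obtain ⟨C3, hC3, hC3'⟩ := jetBound_comp_sub r K'
  refine ⟨C3 * K + 1, by positivity, fun q hq a τ p h x => ?_⟩
  have hq1 : (1 : ℝ) ≤ q := by exact_mod_cast hq
  have hv : ContDiff ℝ ∞ (fun y => k⁻¹ y + q * τ) := (k⁻¹).smooth.add contDiff_const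
  have hvd : deriv (fun y => k⁻¹ y + q * τ) = deriv (k⁻¹ : SLift) := by
    funext y; rw [deriv_add_const]
  have a1 : ∀ y, JetBound r (C3 * (K * |q * τ|)) 1 (fun y => k (k⁻¹ y + q * τ) - k (k⁻¹ y)) y :=
    fun y => hC3' K 1 1 |q * τ| k (fun y => k⁻¹ y + q * τ) (k⁻¹ : SLift) y one_pos zero_le_one
      k.smooth hv (k⁻¹).smooth (fun z _ => hK z)
      (fun _ => by rw [hvd]; simpa using (hK' y).of_le (Nat.sub_le _ _))
      (fun _ => by simpa using (hK' y).of_le (Nat.sub_le _ _))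
      (by simpa using jetBound_const r zero_le_one (q * τ) y)
  set w := fun y => k (k⁻¹ y + q * τ) - k (k⁻¹ y) with hw
  have hws : ContDiff ℝ ∞ w := (k.smooth.comp hv).sub (k.smooth.comp (k⁻¹).smooth)
  have e : (fun y => (k.scale q hq * SLift.rot a * (k.scale q hq)⁻¹ : SLift) y - SLift.rot a y)
      = fun y => (q : ℝ)⁻¹ * w (q * y) - τ := by
    funext y
    simp only [SLift.mul_apply, SLift.scale_apply, SLift.scale_inv_apply, SLift.rot_apply, hw,
      SLift.apply_inv_self]
    have : (q : ℝ) * (k⁻¹ (q * y) / q + a) = k⁻¹ (q * y) + q * τ + p := by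
      rw [mul_add, h]; field_simp; ring
    rw [this, SLift.map_add_int]
    have hq0 : (q : ℝ) ≠ 0 := by positivity
    have ha : a = p / q + τ := by field_simp; linarith
    rw [ha]; field_simp; ring
  rw [e]
  have b1 : JetBound r (C3 * (K * |q * τ|)) q (fun y => w (q * y)) x := by
    intro j hj
    have hwj : ContDiff ℝ j w := hws.of_le (by exact_mod_cast le_top)
    have := iteratedDeriv_comp_const_mul hwj (q : ℝ)
    rw [this]
    simp only
    rw [abs_mul, abs_of_nonneg (by positivity : (0 : ℝ) ≤ (q : ℝ) ^ j), mul_comm]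
    gcongr
    simpa using a1 (q * x) j hj
  have b2 : JetBound r (C3 * (K * |q * τ|) * q ^ r) 1 (fun y => w (q * y)) x := by
    intro j hj
    calc _ ≤ _ := b1 j hj
      _ ≤ C3 * (K * |q * τ|) * q ^ r := by gcongr
      _ = _ := by simp
  have := (b2.const_mul (q : ℝ)⁻¹).sub
    (contDiff_const.mul (hws.comp (contDiff_const.mul contDiff_id))) contDiff_const
    (jetBound_const r zero_le_one τ x)
  refine this.le zero_le_one ?_
  rw [abs_mul, abs_inv, abs_of_nonneg (by positivity : (0 : ℝ) ≤ (q : ℝ))]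
  calc (q : ℝ)⁻¹ * (C3 * (K * (q * |τ|)) * q ^ r) + |τ| = C3 * K * q ^ r * |τ| + 1 * |τ| := by
        field_simp
    _ ≤ C3 * K * q ^ (r + 1) * |τ| + q ^ (r + 1) * |τ| := by
        gcongr
        · exact Nat.le_succ r
        · exact one_le_pow₀ hq1
    _ = _ := by ring

/-- For Liouville `α`, conjugating by `H * k.scale q` barely changes the first iterates. -/
theorem exists_close_scale {α : ℝ} (hα : Liouville α) (H k : SLift) (r N : ℕ) {ε : ℝ}
    (hε : 0 < ε) (Q : ℕ) : ∃ q, ∃ hq : 0 < q, Q ≤ q ∧ ∀ i : ℤ, |i| ≤ N →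
      CloseTo r ε (conj (H * k.scale q hq) α i) (conj H α i) := by
  obtain ⟨C, hC, hC'⟩ := close_conj H r
  obtain ⟨C1, hC1, hC1'⟩ := close_scale_rot k r
  obtain ⟨q, ⟨p, -, hp⟩, hqQ, hq0, hqb⟩ := ((hα.frequently_exists_num (r + 2)).and_eventually
    ((eventually_ge_atTop Q).and ((eventually_gt_atTop 0).and
    (tendsto_natCast_atTop_atTop.eventually_ge_atTop (C1 * N * (1 + C / ε)))))).exists
  refine ⟨q, hq0, hqQ, fun i hi => ?_⟩
  have hq : (0 : ℝ) < q := by exact_mod_cast hq0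
  have hiN : |(i : ℝ)| ≤ N := by exact_mod_cast hi
  set τ := α - p / q with hτ
  have h1 := hC1' q hq0 (i * α) (i * τ) (i * p) (by push_cast; rw [hτ]; field_simp; ring)
  have h2 : C1 * q ^ (r + 1) * |i * τ| ≤ C1 * N / q := by
    rw [abs_mul]
    calc C1 * q ^ (r + 1) * (|(i : ℝ)| * |τ|) ≤ C1 * q ^ (r + 1) * (N * (1 / q ^ (r + 2))) := by
          gcongr
      _ = _ := by field_simp; ring
  have h3 : C1 * N / q ≤ 1 := by
    rw [div_le_one hq]
    refine le_trans ?_ hqb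
    have : 0 ≤ C1 * N * (C / ε) := by positivity
    linarith
  have h4 : C * (C1 * N / q) ≤ ε := by
    rw [← mul_div_assoc, div_le_iff₀ hq]
    have : C * (C1 * N) = ε * (C1 * N * (C / ε)) := by field_simp
    rw [this]
    gcongr
    refine le_trans ?_ hqb
    have : 0 ≤ C1 * N := by positivity
    linarith
  have := hC' (C1 * N / q) _ (i * α) h3 (h1.mono le_rfl h2)
  have e : conj (H * k.scale q hq0) α i =
      H * (k.scale q hq0 * SLift.rot (i * α) * (k.scale q hq0)⁻¹) * H⁻¹ := by
    simp only [conj]; group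
  rw [e]
  exact this.mono le_rfl h4

theorem SLift.sub_le_of_deriv_le (f : SLift) {M x y : ℝ} (hxy : x ≤ y)
    (h : ∀ z ∈ Set.Icc x y, deriv f z ≤ M) : f y - f x ≤ M * (y - x) := by
  refine Convex.image_sub_le_mul_sub_of_deriv_le (convex_Icc x y) f.continuous.continuousOn
    (smooth_diff f.smooth).differentiableOn (fun z hz => h z (interior_subset hz)) x
    (Set.left_mem_Icc.2 hxy) y (Set.right_mem_Icc.2 hxy) hxy

theorem SLift.le_sub_of_le_deriv (f : SLift) {M x y : ℝ} (hxy : x ≤ y)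
    (h : ∀ z ∈ Set.Icc x y, M ≤ deriv f z) : M * (y - x) ≤ f y - f x := by
  refine Convex.mul_sub_le_image_sub_of_le_deriv (convex_Icc x y) f.continuous.continuousOn
    (smooth_diff f.smooth).differentiableOn (fun z hz => h z (interior_subset hz)) x
    (Set.left_mem_Icc.2 hxy) y (Set.right_mem_Icc.2 hxy) hxy

theorem exists_int_mul_near {α : ℝ} (hα : Irrational α) (t : ℝ) {ε : ℝ} (hε : 0 < ε) :
    ∃ i l : ℤ, |i * α - l - t| < ε := by
  have hd : Dense (AddSubgroup.closure {α, (1 : ℝ)} : Set ℝ) :=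
    dense_addSubgroupClosure_pair_iff.2 (by simpa using hα)
  obtain ⟨y, hy, hy'⟩ := Metric.dense_iff.1 hd t ε hε
  obtain ⟨m, n, h⟩ := AddSubgroup.mem_closure_pair.1 hy'
  refine ⟨m, -n, ?_⟩
  rw [Metric.mem_ball, Real.dist_eq, ← h] at hy
  convert hy using 2
  simp

theorem half_le_sin {u : ℝ} (hu : |u - 1 / 4| ≤ 1 / 6) : 1 / 2 ≤ Real.sin (2 * Real.pi * u) := by
  have : Real.sin (2 * Real.pi * u) = Real.cos |2 * Real.pi * (u - 1 / 4)| := by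
    rw [Real.cos_abs, ← Real.cos_sub_pi_div_two]; congr 1; ring
  rw [this, ← Real.cos_pi_div_three]
  have hpi := Real.pi_pos
  refine Real.cos_le_cos_of_nonneg_of_le_pi (abs_nonneg _) (by linarith) ?_
  rw [abs_mul, abs_of_pos (by positivity : 0 < 2 * Real.pi)]
  nlinarith

theorem sin_le_neg_half {u : ℝ} (hu : |u - 3 / 4| ≤ 1 / 6) :
    Real.sin (2 * Real.pi * u) ≤ -(1 / 2) := by
  have h := half_le_sin (u := u - 1 / 2) (by convert hu using 2; ring)
  rw [show 2 * Real.pi * (u - 1 / 2) = 2 * Real.pi * u - Real.pi by ring, Real.sin_sub_pi] at h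
  linarith

theorem sin_add_int (u : ℝ) (n : ℤ) :
    Real.sin (2 * Real.pi * (u + n)) = Real.sin (2 * Real.pi * u) := by
  rw [← Real.sin_add_int_mul_two_pi (2 * Real.pi * u) n]; congr 1; ring

/-- Away from a small set, the derivative of `H * k.scale q` is that of `H` up to the two slopes
of `k`. -/
theorem exists_good (H k : SLift) (q : ℕ) (hq : 0 < q) {lam s c M : ℝ} (hs : 0 < s)
    (hM : ∀ x, deriv (H * k.scale q hq : SLift) x ≤ M)
    (h1 : ∀ x, s ≤ Real.sin (2 * Real.pi * x) → deriv k x = c)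
    (h2 : ∀ x, Real.sin (2 * Real.pi * x) ≤ -s → deriv k x = c * lam) :
    ∃ κ, 0 < κ ∧ ∃ G : Set ℝ, MeasurableSet G ∧
      volume (Set.Icc 0 1 \ G) ≤ ENNReal.ofReal (5 * M * s) ∧
      ∀ z ∈ G, ∀ z', |z' - z| ≤ κ → ∃ e : ℤ,
        deriv (H * k.scale q hq : SLift) ((H * k.scale q hq)⁻¹ z') =
          deriv H (H⁻¹ z') * c * lam ^ e := by
  set h := k.scale q hq with hh
  set F := H * h with hF
  obtain ⟨L, hL1, hL⟩ := (F⁻¹).jets_bounded 0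
  have hq' : (1 : ℝ) ≤ q := by exact_mod_cast hq
  have hpi := Real.pi_pos
  have hM0 : 0 < M := (F.dpos 0).trans_le (hM 0)
  set S : ℝ → ℝ := fun z => Real.sin (2 * Real.pi * (q * F⁻¹ z)) with hS
  have hSc : Continuous S := Real.continuous_sin.comp
    (continuous_const.mul (continuous_const.mul (F⁻¹).continuous))
  refine ⟨s / (2 * Real.pi * q * L), by positivity, {z | 2 * s ≤ |S z|},
    (isClosed_le continuous_const hSc.abs).measurableSet, ?_, ?_⟩
  · set j0 := ⌊2 * q * F⁻¹ 0⌋ with hj0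
    set A : ℕ → Set ℝ := fun j => Set.Icc (F (((j0 + j : ℤ) - s) / (2 * q)))
      (F (((j0 + j : ℤ) + s) / (2 * q))) with hA
    have hsub : Set.Icc 0 1 \ {z | 2 * s ≤ |S z|} ⊆ ⋃ j ∈ Finset.range (2 * q + 3), A j := by
      rintro z ⟨⟨hz0, hz1⟩, hz⟩
      simp only [Set.mem_ofPred_eq, not_le] at hz
      set y := F⁻¹ z with hy
      have hFy : F y = z := F.apply_inv_self z
      have hy0 : F⁻¹ 0 ≤ y := (F⁻¹).strictMono.monotone hz0
      have hy1 : y ≤ F⁻¹ 0 + 1 := by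
        rw [← SLift.map_add_one, zero_add]; exact (F⁻¹).strictMono.monotone hz1
      set m := round (2 * q * y) with hm
      have hr := abs_sub_round (2 * q * y)
      rw [← hm] at hr
      have hjl := Int.floor_le (2 * q * F⁻¹ 0)
      have hju := Int.lt_floor_add_one (2 * q * F⁻¹ 0)
      rw [← hj0] at hjl hju
      have a1 := abs_le.1 hr
      have hmy : 2 * q * F⁻¹ 0 ≤ 2 * q * y := by gcongr
      have hmy' : 2 * q * y ≤ 2 * q * F⁻¹ 0 + 2 * q := by nlinarith
      have hm1 : j0 ≤ m := by
        have : (j0 : ℝ) < m + 1 := by linarith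
        have : j0 < m + 1 := by exact_mod_cast this
        omega
      have hm2 : m < j0 + 2 * q + 2 := by
        have : (m : ℝ) < j0 + 2 * q + 2 := by linarith
        exact_mod_cast this
      have hu : |2 * q * y - m| < s := by
        have e : |S z| = |Real.sin (Real.pi * (2 * q * y - m))| := by
          rw [mul_sub, mul_comm Real.pi (m : ℝ), Real.sin_sub_int_mul_pi, abs_mul]
          rw [abs_zpow]
          simp only [hS, ← hy, abs_neg, abs_one, one_zpow, one_mul]
          congr 2; ring
        have b := Real.mul_abs_le_abs_sin (x := Real.pi * (2 * q * y - m)) (by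
          rw [abs_mul, abs_of_pos hpi]; nlinarith)
        rw [← e, abs_mul, abs_of_pos hpi] at b
        have : 2 / Real.pi * (Real.pi * |2 * q * y - m|) = 2 * |2 * q * y - m| := by field_simp
        linarith
      have a2 := abs_lt.1 hu
      refine Set.mem_biUnion (x := (m - j0).toNat)
          (Finset.mem_coe.2 (Finset.mem_range.2 (by omega)))
        ?_
      have e : (j0 + ((m - j0).toNat : ℕ) : ℤ) = m := by omega
      simp only [hA, e]
      rw [← hFy]
      constructor
      · refine F.strictMono.monotone ?_
        rw [div_le_iff₀ (by positivity)]; linarith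
      · refine F.strictMono.monotone ?_
        rw [le_div_iff₀ (by positivity)]; linarith
    calc volume (Set.Icc 0 1 \ {z | 2 * s ≤ |S z|})
        ≤ volume (⋃ j ∈ Finset.range (2 * q + 3), A j) := measure_mono hsub
      _ ≤ ∑ j ∈ Finset.range (2 * q + 3), volume (A j) := measure_biUnion_finset_le _ _
      _ ≤ ∑ j ∈ Finset.range (2 * q + 3), ENNReal.ofReal (M * (s / q)) := by
        refine Finset.sum_le_sum fun j _ => ?_
        rw [Real.volume_Icc]
        refine ENNReal.ofReal_le_ofReal ?_
        have := F.sub_le_of_deriv_le (M := M) (x := ((j0 + j : ℤ) - s) / (2 * q))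
          (y := ((j0 + j : ℤ) + s) / (2 * q)) (by gcongr; linarith) (fun z _ => hM z)
        refine this.trans (le_of_eq ?_)
        field_simp; ring
      _ = ENNReal.ofReal ((2 * q + 3 : ℕ) * (M * (s / q))) := by
        rw [Finset.sum_const, Finset.card_range, nsmul_eq_mul,
          ENNReal.ofReal_mul (Nat.cast_nonneg _), ENNReal.ofReal_natCast]
      _ ≤ _ := by
        refine ENNReal.ofReal_le_ofReal ?_
        push_cast
        rw [← mul_div_assoc, ← mul_div_assoc, div_le_iff₀ (by positivity)]
        have : 0 < M * s := by positivity
        nlinarith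
  · intro z hz z' hz'
    have hlip : |F⁻¹ z' - F⁻¹ z| ≤ L * |z' - z| :=
      abs_sub_le_of_deriv (smooth_diff (F⁻¹).smooth) fun y _ => (hL y).val
    have hd : |S z' - S z| ≤ s := by
      have b := Real.abs_sin_sub_sin_le (2 * Real.pi * (q * F⁻¹ z')) (2 * Real.pi * (q * F⁻¹ z))
      refine b.trans ?_
      rw [← mul_sub, ← mul_sub, abs_mul (2 * Real.pi), abs_mul (q : ℝ),
        abs_of_pos (by positivity : 0 < 2 * Real.pi), abs_of_pos (by positivity : (0 : ℝ) < q)]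
      calc _ ≤ 2 * Real.pi * (q * (L * (s / (2 * Real.pi * q * L)))) := by
            gcongr; exact hlip.trans (by gcongr)
        _ = s := by field_simp
    have hz2 : 2 * s ≤ |S z| := hz
    have hhz : h (F⁻¹ z') = H⁻¹ z' := h.apply_inv_self (H⁻¹ z')
    rw [SLift.deriv_mul, hhz, SLift.deriv_scale]
    have hdd := abs_le.1 hd
    rcases le_abs.1 hz2 with h3 | h3
    · refine ⟨0, ?_⟩
      rw [h1 _ (by change s ≤ S z'; linarith)]; simp
    · refine ⟨1, ?_⟩
      rw [h2 _ (by change S z' ≤ -s; linarith), zpow_one]; ring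

/-- For `q` large, some iterate of the conjugate of the rotation by `H * k.scale q` has derivative
close to `lam` on a definite proportion of every small scale. -/
theorem exists_recurrence (H k : SLift) {lam s c α : ℝ} (hα : Irrational α) (hlam : 1 < lam)
    (hs : s ≤ 1 / 2) (hc : 0 < c)
    (h0 : ∀ x, lam⁻¹ ≤ deriv k x ∧ deriv k x ≤ lam)
    (h1 : ∀ x, s ≤ Real.sin (2 * Real.pi * x) → deriv k x = c)
    (h2 : ∀ x, Real.sin (2 * Real.pi * x) ≤ -s → deriv k x = c * lam) (n : ℕ) :
    ∃ Q : ℕ, ∀ (q : ℕ) (hq : 0 < q), Q ≤ q → ∃ κ, 0 < κ ∧ ∃ i l : ℤ, ∀ x, ∃ a ρ : ℝ,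
      0 < ρ ∧ ρ ≤ 1 / (n + 1) ∧ κ ≤ ρ ∧
      Set.Icc a (a + ρ / (48 * lam ^ 2)) ⊆ Set.Icc (x - ρ) (x + ρ) ∧
      ∀ z ∈ Set.Icc a (a + ρ / (48 * lam ^ 2)),
        |conj (H * k.scale q hq) α i z - l - x| ≤ ρ ∧
        |deriv (conj (H * k.scale q hq) α i) z - lam| ≤ 1 / (n + 1) := by
  obtain ⟨K, hK1, hK⟩ := H.jets_bounded 1
  obtain ⟨a, ha, hHa⟩ := H.deriv_lower
  have hlam0 : 0 < lam := by linarith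
  obtain ⟨Q, hQ⟩ := exists_nat_ge (4 * K * lam / a + (n + 1) * K * lam ^ 2 / a
    + (n + 1) * (4 * lam * K))
  refine ⟨Q, fun q hq hQq => ?_⟩
  have hq' : (0 : ℝ) < q := by exact_mod_cast hq
  have hqb := hQ.trans (show (Q : ℝ) ≤ q by exact_mod_cast hQq)
  have p1 : 0 ≤ 4 * K * lam / a := by positivity
  have p2 : 0 ≤ (n + 1) * K * lam ^ 2 / a := by positivity
  have p3 : 0 ≤ (n + 1) * (4 * lam * K) := by positivity
  have q1 : 4 * K * lam ≤ q * a := by rw [← div_le_iff₀ ha]; linarith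
  have q2 : (n + 1) * K * lam ^ 2 ≤ q * a := by rw [← div_le_iff₀ ha]; linarith
  have q3 : (n + 1) * (4 * lam * K) ≤ q := by linarith
  obtain ⟨i, l, hil⟩ := exists_int_mul_near hα (1 / (2 * q)) (ε := 1 / (24 * q)) (by positivity)
  refine ⟨4 * lam * a / q, by positivity, i, l, fun x => ?_⟩
  set h := k.scale q hq with hh
  set F := H * h with hF
  have hhd : ∀ w, deriv h w ≤ lam := fun w => by rw [hh, SLift.deriv_scale]; exact (h0 _).2
  set wx := F⁻¹ x with hwx
  have hFw : F wx = x := F.apply_inv_self x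
  set j := ⌊q * wx⌋ with hj
  set D := deriv H (h wx) with hD
  have hDa : a ≤ D := hHa _
  have hDK : D ≤ K := (le_abs_self _).trans (hK _).val
  have hD0 : 0 < D := ha.trans_le hDa
  have hhlip : ∀ u v : ℝ, |h u - h v| ≤ lam * |u - v| := fun u v =>
    abs_sub_le_of_deriv (smooth_diff h.smooth) fun z _ => by
      rw [abs_of_pos (h.dpos z)]; exact hhd z
  have hHlip : ∀ u v : ℝ, |deriv H u - deriv H v| ≤ K * |u - v| := fun u v =>
    abs_sub_le_of_deriv (smooth_diff H.dsmooth) fun z _ => by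
      simpa using ((jetBound_succ.1 (hK z)).2).val
  have hlip : ∀ u v : ℝ, |deriv H (h u) - deriv H (h v)| ≤ K * (lam * |u - v|) := fun u v =>
    (hHlip _ _).trans (by gcongr; exact hhlip u v)
  have hDw : ∀ w, |w - wx| ≤ 2 / q → D / 2 ≤ deriv H (h w) ∧ deriv H (h w) ≤ 2 * D := by
    intro w hw
    have b : |deriv H (h w) - D| ≤ D / 2 := by
      calc _ ≤ K * (lam * (2 / q)) := (hlip w wx).trans (by gcongr)
        _ = 4 * K * lam / q / 2 := by field_simp; ring
        _ ≤ D / 2 := by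
          gcongr
          rw [div_le_iff₀ hq']; nlinarith
    have := abs_le.1 b
    constructor <;> linarith [this.1, this.2]
  have hFd : ∀ w, deriv F w = deriv H (h w) * deriv k (q * w) := fun w => by
    rw [hF, SLift.deriv_mul, SLift.deriv_scale]
  set ρ := 4 * lam * D / q with hρ
  have hρ0 : 0 < ρ := by positivity
  have hFx : ∀ w, |w - wx| ≤ 2 / q → |F w - x| ≤ ρ := by
    intro w hw
    rw [← hFw]
    calc |F w - F wx| ≤ (2 * D * lam) * |w - wx| :=
          abs_sub_le_of_deriv (smooth_diff F.smooth) fun z hz => by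
            rw [abs_of_pos (F.dpos z), hFd]
            have hz' : |z - wx| ≤ 2 / q := (Set.abs_sub_left_of_mem_uIcc
              (Set.uIcc_comm w wx ▸ hz)).trans hw
            exact mul_le_mul (hDw z hz').2 (h0 _).2 (k.dpos _).le (by positivity)
      _ ≤ (2 * D * lam) * (2 / q) := by gcongr
      _ = ρ := by rw [hρ]; ring
  have hj1 := Int.floor_le (q * wx)
  have hj2 := Int.lt_floor_add_one (q * wx)
  rw [← hj] at hj1 hj2
  set wa := (j + 1 / 6 : ℝ) / q with hwa
  set wb := (j + 1 / 3 : ℝ) / q with hwb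
  have hab : wa ≤ wb := by rw [hwa, hwb]; gcongr; norm_num
  have hqw : ∀ w ∈ Set.Icc wa wb, j + 1 / 6 ≤ q * w ∧ q * w ≤ j + 1 / 3 := fun w hw => by
    have e1 := hw.1
    have e2 := hw.2
    rw [hwa, div_le_iff₀ hq'] at e1
    rw [hwb, le_div_iff₀ hq'] at e2
    constructor <;> linarith
  have hwabs : ∀ w t : ℝ, |q * w - q * wx| ≤ t → |w - wx| ≤ t / q := fun w t ht => by
    rw [← mul_sub, abs_mul, abs_of_pos hq', mul_comm] at ht
    rwa [le_div_iff₀ hq']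
  have hw1 : ∀ w ∈ Set.Icc wa wb, |w - wx| ≤ 2 / q := fun w hw => by
    refine hwabs w 2 ?_
    have := hqw w hw
    rw [abs_le]; constructor <;> linarith [this.1, this.2]
  have hlen : F wa + ρ / (48 * lam ^ 2) ≤ F wb := by
    have b := F.le_sub_of_le_deriv (M := D / (2 * lam)) hab fun z hz => by
      rw [hFd]
      calc D / (2 * lam) = D / 2 * lam⁻¹ := by field_simp
        _ ≤ _ := mul_le_mul (hDw z (hw1 z hz)).1 (h0 _).1 (by positivity) (H.dpos _).le
    have e : D / (2 * lam) * (wb - wa) = ρ / (48 * lam ^ 2) := by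
      rw [hwa, hwb, hρ]; field_simp; ring
    linarith
  have hmem : ∀ z ∈ Set.Icc (F wa) (F wa + ρ / (48 * lam ^ 2)), F⁻¹ z ∈ Set.Icc wa wb := by
    intro z hz
    constructor
    · rw [← F.inv_apply_self wa]; exact (F⁻¹).strictMono.monotone hz.1
    · rw [← F.inv_apply_self wb]; exact (F⁻¹).strictMono.monotone (hz.2.trans hlen)
  refine ⟨F wa, ρ, hρ0, ?_, ?_, ?_, ?_⟩
  · rw [hρ, div_le_div_iff₀ hq' (by positivity)]
    have : 4 * lam * D ≤ 4 * lam * K := by gcongr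
    nlinarith
  · rw [hρ]; gcongr
  · intro z hz
    have := abs_le.1 (hFx _ (hw1 _ (hmem z hz)))
    rw [F.apply_inv_self] at this
    constructor <;> linarith [this.1, this.2]
  · intro z hz
    set w := F⁻¹ z with hw
    have hwm := hmem z hz
    have hqw' := hqw w hwm
    set w' := w + i * α - l with hw'
    have hil' : |q * (i * α - l) - 1 / 2| ≤ 1 / 24 := by
      have : q * (i * α - l) - 1 / 2 = q * (i * α - l - 1 / (2 * q)) := by field_simp
      rw [this, abs_mul, abs_of_pos hq']
      calc (q : ℝ) * |i * α - l - 1 / (2 * q)| ≤ q * (1 / (24 * (q : ℝ))) := by gcongr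
        _ = _ := by field_simp
    have hil2 := abs_le.1 hil'
    have hqw2 : q * w' = q * w + q * (i * α - l) := by rw [hw']; ring
    have hw'x : |w' - wx| ≤ 2 / q := by
      refine hwabs w' 2 ?_
      rw [hqw2, abs_le]; constructor <;> linarith [hqw'.1, hqw'.2, hil2.1, hil2.2]
    constructor
    · rw [conj_apply, ← SLift.map_sub_int]
      exact hFx w' hw'x
    · have e0 : deriv F (w + i * α) = deriv F w' := by
        rw [← F.deriv_add_int w' l]; congr 1; rw [hw']; ring
      rw [deriv_conj, e0, hFd, hFd]
      have s1 : deriv k (q * w) = c := by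
        refine h1 _ (hs.trans ?_)
        have : q * w = (q * w - j) + j := by ring
        rw [this, sin_add_int]
        refine half_le_sin ?_
        rw [abs_le]; constructor <;> linarith [hqw'.1, hqw'.2]
      have s2 : deriv k (q * w') = c * lam := by
        refine h2 _ (le_trans ?_ (neg_le_neg hs))
        have : q * w' = (q * w' - j) + j := by ring
        rw [this, sin_add_int]
        refine sin_le_neg_half ?_
        rw [hqw2, abs_le]; constructor <;> linarith [hqw'.1, hqw'.2, hil2.1, hil2.2]
      rw [← hw, s1, s2]
      have hy := H.dpos (h w)
      have e : deriv H (h w') * (c * lam) / (deriv H (h w) * c) - lam =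
          lam * ((deriv H (h w') - deriv H (h w)) / deriv H (h w)) := by
        field_simp
      rw [e, abs_mul, abs_div, abs_of_pos hlam0, abs_of_pos hy]
      have hww : |w' - w| ≤ 1 / q := by
        rw [le_div_iff₀ hq', show |w' - w| * q = |q * (i * α - l)| by
          rw [abs_mul, abs_of_pos hq', hw', mul_comm]; congr 2; ring, abs_le]
        constructor <;> linarith [hil2.1, hil2.2]
      calc lam * (|deriv H (h w') - deriv H (h w)| / deriv H (h w))
          ≤ lam * (K * (lam * (1 / q)) / a) := by
            gcongr
            · exact (hlip w' w).trans (by gcongr)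
            · exact hHa _
        _ = K * lam ^ 2 / (q * a) := by field_simp
        _ ≤ 1 / (n + 1) := by
          rw [div_le_div_iff₀ (by positivity) (by positivity)]; linarith

/-- A stage of the inductive construction. -/
structure Stage where
  /-- The conjugating diffeomorphism. -/
  H : SLift
  /-- The range of controlled iterates. -/
  N : ℕ
  /-- The tolerance for all later modifications. -/
  κ : ℝ
  κ_pos : 0 < κ

/-- The relation between successive stages of the construction. -/
structure Stage.Step (α lam : ℝ) (r n : ℕ) (S S' : Stage) : Prop where
  close : ∀ i : ℤ, |i| ≤ S.N → CloseTo (r + n) (S.κ / 2) (conj S'.H α i) (conj S.H α i)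
  N_le : S.N ≤ S'.N
  lt_N : n < S'.N
  κ_le : S'.κ ≤ S.κ / 2
  good : ∃ G : Set ℝ, MeasurableSet G ∧
    volume (Set.Icc 0 1 \ G) ≤ ENNReal.ofReal ((1 / 4) ^ (n + 1)) ∧ ∃ c, 0 < c ∧
      ∀ z ∈ G, ∀ z', |z' - z| ≤ S'.κ → ∃ e : ℤ,
        deriv S'.H (S'.H⁻¹ z') = deriv S.H (S.H⁻¹ z') * c * lam ^ e
  recur : ∃ i : ℤ, |i| ≤ S'.N ∧ ∃ l : ℤ, ∀ x, ∃ a ρ : ℝ,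
    0 < ρ ∧ ρ ≤ 1 / (n + 1) ∧ S'.κ ≤ ρ ∧
    Set.Icc a (a + ρ / (48 * lam ^ 2)) ⊆ Set.Icc (x - ρ) (x + ρ) ∧
    ∀ z ∈ Set.Icc a (a + ρ / (48 * lam ^ 2)),
      |conj S'.H α i z - l - x| ≤ ρ ∧ |deriv (conj S'.H α i) z - lam| ≤ 1 / (n + 1)

theorem Stage.exists_step {α lam : ℝ} (hα : Liouville α) (hlam : 1 < lam) (r n : ℕ) (S : Stage) :
    ∃ S' : Stage, S.Step α lam r n S' := by
  obtain ⟨K, hK1, hK⟩ := S.H.jets_bounded 0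
  set s : ℝ := min (1 / 2) ((1 / 4) ^ (n + 1) / (5 * (lam * K))) with hs
  have hs0 : 0 < s := by positivity
  obtain ⟨k, c, hc, h0, h1, h2⟩ := exists_two_slope hlam hs0
  obtain ⟨Q, hQ⟩ := exists_recurrence S.H k hα.irrational hlam (min_le_left _ _) hc h0 h1 h2 n
  obtain ⟨q, hq, hQq, hclose⟩ := exists_close_scale hα S.H k (r + n) S.N
    (half_pos S.κ_pos) Q
  obtain ⟨κ₁, hκ₁, i, l, hrec⟩ := hQ q hq hQq
  obtain ⟨κ₂, hκ₂, G, hG, hGv, hGe⟩ := exists_good S.H k q hq (M := lam * K) hs0 (fun x => by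
    rw [SLift.deriv_mul, SLift.deriv_scale, mul_comm]
    exact mul_le_mul (h0 _).2 ((le_abs_self _).trans (hK _).val) (S.H.dpos _).le (by linarith))
    h1 h2
  have hκ := S.κ_pos
  refine ⟨⟨S.H * k.scale q hq, max (max S.N (n + 1)) i.natAbs, min (S.κ / 2) (min κ₁ κ₂),
    by positivity⟩, hclose, ?_, ?_, min_le_left _ _, ?_, ?_⟩
  · exact (le_max_left _ _).trans (le_max_left _ _)
  · exact (Nat.lt_succ_self n).trans_le ((le_max_right _ _).trans (le_max_left _ _))
  · refine ⟨G, hG, hGv.trans (ENNReal.ofReal_le_ofReal ?_), c, hc, fun z hz z' hz' =>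
      hGe z hz z' (hz'.trans ((min_le_right _ _).trans (min_le_right _ _)))⟩
    calc 5 * (lam * K) * s ≤ 5 * (lam * K) * ((1 / 4) ^ (n + 1) / (5 * (lam * K))) := by
          gcongr; exact min_le_right _ _
      _ = _ := by field_simp
  · refine ⟨i, ?_, l, fun x => ?_⟩
    · rw [Int.abs_eq_natAbs]; exact_mod_cast le_max_right _ _
    · obtain ⟨a, ρ, hρ, hρ1, hκρ, h⟩ := hrec x
      exact ⟨a, ρ, hρ, hρ1, ((min_le_right _ _).trans (min_le_left _ _)).trans hκρ, h⟩

theorem CloseTo.iter {r : ℕ} {ε : ℝ} {f g : ℝ → ℝ} (hf : ContDiff ℝ ∞ f) (hg : ContDiff ℝ ∞ g)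
    (h : CloseTo r ε f g) {j : ℕ} (hj : j ≤ r) (x : ℝ) :
    |iteratedDeriv j f x - iteratedDeriv j g x| ≤ ε := by
  have := h x j hj
  rw [iteratedDeriv_fun_sub (hf.contDiffAt.of_le (by exact_mod_cast le_top))
    (hg.contDiffAt.of_le (by exact_mod_cast le_top))] at this
  simpa using this

theorem CloseTo.of_iter {r : ℕ} {ε : ℝ} {f g : ℝ → ℝ} (hf : ContDiff ℝ ∞ f) (hg : ContDiff ℝ ∞ g)
    (h : ∀ j ≤ r, ∀ x, |iteratedDeriv j f x - iteratedDeriv j g x| ≤ ε) : CloseTo r ε f g := by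
  intro x j hj
  rw [iteratedDeriv_fun_sub (hf.contDiffAt.of_le (by exact_mod_cast le_top))
    (hg.contDiffAt.of_le (by exact_mod_cast le_top))]
  simpa using h j hj x

theorem exists_smooth_limit {u : ℕ → ℝ → ℝ} (hu : ∀ n, ContDiff ℝ ∞ (u n)) {e : ℕ → ℝ}
    (he : Tendsto e atTop (𝓝 0))
    (h : ∀ k : ℕ, ∃ n₀, ∀ n ≥ n₀, ∀ m ≥ n, CloseTo k (e n) (u m) (u n)) :
    ∃ v : ℝ → ℝ, ContDiff ℝ ∞ v ∧
      ∀ j, TendstoUniformly (fun n => iteratedDeriv j (u n)) (iteratedDeriv j v) atTop := by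
  have hlim : ∀ j x, ∃ y, Tendsto (fun n => iteratedDeriv j (u n) x) atTop (𝓝 y) := by
    intro j x
    obtain ⟨n₀, hn₀⟩ := h j
    refine cauchySeq_tendsto_of_complete (Metric.cauchySeq_iff'.2 fun ε hε => ?_)
    obtain ⟨N, hN, hN'⟩ := ((he.eventually_lt_const hε).and (eventually_ge_atTop n₀)).exists
    refine ⟨N, fun n hn => ?_⟩
    rw [Real.dist_eq]
    exact ((hn₀ N hN' n hn).iter (hu n) (hu N) le_rfl x).trans_lt hN
  choose v hv using hlim
  have hunif : ∀ j, TendstoUniformly (fun n => iteratedDeriv j (u n)) (v j) atTop := by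
    intro j
    obtain ⟨n₀, hn₀⟩ := h j
    rw [Metric.tendstoUniformly_iff]
    intro ε hε
    filter_upwards [he.eventually_lt_const hε, eventually_ge_atTop n₀] with n h1 h2 x
    rw [Real.dist_eq]
    refine lt_of_le_of_lt (le_of_tendsto ((hv j x).sub_const _).abs ?_) h1
    filter_upwards [eventually_ge_atTop n] with m hm
    exact (hn₀ n h2 m hm).iter (hu m) (hu n) le_rfl x
  have hder : ∀ j x, HasDerivAt (v j) (v (j + 1) x) x := by
    intro j x
    refine hasDerivAt_of_tendstoUniformly (hunif (j + 1)) (Eventually.of_forall fun n y => ?_)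
      (hv j) x
    rw [iteratedDeriv_succ]
    exact smooth_hasDeriv (smooth_iter (hu n) j) y
  have hiter : ∀ j, iteratedDeriv j (v 0) = v j := by
    intro j
    induction j with
    | zero => exact iteratedDeriv_zero
    | succ j ih => rw [iteratedDeriv_succ, ih]; exact funext fun x => (hder j x).deriv
  refine ⟨v 0, contDiff_of_differentiable_iteratedDeriv fun m _ => ?_, fun j => ?_⟩
  · rw [hiter]; exact fun x => (hder m x).differentiableAt
  · rw [hiter]; exact hunif j

theorem CloseTo.of_tendsto {u : ℕ → ℝ → ℝ} (hu : ∀ n, ContDiff ℝ ∞ (u n)) {v w : ℝ → ℝ}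
    (hv : ContDiff ℝ ∞ v) (hw : ContDiff ℝ ∞ w) {r : ℕ} {ε : ℝ}
    (hlim : ∀ j, TendstoUniformly (fun n => iteratedDeriv j (u n)) (iteratedDeriv j v) atTop)
    (h : ∀ᶠ n in atTop, CloseTo r ε (u n) w) : CloseTo r ε v w := by
  refine CloseTo.of_iter hv hw fun j hj x =>
    le_of_tendsto (((hlim j).tendsto_at x).sub_const _).abs ?_
  filter_upwards [h] with n hn using hn.iter (hu n) hw hj x

section Limit

variable {α lam : ℝ} {r : ℕ} {S : ℕ → Stage}

theorem Stage.N_mono (hS : ∀ n, (S n).Step α lam r n (S (n + 1))) : Monotone fun n => (S n).N :=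
  monotone_nat_of_le_succ fun n => (hS n).N_le

theorem Stage.le_N (hS : ∀ n, (S n).Step α lam r n (S (n + 1))) (n : ℕ) : n ≤ (S n).N := by
  cases n with
  | zero => exact Nat.zero_le _
  | succ n => exact (hS n).lt_N

theorem Stage.κ_anti (hS : ∀ n, (S n).Step α lam r n (S (n + 1))) : Antitone fun n => (S n).κ :=
  antitone_nat_of_succ_le fun n => (hS n).κ_le.trans (by linarith [(S n).κ_pos])

theorem Stage.κ_tendsto (hS : ∀ n, (S n).Step α lam r n (S (n + 1))) :
    Tendsto (fun n => (S n).κ) atTop (𝓝 0) := by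
  have h : ∀ n, (S n).κ ≤ (S 0).κ * (1 / 2) ^ n := by
    intro n
    induction n with
    | zero => simp
    | succ n ih => rw [pow_succ]; linarith [(hS n).κ_le]
  refine squeeze_zero (fun n => (S n).κ_pos.le) h ?_
  simpa using (tendsto_pow_atTop_nhds_zero_of_lt_one (by norm_num) (by norm_num :
    (1 / 2 : ℝ) < 1)).const_mul (S 0).κ

theorem Stage.close_of_le (hS : ∀ n, (S n).Step α lam r n (S (n + 1))) {n m : ℕ} (hnm : n ≤ m)
    {i : ℤ} (hi : |i| ≤ (S n).N) :
    CloseTo (r + n) ((S n).κ - (S m).κ) (conj (S m).H α i) (conj (S n).H α i) := by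
  induction m, hnm using Nat.le_induction with
  | base => exact CloseTo.refl _ (by simp) _
  | succ m hnm ih =>
    have h1 := (hS m).close i (hi.trans (by exact_mod_cast Stage.N_mono hS hnm))
    have h2 := (h1.mono (by omega) le_rfl).trans (SLift.smooth _) (SLift.smooth _)
      (SLift.smooth _) ih
    exact h2.mono le_rfl (by linarith [(hS m).κ_le])

theorem conj_zero (H : SLift) (α : ℝ) : conj H α 0 = 1 := by
  refine SLift.ext' fun x => ?_
  rw [conj_apply]
  simp [SLift.apply_inv_self, SLift.one_apply]

/-- The iterates converge in the smooth topology to those of a diffeomorphism. -/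
theorem Stage.exists_limit (hS : ∀ n, (S n).Step α lam r n (S (n + 1))) :
    ∃ f : SLift, ∀ n, ∀ i : ℤ, |i| ≤ (S n).N →
      CloseTo (r + n) (S n).κ (f ^ i : SLift) (conj (S n).H α i) := by
  have hex : ∀ i : ℤ, ∃ v : ℝ → ℝ, ContDiff ℝ ∞ v ∧ ∀ j,
      TendstoUniformly (fun n => iteratedDeriv j (conj (S n).H α i)) (iteratedDeriv j v) atTop := by
    intro i
    refine exists_smooth_limit (fun n => SLift.smooth _) (Stage.κ_tendsto hS) fun k =>
      ⟨max k i.natAbs, fun n hn m hm => ?_⟩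
    have h1 : i.natAbs ≤ (S n).N := (le_of_max_le_right hn).trans (Stage.le_N hS n)
    refine (Stage.close_of_le hS hm ?_).mono ((le_of_max_le_left hn).trans (by omega))
      (by linarith [(S m).κ_pos])
    rw [Int.abs_eq_natAbs]; exact_mod_cast h1
  choose φ hφ hφl using hex
  have hu : ∀ i, TendstoUniformly (fun n => (conj (S n).H α i : ℝ → ℝ)) (φ i) atTop := fun i => by
    simpa using hφl i 0
  have hadd : ∀ i j x, φ i (φ j x) = φ (i + j) x := by
    intro i j x
    refine tendsto_nhds_unique ((hu i).tendsto_comp (hφ i).continuous.continuousAt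
      ((hu j).tendsto_at x)) ?_
    simpa only [conj_add, SLift.mul_apply] using (hu (i + j)).tendsto_at x
  have hzero : ∀ x, φ 0 x = x := by
    intro x
    refine tendsto_nhds_unique ((hu 0).tendsto_at x) ?_
    simp only [conj_zero, SLift.one_apply, tendsto_const_nhds]
  have hmap : ∀ i x, φ i (x + 1) = φ i x + 1 := by
    intro i x
    refine tendsto_nhds_unique ((hu i).tendsto_at (x + 1)) ?_
    simpa only [SLift.map_add_one] using ((hu i).tendsto_at x).add_const 1
  have hpos : ∀ x, 0 < deriv (φ 1) x := by
    intro x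
    have h0 : 0 ≤ deriv (φ 1) x := by
      have := (hφl 1 1).tendsto_at x
      simp only [iteratedDeriv_one] at this
      exact ge_of_tendsto' this fun n => (SLift.dpos _ x).le
    refine h0.lt_of_ne fun h => ?_
    have h1 := (smooth_hasDeriv (hφ (-1)) (φ 1 x)).comp x (smooth_hasDeriv (hφ 1) x)
    have h2 : φ (-1) ∘ φ 1 = id := by
      funext y; simp [hadd, hzero]
    rw [h2, ← h, mul_zero] at h1
    exact one_ne_zero ((hasDerivAt_id x).unique h1)
  let f : SLift := ⟨φ 1, φ (-1), hφ 1, hφ (-1), hmap 1, fun x => by simp [hadd, hzero],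
    fun x => by simp [hadd, hzero], hpos⟩
  have hf : ∀ i : ℤ, ((f ^ i : SLift) : ℝ → ℝ) = φ i := by
    intro i
    induction i with
    | zero => funext x; simp [hzero, SLift.one_apply]
    | succ i ih =>
      funext x
      rw [zpow_add_one, SLift.mul_apply, ih]; exact hadd _ _ _
    | pred i ih =>
      funext x
      rw [zpow_sub_one, SLift.mul_apply, ih]; exact hadd _ _ _
  refine ⟨f, fun n i hi => ?_⟩
  rw [hf]
  refine CloseTo.of_tendsto (fun m => SLift.smooth _) (hφ i) (SLift.smooth _) (hφl i) ?_
  filter_upwards [eventually_ge_atTop n] with m hm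
  exact (Stage.close_of_le hS hm hi).mono le_rfl (by linarith [(S m).κ_pos])

end Limit

theorem abs_conj_apply_sub (H : SLift) (α : ℝ) (i : ℤ) (x : ℝ) :
    |conj H α i x - x - i * α| ≤ 1 := by
  have := H.abs_apply_sub_apply (H⁻¹ x) (H⁻¹ x + i * α)
  rw [H.apply_inv_self] at this
  rw [conj_apply]
  convert this using 2; ring

section Circle

variable {Fz : ℤ → UnitAddCircle → UnitAddCircle} {D : ℤ → UnitAddCircle → ℝ} {f : SLift}

theorem continuous_of_lift {X : Type*} [TopologicalSpace X] {u : UnitAddCircle → X} {v : ℝ → X}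
    (hv : Continuous v) (h : ∀ x : ℝ, u x = v x) : Continuous u := by
  refine (QuotientAddGroup.isQuotientMap_mk _).continuous_iff.2 ?_
  convert hv using 1
  exact funext h

theorem coe_eq_coe_add_int {x y : ℝ} (h : (x : UnitAddCircle) = y) : ∃ n : ℤ, x = y + n := by
  rw [← sub_eq_zero, ← AddCircle.coe_sub, AddCircle.coe_eq_zero_iff] at h
  obtain ⟨n, hn⟩ := h
  exact ⟨n, by rw [zsmul_eq_mul, mul_one] at hn; linarith⟩

theorem coe_add_int (x : ℝ) (n : ℤ) : ((x + n : ℝ) : UnitAddCircle) = x := by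
  rw [AddCircle.coe_add, add_eq_left, AddCircle.coe_eq_zero_iff]
  exact ⟨n, by simp⟩

theorem volume_preimage_pos {B : Set UnitAddCircle} (hB : MeasurableSet B) :
    0 < volume B ↔ 0 < volume ((↑) ⁻¹' B : Set ℝ) := by
  have key : ∀ a : ℝ, volume (((↑) ⁻¹' B : Set ℝ) ∩ Set.Ioc a (a + 1)) = volume B := by
    intro a
    have h := UnitAddCircle.measurePreserving_mk a
    rw [← h.measure_preimage hB.nullMeasurableSet,
      Measure.restrict_apply (h.measurable hB)]
  constructor
  · intro h
    rw [← key 0] at h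
    exact h.trans_le (measure_mono Set.inter_subset_left)
  · intro h
    rw [pos_iff_ne_zero] at h ⊢
    contrapose! h
    have hsub : ((↑) ⁻¹' B : Set ℝ) ⊆ ⋃ n : ℤ, ((↑) ⁻¹' B : Set ℝ) ∩ Set.Ioc (n : ℝ) (n + 1) := by
      intro x hx
      have h1 := Int.ceil_lt_add_one x
      refine Set.mem_iUnion.2 ⟨⌈x⌉ - 1, hx, ?_, ?_⟩
      · push_cast; linarith
      · push_cast; linarith [Int.le_ceil x]
    exact measure_mono_null hsub (measure_iUnion_null fun n => (key n).trans h)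

/-- Real-line form of membership in the ratio set. -/
def EssValue (f : SLift) (t : ℝ) : Prop :=
  ∀ A : Set ℝ, MeasurableSet A → (∀ (x : ℝ) (n : ℤ), x + n ∈ A ↔ x ∈ A) → 0 < volume A →
    ∀ ε : ℝ, 0 < ε → ∃ i : ℤ,
      0 < volume {x | x ∈ A ∧ (f ^ i) x ∈ A ∧ |deriv (f ^ i : SLift) x - t| < ε}

theorem EssValue.mem_ratioSet (hF : ∀ (i : ℤ) (x : ℝ), Fz i x = ((f ^ i) x : ℝ))
    (hD : ∀ (i : ℤ) (x : ℝ), D i x = deriv (f ^ i : SLift) x) {t : ℝ} (ht : 0 ≤ t)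
    (h : EssValue f t) : t ∈ ratioSet Fz D := by
  refine ⟨ht, fun A hA hApos ε hε => ?_⟩
  have hmk : Measurable ((↑) : ℝ → UnitAddCircle) := (AddCircle.continuous_mk' 1).measurable
  obtain ⟨i, hi⟩ := h ((↑) ⁻¹' A) (hmk hA)
    (fun x n => by rw [Set.mem_preimage, Set.mem_preimage, coe_add_int])
    ((volume_preimage_pos hA).1 hApos) ε hε
  have hFc : Continuous (Fz i) := continuous_of_lift
    ((AddCircle.continuous_mk' 1).comp (f ^ i : SLift).continuous) (hF i)
  have hDc : Continuous (D i) := continuous_of_lift (f ^ i : SLift).dsmooth.continuous (hD i)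
  have hB : MeasurableSet {y | y ∈ A ∧ Fz i y ∈ A ∧ |D i y - t| < ε} :=
    hA.inter ((hFc.measurable hA).inter
      (isOpen_lt (hDc.sub continuous_const).abs continuous_const).measurableSet)
  refine ⟨_, hB, fun y hy => hy.1, (volume_preimage_pos hB).2 ?_, i, ?_, fun y hy => hy.2.2⟩
  · convert hi using 2
    ext x
    simp only [Set.mem_preimage, Set.mem_ofPred_eq, hF, hD]
  · rintro _ ⟨y, hy, rfl⟩
    exact hy.2.1

theorem exists_return_of_mem_ratioSet (hF : ∀ (i : ℤ) (x : ℝ), Fz i x = ((f ^ i) x : ℝ))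
    (hD : ∀ (i : ℤ) (x : ℝ), D i x = deriv (f ^ i : SLift) x) {t : ℝ} (ht : t ∈ ratioSet Fz D)
    {A : Set ℝ} (hA : MeasurableSet A) (hpos : 0 < volume (A ∩ Set.Ioc 0 1)) {ε : ℝ}
    (hε : 0 < ε) : ∃ x ∈ A, ∃ i n : ℤ, (f ^ i) x + n ∈ A ∧ |deriv (f ^ i : SLift) x - t| < ε := by
  set e : UnitAddCircle → ℝ := fun y => (AddCircle.measurableEquivIoc 1 0 y : ℝ) with he
  have hem : Measurable e := measurable_subtype_coe.comp (MeasurableEquiv.measurable _)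
  have hee : ∀ y, (e y : UnitAddCircle) = y := fun y => AddCircle.coe_equivIoc
  have hmem : ∀ x ∈ Set.Ioc (0 : ℝ) 1, e x = x := fun x hx =>
    AddCircle.equivIoc_coe_of_mem (p := (1 : ℝ)) (a := 0) (by simpa using hx)
  have hA' : MeasurableSet (e ⁻¹' A) := hem hA
  have hApos : 0 < volume (e ⁻¹' A) := by
    refine (volume_preimage_pos hA').2 (hpos.trans_le (measure_mono ?_))
    rintro x ⟨hx, hx'⟩
    rw [Set.mem_preimage, Set.mem_preimage, hmem x hx']; exact hx
  obtain ⟨B, _, hBA, hBpos, i, hBi, hBD⟩ := ht.2 _ hA' hApos ε hε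
  obtain ⟨y, hy⟩ := nonempty_of_measure_ne_zero hBpos.ne'
  have h1 := hBi ⟨y, hy, rfl⟩
  rw [← hee y, hF] at h1
  obtain ⟨n, hn⟩ := coe_eq_coe_add_int (hee ((f ^ i) (e y) : ℝ))
  refine ⟨e y, hBA hy, i, n, ?_, ?_⟩
  · rw [← hn]; exact h1
  · have := hBD y hy
    rwa [← hee y, hD] at this

end Circle

theorem EssValue.one (f : SLift) : EssValue f 1 := by
  intro A _ _ hA ε hε
  refine ⟨0, ?_⟩
  have h : deriv (1 : SLift) = fun _ => 1 := deriv_id_eq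
  simpa [SLift.one_apply, h, hε] using hA

theorem measurableSet_return (f : SLift) {A : Set ℝ} (hA : MeasurableSet A) (t ε : ℝ) :
    MeasurableSet {x | x ∈ A ∧ f x ∈ A ∧ |deriv f x - t| < ε} :=
  hA.inter ((f.continuous.measurable hA).inter
    (isOpen_lt (f.dsmooth.continuous.sub continuous_const).abs continuous_const).measurableSet)

theorem EssValue.mul {f : SLift} {s t : ℝ} (hs : EssValue f s) (ht : EssValue f t) :
    EssValue f (s * t) := by
  intro A hA hper hpos ε hε
  have hc : Tendsto (fun p : ℝ × ℝ => p.1 * p.2) (𝓝 (s, t)) (𝓝 (s * t)) :=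
    (continuous_fst.mul continuous_snd).tendsto _
  obtain ⟨δ, hδ, hδ'⟩ := Metric.eventually_nhds_iff.1 (Metric.tendsto_nhds.1 hc ε hε)
  obtain ⟨i, hi⟩ := hs A hA hper hpos δ hδ
  obtain ⟨j, hj⟩ := ht _ (measurableSet_return (f ^ i) hA s δ) (fun x n => by
    simp only [Set.mem_ofPred_eq, SLift.map_add_int, SLift.deriv_add_int, hper]) hi δ hδ
  refine ⟨i + j, hj.trans_le (measure_mono ?_)⟩
  rintro x ⟨⟨h1, _, _⟩, ⟨_, h2, h3⟩, h4⟩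
  refine ⟨h1, by rw [zpow_add]; exact h2, ?_⟩
  rw [zpow_add, SLift.deriv_mul]
  have := @hδ' (deriv (f ^ i : SLift) ((f ^ j) x), deriv (f ^ j : SLift) x)
    (by rw [Prod.dist_eq, max_lt_iff, Real.dist_eq, Real.dist_eq]; exact ⟨h3, h4⟩)
  rwa [Real.dist_eq] at this

theorem EssValue.inv {f : SLift} {t : ℝ} (ht : EssValue f t) (h0 : 0 < t) : EssValue f t⁻¹ := by
  intro A hA hper hpos ε hε
  obtain ⟨δ, hδ, hδ'⟩ := Metric.eventually_nhds_iff.1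
    (Metric.tendsto_nhds.1 (tendsto_inv₀ h0.ne') ε hε)
  obtain ⟨i, hi⟩ := ht A hA hper hpos δ hδ
  refine ⟨-i, ?_⟩
  set C := {x | x ∈ A ∧ (f ^ i) x ∈ A ∧ |deriv (f ^ i : SLift) x - t| < δ} with hC
  have h1 : 0 < volume ((f ^ i : SLift) '' C) := by
    rw [pos_iff_ne_zero] at hi ⊢
    contrapose! hi
    have := addHaar_image_eq_zero_of_differentiableOn_of_addHaar_eq_zero volume
      (smooth_diff ((f ^ i)⁻¹ : SLift).smooth).differentiableOn hi
    rw [← Set.image_comp] at this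
    rwa [show (((f ^ i)⁻¹ : SLift) : ℝ → ℝ) ∘ (f ^ i : SLift) = id from
      funext fun x => SLift.inv_apply_self _ _, Set.image_id] at this
  refine h1.trans_le (measure_mono ?_)
  rintro _ ⟨x, ⟨hx1, hx2, hx3⟩, rfl⟩
  refine ⟨hx2, ?_, ?_⟩
  · rw [zpow_neg, SLift.inv_apply_self]; exact hx1
  · rw [zpow_neg, SLift.deriv_inv_apply]
    have := @hδ' (deriv (f ^ i : SLift) x) (by rw [Real.dist_eq]; exact hx3)
    rwa [Real.dist_eq] at this

theorem EssValue.pow {f : SLift} {t : ℝ} (ht : EssValue f t) (n : ℕ) : EssValue f (t ^ n) := by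
  induction n with
  | zero => rw [pow_zero]; exact .one f
  | succ n ih => rw [pow_succ]; exact ih.mul ht

theorem EssValue.zpow {f : SLift} {t : ℝ} (ht : EssValue f t) (h0 : 0 < t) (n : ℤ) :
    EssValue f (t ^ n) := by
  obtain ⟨n, rfl | rfl⟩ := n.eq_nat_or_neg
  · rw [zpow_natCast]; exact ht.pow n
  · rw [zpow_neg, zpow_natCast]; exact (ht.pow n).inv (by positivity)

theorem EssValue.zero {f : SLift} {t : ℝ} (ht : EssValue f t) (h1 : 1 < t) : EssValue f 0 := by
  intro A hA hper hpos ε hε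
  obtain ⟨n, hn⟩ := exists_pow_lt_of_lt_one (half_pos hε) (inv_lt_one_of_one_lt₀ h1)
  have h0 : 0 < t := by linarith
  obtain ⟨i, hi⟩ := (ht.inv h0).pow n A hA hper hpos (ε / 2) (half_pos hε)
  refine ⟨i, hi.trans_le (measure_mono ?_)⟩
  rintro x ⟨h1, h2, h3⟩
  refine ⟨h1, h2, ?_⟩
  have : 0 < t⁻¹ ^ n := by positivity
  rw [abs_lt] at h3 ⊢
  constructor <;> linarith [h3.1, h3.2, (f ^ i : SLift).dpos x]

theorem SLift.volume_le_image (f : SLift) {c : ℝ} (hc : 0 < c) {E : Set ℝ} (hE : MeasurableSet E)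
    (h : ∀ x ∈ E, c ≤ deriv f x) : volume E ≤ ENNReal.ofReal c⁻¹ * volume (f '' E) := by
  have h1 := lintegral_image_eq_lintegral_abs_deriv_mul hE
    (fun x _ => (f.hasDeriv x).hasDerivWithinAt) f.strictMono.injective.injOn (fun _ => 1)
  rw [setLIntegral_one] at h1
  have h2 : ENNReal.ofReal c * volume E ≤ volume (f '' E) := by
    rw [h1, ← setLIntegral_const]
    refine setLIntegral_mono' hE fun x hx => ?_
    rw [mul_one]
    exact ENNReal.ofReal_le_ofReal ((h x hx).trans (le_abs_self _))
  calc volume E = ENNReal.ofReal c⁻¹ * (ENNReal.ofReal c * volume E) := by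
        rw [← mul_assoc, ← ENNReal.ofReal_mul (by positivity), inv_mul_cancel₀ hc.ne',
          ENNReal.ofReal_one, one_mul]
    _ ≤ _ := by gcongr

/-- Near a density point, the complement of a set is negligible in small balls. -/
theorem exists_density_point {A : Set ℝ} (hA : MeasurableSet A) (hpos : 0 < volume A) {δ : ℝ}
    (hδ : 0 < δ) : ∃ x, ∃ r₀ > 0, ∀ ρ, 0 < ρ → ρ ≤ r₀ →
      volume (Set.Icc (x - ρ) (x + ρ) \ A) ≤ ENNReal.ofReal (δ * ρ) := by
  have h := Besicovitch.ae_tendsto_measure_inter_div (volume : Measure ℝ) A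
  have hne : (volume.restrict A) ≠ 0 := by
    rw [Ne, Measure.restrict_eq_zero]; exact hpos.ne'
  have : NeBot (ae (volume.restrict A)) := ae_neBot.2 hne
  obtain ⟨x, hx⟩ := h.exists
  have hlt : ENNReal.ofReal (1 - δ / 2) < 1 := by
    rw [ENNReal.ofReal_lt_one]; linarith
  obtain ⟨r₀, hr₀, hr⟩ := mem_nhdsGT_iff_exists_Ioc_subset.1 (hx.eventually_const_lt hlt)
  refine ⟨x, r₀, hr₀, fun ρ hρ hρ' => ?_⟩
  have h1 : ENNReal.ofReal (1 - δ / 2) < volume (A ∩ Metric.closedBall x ρ) /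
    volume (Metric.closedBall x ρ) := hr ⟨hρ, hρ'⟩
  rw [Real.closedBall_eq_Icc] at h1
  have hv : volume (Set.Icc (x - ρ) (x + ρ)) = ENNReal.ofReal (2 * ρ) := by
    rw [Real.volume_Icc]; congr 1; ring
  have h2 : ENNReal.ofReal ((1 - δ / 2) * (2 * ρ)) ≤ volume (A ∩ Set.Icc (x - ρ) (x + ρ)) := by
    rw [ENNReal.ofReal_mul' (by positivity), ← hv]
    exact ENNReal.mul_le_of_le_div h1.le
  have h3 : volume (Set.Icc (x - ρ) (x + ρ) \ A) + volume (A ∩ Set.Icc (x - ρ) (x + ρ)) =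
      ENNReal.ofReal (2 * ρ) := by
    rw [← hv, Set.inter_comm A, add_comm, measure_inter_add_sdiff _ hA]
  have hfin : volume (A ∩ Set.Icc (x - ρ) (x + ρ)) ≠ ⊤ :=
    measure_ne_top_of_subset Set.inter_subset_right (by rw [hv]; exact ENNReal.ofReal_ne_top)
  rw [ENNReal.eq_sub_of_add_eq hfin h3]
  calc _ ≤ ENNReal.ofReal (2 * ρ) - ENNReal.ofReal ((1 - δ / 2) * (2 * ρ)) :=
        tsub_le_tsub_left h2 _
    _ ≤ ENNReal.ofReal (δ * ρ) := by
      rw [tsub_le_iff_right]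
      refine le_trans (ENNReal.ofReal_le_ofReal ?_) ENNReal.ofReal_add_le
      linarith

section

variable {α lam : ℝ} {r : ℕ} {S : ℕ → Stage} {f : SLift}

theorem Stage.essValue (hlam : 1 < lam) (hS : ∀ n, (S n).Step α lam r n (S (n + 1)))
    (hf : ∀ n, ∀ i : ℤ, |i| ≤ (S n).N →
      CloseTo (r + n) (S n).κ (f ^ i : SLift) (conj (S n).H α i)) : EssValue f lam := by
  intro A hA hper hpos ε hε
  have hlam0 : 0 < lam := by linarith
  set δ : ℝ := 1 / (480 * lam ^ 2) with hδ
  have hδ0 : 0 < δ := by positivity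
  obtain ⟨x, r₀, hr₀, hx⟩ := exists_density_point hA hpos hδ0
  have hκ := Stage.κ_tendsto hS
  have hsmall : ∀ᶠ n : ℕ in atTop, (S (n + 1)).κ + 1 / ((n : ℝ) + 1) < min ε (1 / 2) ∧
      1 / ((n : ℝ) + 1) < r₀ / 2 := by
    have h1 := ((tendsto_add_atTop_iff_nat 1).2 hκ).add
        (tendsto_one_div_add_atTop_nhds_zero_nat (𝕜 := ℝ))
    rw [add_zero] at h1
    exact (h1.eventually_lt_const (by positivity)).and
      (tendsto_one_div_add_atTop_nhds_zero_nat.eventually_lt_const (by positivity))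
  obtain ⟨n, hn1, hn2⟩ := hsmall.exists
  obtain ⟨i, hi, l, hrec⟩ := (hS n).recur
  obtain ⟨a, ρ, hρ, hρ1, hκρ, hsub, hz⟩ := hrec x
  have hclose := hf (n + 1) i hi
  set c := ρ / (48 * lam ^ 2) with hc
  have hcδ : c = 10 * δ * ρ := by rw [hc, hδ]; field_simp; norm_num
  have hd : ∀ z ∈ Set.Icc a (a + c), |deriv (f ^ i : SLift) z - lam| < min ε (1 / 2) := by
    intro z hzm
    have h1 := hclose.iter (SLift.smooth _) (SLift.smooth _) (by omega : 1 ≤ r + (n + 1)) z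
    rw [iteratedDeriv_one, iteratedDeriv_one] at h1
    have h2 := abs_sub_le (deriv (f ^ i : SLift) z) (deriv (conj (S (n + 1)).H α i) z) lam
    linarith [(hz z hzm).2]
  have hloc : ∀ z ∈ Set.Icc a (a + c), (f ^ i) z - l ∈ Set.Icc (x - 2 * ρ) (x + 2 * ρ) := by
    intro z hzm
    have h1 := abs_le.1 (hclose.abs_sub z)
    have h2 := abs_le.1 (hz z hzm).1
    constructor <;> linarith [h1.1, h1.2, h2.1, h2.2]
  set E := {z | z ∈ Set.Icc a (a + c) ∧ (f ^ i) z ∉ A} with hE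
  have hEm : MeasurableSet E :=
    measurableSet_Icc.inter ((f ^ i : SLift).continuous.measurable hA.compl)
  set F := (SLift.rot (-l) * f ^ i : SLift) with hF
  have hFd : ∀ z, deriv F z = deriv (f ^ i : SLift) z := fun z => by
    rw [hF, SLift.deriv_mul, SLift.deriv_rot, one_mul]
  have hFE : F '' E ⊆ Set.Icc (x - 2 * ρ) (x + 2 * ρ) \ A := by
    rintro _ ⟨z, ⟨hz1, hz2⟩, rfl⟩
    have e : F z = (f ^ i) z - l := by
      rw [hF, SLift.mul_apply, SLift.rot_apply, sub_eq_add_neg]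
    rw [e]
    refine ⟨hloc z hz1, fun h => hz2 ?_⟩
    rw [← hper _ (-l)]
    push_cast
    rwa [← sub_eq_add_neg]
  have hEv : volume E ≤ ENNReal.ofReal (4 * δ * ρ) := by
    refine (F.volume_le_image (c := 1 / 2) (by norm_num) hEm fun z hz => ?_).trans ?_
    · rw [hFd]
      have := abs_lt.1 ((hd z hz.1).trans_le (min_le_right _ _))
      linarith [this.1]
    · calc _ ≤ ENNReal.ofReal (1 / 2)⁻¹ * ENNReal.ofReal (δ * (2 * ρ)) := by
            gcongr
            exact (measure_mono hFE).trans (hx _ (by positivity) (by linarith))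
        _ = _ := by
          rw [← ENNReal.ofReal_mul (by norm_num)]; congr 1; ring
  have hAv : volume (Set.Icc a (a + c) \ A) ≤ ENNReal.ofReal (δ * ρ) :=
    (measure_mono (Set.sdiff_subset_sdiff_left hsub)).trans (hx ρ hρ (by linarith))
  refine ⟨i, ?_⟩
  set T := {x | x ∈ A ∧ (f ^ i) x ∈ A ∧ |deriv (f ^ i : SLift) x - lam| < ε} with hT
  have hcov : Set.Icc a (a + c) ⊆ T ∪ (Set.Icc a (a + c) \ A ∪ E) := by
    intro z hzm
    by_cases h1 : z ∈ A
    · by_cases h2 : (f ^ i) z ∈ A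
      · exact Or.inl ⟨h1, h2, (hd z hzm).trans_le (min_le_left _ _)⟩
      · exact Or.inr (Or.inr ⟨hzm, h2⟩)
    · exact Or.inr (Or.inl ⟨hzm, h1⟩)
  rw [pos_iff_ne_zero]
  intro h0
  have h1 := (measure_mono (μ := volume) hcov).trans ((measure_union_le _ _).trans
    (add_le_add_right (measure_union_le _ _) _))
  rw [Real.volume_Icc, h0, zero_add] at h1
  have h2 := h1.trans (add_le_add hAv hEv)
  rw [← ENNReal.ofReal_add (by positivity) (by positivity),
    ENNReal.ofReal_le_ofReal_iff (by positivity)] at h2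
  have : 0 < δ * ρ := by positivity
  linarith

/-- Along good points, the derivative of the conjugacy is that of the initial one, up to a constant
and powers of `lam`. -/
theorem Stage.deriv_eq_of_good (hlam : 1 < lam) {κ : ℕ → ℝ} (hκ : Antitone κ)
    {H : ℕ → SLift} {G : ℕ → Set ℝ} (hG : ∀ n, ∃ c, 0 < c ∧ ∀ z ∈ G n, ∀ z', |z' - z| ≤ κ (n + 1) →
      ∃ e : ℤ, deriv (H (n + 1)) ((H (n + 1))⁻¹ z') = deriv (H n) ((H n)⁻¹ z') * c * lam ^ e)
    (k : ℕ) : ∃ c, 0 < c ∧ ∀ z, (∀ n, z ∈ G n) → ∀ z', |z' - z| ≤ κ k →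
      ∃ e : ℤ, deriv (H k) ((H k)⁻¹ z') = deriv (H 0) ((H 0)⁻¹ z') * c * lam ^ e := by
  have hlam0 : lam ≠ 0 := by linarith
  induction k with
  | zero => exact ⟨1, one_pos, fun z _ z' _ => ⟨0, by simp⟩⟩
  | succ k ih =>
    obtain ⟨c, hc, h⟩ := ih
    obtain ⟨c', hc', h'⟩ := hG k
    refine ⟨c * c', by positivity, fun z hz z' hz' => ?_⟩
    obtain ⟨e, he⟩ := h z hz z' (hz'.trans (hκ (Nat.le_succ k)))
    obtain ⟨e', he'⟩ := h' z (hz k) z' hz'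
    refine ⟨e + e', ?_⟩
    rw [he', he, zpow_add₀ hlam0]; ring

theorem Stage.log_deriv (hlam : 1 < lam) (hS : ∀ n, (S n).Step α lam r n (S (n + 1)))
    (hf : ∀ n, ∀ i : ℤ, |i| ≤ (S n).N →
      CloseTo (r + n) (S n).κ (f ^ i : SLift) (conj (S n).H α i)) {G : ℕ → Set ℝ}
    (hG : ∀ n, ∃ c, 0 < c ∧ ∀ z ∈ G n, ∀ z', |z' - z| ≤ (S (n + 1)).κ → ∃ e : ℤ,
      deriv (S (n + 1)).H ((S (n + 1)).H⁻¹ z') = deriv (S n).H ((S n).H⁻¹ z') * c * lam ^ e)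
    {x : ℝ} (hx : ∀ n, x ∈ G n) {i m : ℤ} (hx' : ∀ n, (f ^ i) x + m ∈ G n) :
    ∃ e : ℤ, Real.log (deriv (f ^ i : SLift) x) = e * Real.log lam +
      (Real.log (deriv (S 0).H ((S 0).H⁻¹ ((f ^ i) x + m))) -
        Real.log (deriv (S 0).H ((S 0).H⁻¹ x))) := by
  have hlam0 : 0 < lam := by linarith
  have hlog : 0 < Real.log lam := Real.log_pos hlam
  set w : ℝ → ℝ := fun z => Real.log (deriv (S 0).H ((S 0).H⁻¹ z)) with hw
  have hwc : Continuous w := ((S 0).H.dsmooth.continuous.comp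
    ((S 0).H⁻¹).continuous).log fun z => ((S 0).H.dpos _).ne'
  set u : ℕ → ℝ := fun k => (Real.log (deriv (conj (S k).H α i) x) -
    (w (conj (S k).H α i x + m) - w x)) / Real.log lam with hu
  have hN : ∀ᶠ k : ℕ in atTop, 1 ≤ k ∧ |i| ≤ (S k).N := by
    filter_upwards [eventually_ge_atTop (max 1 i.natAbs)] with k hk
    refine ⟨le_of_max_le_left hk, ?_⟩
    rw [Int.abs_eq_natAbs]
    exact_mod_cast (le_of_max_le_right hk).trans (Stage.le_N hS k)
  have hconv : ∀ (j : ℕ), j ≤ 1 → Tendsto (fun k => iteratedDeriv j (conj (S k).H α i) x) atTop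
      (𝓝 (iteratedDeriv j (f ^ i : SLift) x)) := by
    intro j hj
    rw [tendsto_iff_dist_tendsto_zero]
    refine squeeze_zero' (Eventually.of_forall fun k => dist_nonneg) ?_ (Stage.κ_tendsto hS)
    filter_upwards [hN] with k hk
    rw [dist_comm, Real.dist_eq]
    exact (hf k i hk.2).iter (SLift.smooth _) (SLift.smooth _) (by omega) x
  have h0 := hconv 0 zero_le_one
  have h1 := hconv 1 le_rfl
  simp only [iteratedDeriv_zero] at h0
  simp only [iteratedDeriv_one] at h1
  have hulim : Tendsto u atTop (𝓝 ((Real.log (deriv (f ^ i : SLift) x) -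
      (w ((f ^ i) x + m) - w x)) / Real.log lam)) :=
    ((h1.log (SLift.dpos _ _).ne').sub
      (((hwc.tendsto _).comp (h0.add_const _)).sub_const _)).div_const _
  have hmem : ∀ᶠ k in atTop, u k ∈ Set.range ((↑) : ℤ → ℝ) := by
    filter_upwards [hN] with k hk
    obtain ⟨c, hc, hk'⟩ := Stage.deriv_eq_of_good hlam (κ := fun n => (S n).κ)
      (H := fun n => (S n).H) (Stage.κ_anti hS) hG k
    obtain ⟨e, he⟩ := hk' x hx x (by simpa using (S k).κ_pos.le)
    obtain ⟨e', he'⟩ := hk' _ hx' (conj (S k).H α i x + m) (by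
      rw [add_sub_add_right_eq_sub, abs_sub_comm]; exact (hf k i hk.2).abs_sub x)
    refine ⟨e' - e, ?_⟩
    have e1 : deriv (conj (S k).H α i) x = deriv (S k).H ((S k).H⁻¹ (conj (S k).H α i x + m)) /
        deriv (S k).H ((S k).H⁻¹ x) := by
      rw [deriv_conj, SLift.map_add_int, SLift.deriv_add_int, conj_apply, SLift.inv_apply_self]
    have p := (S 0).H.dpos
    rw [hu]
    simp only
    rw [e1, he, he', Real.log_div (by have := p ((S 0).H⁻¹ (conj (S k).H α i x + m)); positivity)
      (by have := p ((S 0).H⁻¹ x); positivity), Real.log_mul (by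
        have := p ((S 0).H⁻¹ (conj (S k).H α i x + m)); positivity) (by positivity),
      Real.log_mul (p _).ne' hc.ne', Real.log_mul (by
        have := p ((S 0).H⁻¹ x); positivity) (by positivity),
      Real.log_mul (p _).ne' hc.ne', Real.log_zpow, Real.log_zpow]
    rw [eq_div_iff hlog.ne']
    push_cast
    ring
  obtain ⟨e, he⟩ := Int.isClosedEmbedding_coe_real.isClosed_range.mem_of_tendsto hulim hmem
  refine ⟨e, ?_⟩
  rw [he]
  field_simp
  ring

theorem Stage.volume_good {G : ℕ → Set ℝ}
    (hv : ∀ n, volume (Set.Icc 0 1 \ G n) ≤ ENNReal.ofReal ((1 / 4) ^ (n + 1))) :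
    0 < volume ((⋂ n, G n) ∩ Set.Ioc 0 1) := by
  rw [pos_iff_ne_zero]
  intro h0
  have hcov : Set.Ioc (0 : ℝ) 1 ⊆ ((⋂ n, G n) ∩ Set.Ioc 0 1) ∪ ⋃ n, Set.Icc 0 1 \ G n := by
    intro z hz
    by_cases h : ∀ n, z ∈ G n
    · exact Or.inl ⟨Set.mem_iInter.2 h, hz⟩
    · push Not at h
      obtain ⟨n, hn⟩ := h
      exact Or.inr (Set.mem_iUnion.2 ⟨n, Set.Ioc_subset_Icc_self hz, hn⟩)
  have h1 := (measure_mono hcov).trans ((measure_union_le _ _).trans (add_le_add_right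
    ((measure_iUnion_le _).trans (ENNReal.tsum_le_tsum hv)) _))
  have hs : HasSum (fun n : ℕ => (1 / 4 : ℝ) ^ (n + 1)) (1 / 3) := by
    have := (hasSum_geometric_of_lt_one (by norm_num : (0 : ℝ) ≤ 1 / 4) (by norm_num)).mul_right
      (1 / 4 : ℝ)
    rw [show (1 - 1 / 4 : ℝ)⁻¹ * (1 / 4) = 1 / 3 by norm_num] at this
    simpa only [pow_succ] using this
  rw [h0, zero_add, ← ENNReal.ofReal_tsum_of_nonneg (fun n => by positivity) hs.summable,
    hs.tsum_eq, Real.volume_Ioc, ENNReal.ofReal_le_ofReal_iff (by norm_num)] at h1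
  norm_num at h1

theorem Stage.ratioSet_subset (hlam : 1 < lam) (hS : ∀ n, (S n).Step α lam r n (S (n + 1)))
    (hf : ∀ n, ∀ i : ℤ, |i| ≤ (S n).N →
      CloseTo (r + n) (S n).κ (f ^ i : SLift) (conj (S n).H α i))
    {Fz : ℤ → UnitAddCircle → UnitAddCircle} {D : ℤ → UnitAddCircle → ℝ}
    (hF : ∀ (i : ℤ) (x : ℝ), Fz i x = ((f ^ i) x : ℝ))
    (hD : ∀ (i : ℤ) (x : ℝ), D i x = deriv (f ^ i : SLift) x) {t : ℝ} (ht : t ∈ ratioSet Fz D)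
    (h0 : 0 < t) : ∃ n : ℤ, t = lam ^ n := by
  have hlam0 : 0 < lam := by linarith
  have hlog : 0 < Real.log lam := Real.log_pos hlam
  choose G hGm hGv hG using fun n => (hS n).good
  have hpos := Stage.volume_good hGv
  set w : ℝ → ℝ := fun z => Real.log (deriv (S 0).H ((S 0).H⁻¹ z)) with hw
  have hwc : Continuous w := ((S 0).H.dsmooth.continuous.comp
    ((S 0).H⁻¹).continuous).log fun z => ((S 0).H.dpos _).ne'
  have hmem : Real.log t / Real.log lam ∈ closure (Set.range ((↑) : ℤ → ℝ)) := by
    rw [Metric.mem_closure_iff]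
    intro ε hε
    set η := ε * Real.log lam / 3 with hη
    have hη0 : 0 < η := by positivity
    set A : ℤ → Set ℝ := fun k => (⋂ n, G n) ∩ w ⁻¹' Set.Ico (k * η) ((k + 1) * η) with hA
    have hAm : ∀ k, MeasurableSet (A k) := fun k =>
      (MeasurableSet.iInter hGm).inter (hwc.measurable measurableSet_Ico)
    obtain ⟨k, hk⟩ : ∃ k, 0 < volume (A k ∩ Set.Ioc 0 1) := by
      by_contra! h
      refine hpos.ne' (measure_mono_null (t := ⋃ k, A k ∩ Set.Ioc 0 1) ?_
        (measure_iUnion_null fun k => nonpos_iff_eq_zero.1 (h k)))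
      rintro z ⟨hz1, hz2⟩
      refine Set.mem_iUnion.2 ⟨⌊w z / η⌋, ⟨hz1, ?_, ?_⟩, hz2⟩
      · rw [← le_div_iff₀ hη0]; exact Int.floor_le _
      · rw [← div_lt_iff₀ hη0]; exact Int.lt_floor_add_one _
    obtain ⟨δ, hδ, hδ'⟩ := Metric.eventually_nhds_iff.1
      (Metric.tendsto_nhds.1 (Real.continuousAt_log h0.ne') η hη0)
    obtain ⟨x, hx, i, m, hx', hd⟩ := exists_return_of_mem_ratioSet hF hD ht (hAm k) hk hδ
    obtain ⟨e, he⟩ := Stage.log_deriv hlam hS hf hG (Set.mem_iInter.1 hx.1)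
      (Set.mem_iInter.1 hx'.1)
    refine ⟨e, ⟨e, rfl⟩, ?_⟩
    have h1 := hδ' (y := deriv (f ^ i : SLift) x) (by rw [Real.dist_eq]; exact hd)
    rw [Real.dist_eq, he] at h1
    have h2 : w x ∈ Set.Ico (k * η) ((k + 1) * η) := hx.2
    have h3 : w ((f ^ i) x + m) ∈ Set.Ico (k * η) ((k + 1) * η) := hx'.2
    have h4 := abs_lt.1 h1
    rw [Real.dist_eq, div_sub' hlog.ne', abs_div, abs_of_pos hlog, div_lt_iff₀ hlog, abs_lt]
    constructor <;> linarith [h2.1, h2.2, h3.1, h3.2, h4.1, h4.2]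
  rw [Int.isClosedEmbedding_coe_real.isClosed_range.closure_eq] at hmem
  obtain ⟨n, hn⟩ := hmem
  refine ⟨n, ?_⟩
  rw [eq_div_iff hlog.ne', ← Real.log_zpow] at hn
  exact (Real.log_injOn_pos (by positivity : (0 : ℝ) < lam ^ n) h0 hn).symm

end

/-- Conjugates of a Liouville rotation are approximated by type `III_lam` diffeomorphisms. -/
theorem exists_typeIII {α lam : ℝ} (hα : Liouville α) (hlam : 1 < lam) (H : SLift) (r : ℕ) {ε : ℝ}
    (hε : 0 < ε) : ∃ f : SLift, CloseTo r ε f (conj H α 1) ∧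
      CloseTo r ε (f⁻¹ : SLift) (conj H α (-1)) ∧
      (∃ C, ∀ i : ℤ, |(f ^ i) 0 - i * α| ≤ C) ∧
      ∀ (Fz : ℤ → UnitAddCircle → UnitAddCircle) (D : ℤ → UnitAddCircle → ℝ),
        (∀ (i : ℤ) (x : ℝ), Fz i x = ((f ^ i) x : ℝ)) →
        (∀ (i : ℤ) (x : ℝ), D i x = deriv (f ^ i : SLift) x) →
        ratioSet Fz D = {t : ℝ | ∃ n : ℤ, t = lam ^ n} ∪ {0} := by
  choose next hnext using fun n S => Stage.exists_step hα hlam r n S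
  let S : ℕ → Stage := fun n => Nat.rec ⟨H, 1, ε, hε⟩ next n
  have hS : ∀ n, (S n).Step α lam r n (S (n + 1)) := fun n => hnext n (S n)
  obtain ⟨f, hf⟩ := Stage.exists_limit hS
  have hS0 : S 0 = ⟨H, 1, ε, hε⟩ := rfl
  have hlam0 : 0 < lam := by linarith
  refine ⟨f, ?_, ?_, ⟨1 + ε, fun i => ?_⟩, fun Fz D hF hD => Set.Subset.antisymm ?_ ?_⟩
  · have := hf 0 1 (by simp [hS0])
    rwa [zpow_one] at this
  · have := hf 0 (-1) (by simp [hS0])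
    rwa [zpow_neg_one] at this
  · have h1 := (hf i.natAbs i (by
      rw [Int.abs_eq_natAbs]; exact_mod_cast Stage.le_N hS _)).abs_sub 0
    have h2 := abs_conj_apply_sub (S i.natAbs).H α i 0
    have h3 : (S i.natAbs).κ ≤ ε := Stage.κ_anti hS (Nat.zero_le _)
    have h4 := abs_sub_le ((f ^ i) 0) (conj (S i.natAbs).H α i 0) (i * α)
    rw [sub_zero] at h2
    linarith
  · intro t ht
    rcases ht.1.eq_or_lt with h | h
    · exact Or.inr h.symm
    · exact Or.inl (Stage.ratioSet_subset hlam hS hf hF hD ht h)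
  · have h := Stage.essValue hlam hS hf
    rintro t (⟨n, rfl⟩ | rfl)
    · exact (h.zpow hlam0 n).mem_ratioSet hF hD (by positivity)
    · exact (h.zero hlam).mem_ratioSet hF hD le_rfl

/-- A smooth lift, viewed as a degree one lift in the sense of Mathlib. -/
def SLift.toDeg1 : SLift →* CircleDeg1Lift where
  toFun f := ⟨⟨f, f.strictMono.monotone⟩, f.map_add_one⟩
  map_one' := rfl
  map_mul' _ _ := rfl

theorem SLift.toDeg1_apply (f : SLift) (x : ℝ) : f.toDeg1 x = f x := rfl

/-- The translation number of a smooth lift. -/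
def SLift.transl (f : SLift) : ℝ := f.toDeg1.translationNumber

theorem SLift.transl_of_pow_eq (f : SLift) {x : ℝ} {m : ℤ} {n : ℕ} (hn : 0 < n)
    (h : (f ^ n) x = x + m) : f.transl = m / n :=
  CircleDeg1Lift.translationNumber_of_map_pow_eq_add_int (f := f.toDeg1)
    (by rw [← map_pow]; exact h) hn

theorem SLift.transl_mul_rot_int (f : SLift) (n : ℤ) : (f * rot n).transl = f.transl + n := by
  unfold transl
  rw [map_mul, CircleDeg1Lift.translationNumber_mul_of_commute]
  · congr 1
    refine CircleDeg1Lift.translationNumber_of_eq_add_int (x := 0) _ ?_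
    rw [toDeg1_apply, rot_apply]
  · exact (show Commute f (rot n) from rot_int_comm f n).map toDeg1

theorem SLift.transl_pow (f : SLift) (k : ℕ) : (f ^ k).transl = k * f.transl := by
  unfold transl
  rw [map_pow, CircleDeg1Lift.translationNumber_pow]

theorem SLift.exists_int_rot_pow (f : SLift) {q : ℕ} {p : ℤ} (h : (f ^ q) 0 = p) (a : ℤ) (m : ℤ) :
    ((f ^ (q : ℤ)) ^ a) (m : ℝ) = m + a * p := by
  have key : ∀ m : ℤ, (f ^ (q : ℤ)) (m : ℝ) = m + p := fun m => by
    have := (f ^ q).map_add_int 0 m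
    rw [zpow_natCast, ← zero_add (m : ℝ), this, h]; ring
  induction a with
  | zero => simp [one_apply]
  | succ i ih =>
    rw [zpow_add_one, (Commute.zpow_self _ _).eq, mul_apply, ih]
    have := key (m + i * p)
    push_cast at this ⊢
    rw [this]; ring
  | pred i ih =>
    rw [zpow_sub_one, ((Commute.zpow_self _ _).inv_right).eq, mul_apply, ih]
    have := key (m + (-i - 1) * p)
    rw [← inv_apply_self (f ^ (q : ℤ)) ((m : ℝ) + ((-i - 1 : ℤ) : ℝ) * p)]
    congr 1
    push_cast at this ⊢
    rw [this]; ring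

/-- A cyclically ordered periodic orbit of rotation number `p / q`, indexed in increasing order. -/
structure GapData (f : SLift) (p : ℤ) (q : ℕ) (X : ℤ → ℝ) : Prop where
  q_pos : 0 < q
  mono : StrictMono X
  period : ∀ j, X (j + q) = X j + 1
  map : ∀ j, f (X j) = X (j + p)
  coprime : IsCoprime p (q : ℤ)

theorem GapData.exists_of_periodic (f : SLift) {p : ℤ} {q : ℕ} (hq : 0 < q)
    (hc : IsCoprime p (q : ℤ)) (h : (f ^ q) 0 = p) : ∃ X, GapData f p q X := by
  obtain ⟨a, b, hab⟩ := hc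
  have hcomm : Commute f (SLift.rot b) := SLift.rot_int_comm f b
  have hfN : Commute f (f ^ a * SLift.rot b) := ((Commute.refl f).zpow_right a).mul_right hcomm
  obtain ⟨N, hN⟩ : ∃ N, N = f ^ a * SLift.rot b := ⟨_, rfl⟩
  rw [← hN] at hfN
  have hNpow : ∀ k : ℤ, N ^ k = f ^ (a * k) * SLift.rot (b * k) := fun k => by
    rw [hN, (hcomm.zpow_left a).mul_zpow, ← zpow_mul, SLift.rot_zpow, mul_comm (k : ℝ)]
  have hNq : (N ^ (q : ℤ)) 0 = 1 := by
    have := f.exists_int_rot_pow h a (b * q)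
    rw [hNpow, SLift.mul_apply, SLift.rot_apply, mul_comm a, zpow_mul]
    push_cast at this ⊢
    rw [zero_add, this]
    exact_mod_cast (by linarith : b * q + a * p = 1)
  have hNp : (N ^ p) 0 = f 0 := by
    have e : a * p = 1 + q * (-b) := by linarith
    have := f.exists_int_rot_pow h (-b) (b * p)
    rw [hNpow, SLift.mul_apply, SLift.rot_apply, e, zpow_add, zpow_one, SLift.mul_apply, zpow_mul]
    push_cast at this ⊢
    rw [zero_add, this]
    congr 1; ring
  have hτ : N.transl = (1 : ℤ) / q := SLift.transl_of_pow_eq N hq (x := 0) (by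
    rw [← zpow_natCast, hNq]; simp)
  have hlt : ∀ x, x < N x := fun x => by
    have := CircleDeg1Lift.lt_map_of_int_lt_translationNumber N.toDeg1 (n := 0) (by
      change _ < N.transl
      rw [hτ]; push_cast; positivity) x
    simpa [SLift.toDeg1_apply] using this
  refine ⟨fun j => (N ^ j) 0, hq, strictMono_int_of_lt_succ fun j => ?_, fun j => ?_, fun j => ?_,
    ⟨a, b, hab⟩⟩
  · rw [zpow_add_one, (Commute.zpow_self _ _).eq]
    exact hlt _
  · rw [zpow_add, SLift.mul_apply, hNq]
    simpa using (N ^ j).map_add_one 0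
  · rw [zpow_add, SLift.mul_apply, hNp]
    exact congrArg (fun F : SLift => F 0) ((hfN.zpow_right j).eq)

theorem SLift.lt_of_lt_transl (f : SLift) {n : ℤ} (h : (n : ℝ) < f.transl) (x : ℝ) :
    x + n < f x :=
  CircleDeg1Lift.lt_map_of_int_lt_translationNumber f.toDeg1 h x

theorem SLift.lt_of_transl_lt (f : SLift) {n : ℤ} (h : f.transl < n) (x : ℝ) :
    f x < x + n :=
  CircleDeg1Lift.map_lt_of_translationNumber_lt_int f.toDeg1 h x

theorem SLift.transl_inv (f : SLift) : (f⁻¹ : SLift).transl = -f.transl := by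
  have := CircleDeg1Lift.translationNumber_units_inv (toDeg1.toHomUnits f)
  rwa [← map_inv, MonoidHom.coe_toHomUnits, MonoidHom.coe_toHomUnits] at this

theorem SLift.transl_conj (f g : SLift) : (f * g * f⁻¹).transl = g.transl := by
  have := CircleDeg1Lift.translationNumber_conj_eq (toDeg1.toHomUnits f) g.toDeg1
  rwa [← map_inv, MonoidHom.coe_toHomUnits, MonoidHom.coe_toHomUnits, ← map_mul, ← map_mul] at this

theorem exists_mul_add_int_mem {α : ℝ} (hα : Irrational α) {ε : ℝ} (hε : 0 < ε) :
    ∃ k : ℕ, 0 < k ∧ ∃ n : ℤ, -ε < k * α + n ∧ k * α + n < 0 := by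
  obtain ⟨N, hN⟩ := exists_nat_one_div_lt hε
  obtain ⟨j, k, hk, -, h⟩ := Real.exists_int_int_abs_mul_sub_le α (n := N + 1) (by omega)
  have hβ : |k * α - j| < ε := by
    refine h.trans_lt (lt_of_le_of_lt ?_ hN)
    push_cast
    gcongr
    linarith
  have hirr : ∀ (k j : ℤ), 0 < k → (k : ℝ) * α - j ≠ 0 := fun k j hk h0 =>
    ((hα.intCast_mul hk.ne').sub_intCast j).ne_zero h0
  obtain ⟨hβ1, hβ2⟩ := abs_lt.1 hβ
  lift k to ℕ using hk.le
  rcases lt_or_gt_of_ne (hirr k j hk) with hneg | hpos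
  · exact ⟨k, by exact_mod_cast hk, -j, by push_cast at *; linarith, by push_cast at *; linarith⟩
  · set β := ((k : ℤ) : ℝ) * α - j with hβd
    by_cases h1 : 1 < β
    · refine ⟨k, by exact_mod_cast hk, -j - ⌈β⌉, ?_, ?_⟩
      · have := Int.ceil_lt_add_one β
        push_cast at *; linarith
      · have := Int.le_ceil β
        have h2 := hirr k (j + ⌈β⌉) hk
        push_cast at *
        exact lt_of_le_of_ne (by linarith) (fun h => h2 (by linarith))
    · push Not at h1
      have hm := Nat.floor_le (a := 1 / β) (by positivity)
      have hm' := Nat.lt_floor_add_one (1 / β)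
      have hm1 : 0 < ⌊1 / β⌋₊ := Nat.floor_pos.2 (by rwa [le_div_iff₀ hpos, one_mul])
      set m := ⌊1 / β⌋₊
      rw [le_div_iff₀ hpos] at hm
      rw [div_lt_iff₀ hpos] at hm'
      have hk' : 0 < k := by exact_mod_cast hk
      refine ⟨m * k, by positivity, -(m * j) - 1, ?_, ?_⟩
      · push_cast at *
        have : (m : ℝ) * k * α + (-(m * j) - 1) = m * β - 1 := by rw [hβd]; ring
        rw [this]; nlinarith
      · have h2 := hirr (m * k) (m * j + 1) (by positivity)
        push_cast at *
        have : (m : ℝ) * k * α + (-(m * j) - 1) = m * β - 1 := by rw [hβd]; ring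
        rw [this]
        refine lt_of_le_of_ne (by linarith) fun h => h2 (by rw [← this] at h; linarith)

theorem SLift.lt_transl_rot_mul (g : SLift) (hg : Irrational g.transl) {η : ℝ} (hη : 0 < η) :
    g.transl < (rot η * g).transl := by
  obtain ⟨L, hL⟩ := exists_nat_gt (1 / η)
  have hL0 : (0 : ℝ) < L := lt_trans (by positivity) hL
  obtain ⟨k, hk, n, h1, h2⟩ := exists_mul_add_int_mem hg (ε := 1 / L) (by positivity)
  set G := g ^ k * rot n with hG
  have hGτ : G.transl = k * g.transl + n := by rw [hG, transl_mul_rot_int, transl_pow]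
  have hGL : -1 < (G ^ L) 0 := by
    have := (G ^ L).lt_of_lt_transl (n := -1) (by
      rw [transl_pow, hGτ]
      push_cast
      have := mul_lt_mul_of_pos_left h1 hL0
      field_simp at this
      linarith) 0
    simpa using this
  obtain ⟨i, hi⟩ : ∃ i : ℕ, (G ^ i) 0 - 1 / L < (G ^ (i + 1)) 0 := by
    by_contra! hcon
    have : ∀ i : ℕ, (G ^ i) 0 ≤ -(i / L) := fun i => by
      induction i with
      | zero => simp [one_apply]
      | succ i ih =>
        refine (hcon i).trans ?_
        push_cast
        rw [add_div]
        linarith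
    have := this L
    rw [div_self hL0.ne'] at this
    linarith
  set y := (G ^ i) 0
  rw [pow_succ', mul_apply] at hi
  have hgr : ∀ (m : ℕ) x, (g ^ (m + 1)) x + η ≤ ((rot η * g) ^ (m + 1)) x := fun m => by
    induction m with
    | zero => intro x; simp [mul_apply, rot_apply]
    | succ m ih =>
      intro x
      rw [pow_succ' _ (m + 1), pow_succ' _ (m + 1), mul_apply, mul_apply, mul_apply, rot_apply]
      gcongr
      exact g.strictMono.monotone ((le_add_of_nonneg_right hη.le).trans (ih x))
  have hk1 : k = k - 1 + 1 := by omega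
  have h3 : y < ((rot η * g) ^ k * rot n) y := by
    have hGy : G y = (g ^ k) y + n := by rw [hG, mul_apply, rot_apply, map_add_int]
    have := hgr (k - 1) y
    rw [← hk1] at this
    rw [mul_apply, rot_apply, map_add_int]
    have hη' : 1 / (L : ℝ) < η := by
      rw [div_lt_iff₀ hL0]; rw [div_lt_iff₀ hη] at hL; linarith
    linarith [show (G ^ i) 0 = y from rfl]
  have h4 : 0 ≤ ((rot η * g) ^ k * rot n).transl := by
    by_contra! hcon
    have := lt_of_transl_lt _ (n := 0) (by simpa using hcon) y
    simp only [Int.cast_zero, add_zero] at this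
    exact lt_asymm h3 this
  rw [transl_mul_rot_int, transl_pow] at h4
  have hk' : (0 : ℝ) < k := by exact_mod_cast hk
  by_contra! hcon
  nlinarith

theorem SLift.transl_rot_neg_mul_lt (g : SLift) (hg : Irrational g.transl) {η : ℝ} (hη : 0 < η) :
    (rot (-η) * g).transl < g.transl := by
  have h := (g⁻¹).lt_transl_rot_mul (by rw [transl_inv]; exact hg.neg) hη
  have e : (rot (-η) * g)⁻¹ = rot (-η) * (rot η * g⁻¹) * (rot (-η))⁻¹ := by
    rw [mul_inv_rev, ← mul_assoc, rot_mul, rot_inv, neg_neg, neg_add_cancel, rot_zero, one_mul]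
  rw [← neg_lt_neg_iff, ← transl_inv, ← transl_inv, e, transl_conj]
  exact h

theorem SLift.exists_rot_mul_periodic (g : SLift) (hg : Irrational g.transl) {η : ℝ} (hη : 0 < η) :
    ∃ δ, 0 < δ ∧ ∀ (p : ℤ) (q : ℕ), 0 < q → |g.transl - p / q| < δ →
      ∃ t, |t| ≤ η ∧ ((rot t * g) ^ q) 0 = p := by
  have h1 := g.lt_transl_rot_mul hg hη
  have h2 := g.transl_rot_neg_mul_lt hg hη
  refine ⟨_, lt_min (sub_pos.2 h1) (sub_pos.2 h2), fun p q hq h => ?_⟩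
  have hq' : (0 : ℝ) < q := by exact_mod_cast hq
  obtain ⟨h3, h4⟩ := abs_lt.1 (h.trans_le (min_le_left _ _))
  obtain ⟨h5, h6⟩ := abs_lt.1 (h.trans_le (min_le_right _ _))
  have hc : ∀ n : ℕ, Continuous fun t => ((rot t * g) ^ n) 0 := fun n => by
    induction n with
    | zero => simpa [one_apply] using continuous_const
    | succ n ih =>
      simp only [pow_succ', mul_apply, rot_apply]
      exact (g.continuous.comp ih).add continuous_id
  have hl : ((rot (-η) * g) ^ q) 0 ≤ p := by
    have := lt_of_transl_lt ((rot (-η) * g) ^ q) (n := p) (by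
      rw [transl_pow, ← lt_div_iff₀' hq']; linarith) 0
    linarith
  have hu : p ≤ ((rot η * g) ^ q) 0 := by
    have := lt_of_lt_transl ((rot η * g) ^ q) (n := p) (by
      rw [transl_pow, ← div_lt_iff₀' hq']; linarith) 0
    linarith
  obtain ⟨t, ht, h⟩ := intermediate_value_Icc (by linarith) (hc q).continuousOn ⟨hl, hu⟩
  exact ⟨t, abs_le.2 ht, h⟩

theorem exists_coprime_near {α : ℝ} (hα : Liouville α) (n Q : ℕ) :
    ∃ (p : ℤ) (q : ℕ), Q ≤ q ∧ 0 < q ∧ IsCoprime p (q : ℤ) ∧ |α - p / q| < 1 / (q : ℝ) ^ n := by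
  obtain ⟨ε, hε, hε0⟩ := ((hα.irrational.eventually_forall_le_dist_cast_rat_of_den_le Q).filter_mono
    nhdsWithin_le_nhds |>.and (eventually_mem_nhdsWithin (s := Set.Ioi (0 : ℝ)))).exists
  have hε0 : 0 < ε := hε0
  obtain ⟨N, hN⟩ := exists_nat_gt (1 / ε)
  obtain ⟨b, hb, a, -, h⟩ := (frequently_atTop.1 (hα.frequently_exists_num (n + 1))) (N + 1)
  have hb0 : (0 : ℝ) < b := by exact_mod_cast (show 0 < b by omega)
  have hb1 : (1 : ℝ) ≤ b := by exact_mod_cast (show 1 ≤ b by omega)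
  have hden : ((a / b : ℚ).den : ℝ) ≤ b := by
    have : (a / b : ℚ).den ∣ b := by
      have := Rat.den_dvd a b
      exact_mod_cast this
    exact_mod_cast Nat.le_of_dvd (by omega) this
  have hd0 : (0 : ℝ) < (a / b : ℚ).den := by exact_mod_cast (a / b : ℚ).den_pos
  have hcast : (a : ℝ) / b = ((a / b : ℚ).num : ℝ) / (a / b : ℚ).den := by
    rw [← Rat.cast_def]; push_cast; rfl
  refine ⟨(a / b : ℚ).num, (a / b : ℚ).den, ?_, (a / b : ℚ).den_pos,
    Int.isCoprime_iff_gcd_eq_one.2 (a / b : ℚ).reduced, ?_⟩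
  · by_contra! hcon
    have := hε (a / b) hcon.le
    rw [Real.dist_eq] at this
    push_cast at this
    have h2 : 1 / (b : ℝ) ^ (n + 1) ≤ 1 / b := by
      gcongr; exact le_self_pow₀ hb1 (by omega)
    have h3 : 1 / (b : ℝ) < ε := by
      rw [div_lt_iff₀ hb0]; rw [div_lt_iff₀ hε0] at hN
      have : (N + 1 : ℝ) ≤ b := by exact_mod_cast hb
      nlinarith
    linarith
  · rw [← hcast]
    refine h.trans_le ?_
    calc 1 / (b : ℝ) ^ (n + 1) ≤ 1 / (b : ℝ) ^ n := 
          one_div_le_one_div_of_le (by positivity) (pow_le_pow_right₀ hb1 (by omega))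
      _ ≤ _ := by gcongr

/-- The logarithm of the derivative. -/
def SLift.dlog (f : SLift) (x : ℝ) : ℝ := Real.log (deriv f x)

theorem SLift.smooth_dlog (f : SLift) : ContDiff ℝ ∞ f.dlog :=
  f.dsmooth.log fun x => (f.dpos x).ne'

theorem SLift.dlog_periodic (f : SLift) : Function.Periodic f.dlog 1 := fun x =>
  congrArg Real.log (f.dperiodic x)

theorem SLift.exp_dlog (f : SLift) (x : ℝ) : Real.exp (f.dlog x) = deriv f x :=
  Real.exp_log (f.dpos x)

theorem SLift.dlog_pow (f : SLift) (n : ℕ) (x : ℝ) :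
    (f ^ n).dlog x = ∑ i ∈ Finset.range n, f.dlog ((f ^ i) x) := by
  induction n with
  | zero => simp [dlog, show deriv (1 : SLift) x = 1 from by
      change deriv (fun y : ℝ => y) x = 1; simp]
  | succ n ih =>
    rw [Finset.sum_range_succ, ← ih, pow_succ', dlog, deriv_mul,
      Real.log_mul (dpos _ _).ne' (dpos _ _).ne', add_comm]
    rfl

/-- The length of the `j`-th gap. -/
def gap (X : ℤ → ℝ) (j : ℤ) : ℝ := X (j + 1) - X j

theorem sum_gap (X : ℤ → ℝ) (j : ℤ) (n : ℕ) :
    ∑ c ∈ Finset.range n, gap X (j + c) = X (j + n) - X j := by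
  induction n with
  | zero => simp
  | succ n ih =>
    rw [Finset.sum_range_succ, ih, gap]
    push_cast
    rw [← add_assoc]; ring

theorem eq_of_modEq {q : ℕ} {a b : ℤ} (hab : |b - a| < q) (h : a ≡ b [ZMOD q]) : a = b := by
  have := Int.eq_zero_of_abs_lt_dvd h.dvd hab
  omega

namespace GapData

variable {f : SLift} {p : ℤ} {q : ℕ} {X : ℤ → ℝ}

theorem gap_pos (h : GapData f p q X) (j : ℤ) : 0 < gap X j := sub_pos.2 (h.mono (by omega))

theorem period_int (h : GapData f p q X) (j k : ℤ) : X (j + k * q) = X j + k := by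
  induction k with
  | zero => simp
  | succ i ih => rw [add_mul, ← add_assoc, one_mul, h.period, ih]; push_cast; ring
  | pred i ih =>
    have := h.period (j + (-i - 1) * q)
    rw [show j + (-(i : ℤ) - 1) * q + q = j + -i * q by ring, ih] at this
    push_cast at *; linarith

theorem gap_add_mul (h : GapData f p q X) (j k : ℤ) : gap X (j + k * q) = gap X j := by
  rw [gap, gap, add_right_comm, h.period_int, h.period_int]; ring

theorem gap_congr (h : GapData f p q X) {j k : ℤ} (hjk : j ≡ k [ZMOD q]) : gap X j = gap X k := by
  obtain ⟨c, hc⟩ := hjk.dvd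
  rw [show k = j + c * q by linarith, h.gap_add_mul]

theorem map_pow (h : GapData f p q X) (i : ℕ) (j : ℤ) : (f ^ i) (X j) = X (j + i * p) := by
  induction i with
  | zero => simp [SLift.one_apply]
  | succ i ih => rw [pow_succ', SLift.mul_apply, ih, h.map]; push_cast; ring_nf

theorem map_pow_inv (h : GapData f p q X) (i : ℕ) (j : ℤ) :
    ((f ^ i)⁻¹ : SLift) (X j) = X (j - i * p) := by
  rw [← (f ^ i).inv_apply_self (X (j - i * p)), h.map_pow, sub_add_cancel]

/-- Gaps with pairwise incongruent indices have total length at most one. -/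
theorem sum_gap_le (h : GapData f p q X) {ι : Type*} (s : Finset ι) (u : ι → ℤ)
    (hu : ∀ a ∈ s, ∀ b ∈ s, u a ≡ u b [ZMOD q] → a = b) : ∑ a ∈ s, gap X (u a) ≤ 1 := by
  classical
  have hq : (0 : ℤ) < q := by exact_mod_cast h.q_pos
  have hinj : Set.InjOn (fun a => (u a % q).toNat) s := fun a ha b hb hab => hu a ha b hb (by
    have h1 := Int.emod_nonneg (u a) hq.ne'
    have h2 := Int.emod_nonneg (u b) hq.ne'
    simp only at hab
    unfold Int.ModEq
    omega)
  have e : ∀ a, gap X (u a) = gap X (((u a % q).toNat : ℤ)) := fun a => by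
    rw [Int.toNat_of_nonneg (Int.emod_nonneg _ hq.ne')]
    exact h.gap_congr (Int.mod_modEq _ _).symm
  calc ∑ a ∈ s, gap X (u a) = ∑ r ∈ s.image (fun a => (u a % q).toNat), gap X (r : ℤ) := by
        rw [Finset.sum_image hinj]
        exact Finset.sum_congr rfl fun a _ => e a
    _ ≤ ∑ r ∈ Finset.range q, gap X (r : ℤ) := by
        refine Finset.sum_le_sum_of_subset_of_nonneg ?_ fun _ _ _ => (h.gap_pos _).le
        intro r hr
        obtain ⟨a, -, rfl⟩ := Finset.mem_image.1 hr
        rw [Finset.mem_range]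
        have h1 := Int.emod_nonneg (u a) hq.ne'
        have h2 := Int.emod_lt_of_pos (u a) hq
        omega
    _ = 1 := by
        have := sum_gap X 0 q
        simp only [zero_add] at this
        rw [this]
        have := h.period 0
        rw [zero_add] at this
        linarith

theorem coprime_dvd (h : GapData f p q X) {a b : ℤ} (hab : a * p ≡ b * p [ZMOD q]) :
    a ≡ b [ZMOD q] := by
  have h1 := hab.dvd
  rw [← sub_mul] at h1
  exact Int.modEq_iff_dvd.2 (h.coprime.symm.dvd_of_dvd_mul_right h1)

theorem abs_dlog_sub_le (h : GapData f p q X) {K : ℝ} (hK : ∀ x, |deriv f.dlog x| ≤ K)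
    (n κ : ℕ) (j : ℤ) {x y : ℝ} (hx : x ∈ Set.Icc (X j) (X (j + κ)))
    (hy : y ∈ Set.Icc (X j) (X (j + κ))) : |(f ^ n).dlog x - (f ^ n).dlog y| ≤
      K * ∑ i ∈ Finset.range n, ∑ c ∈ Finset.range κ, gap X (j + i * p + c) := by
  have hK0 : 0 ≤ K := (abs_nonneg _).trans (hK 0)
  rw [SLift.dlog_pow, SLift.dlog_pow, ← Finset.sum_sub_distrib, Finset.mul_sum]
  refine (Finset.abs_sum_le_sum_abs _ _).trans (Finset.sum_le_sum fun i _ => ?_)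
  refine (abs_sub_le_of_deriv (smooth_diff f.smooth_dlog) fun z _ => hK z).trans ?_
  refine mul_le_mul_of_nonneg_left ?_ hK0
  have hm := (f ^ i).strictMono.monotone
  have e1 := h.map_pow i j
  have e2 := h.map_pow i (j + κ)
  have h1 := hm hx.1
  have h2 := hm hx.2
  have h3 := hm hy.1
  have h4 := hm hy.2
  rw [sum_gap, show j + i * p + κ = j + κ + i * p by ring, ← e1, ← e2, abs_le]
  constructor <;> linarith

theorem sum_window (h : GapData f p q X) (j : ℤ) (a : ℕ) {n : ℕ} (hn : n ≤ q) :
    ∑ i ∈ Finset.range n, gap X (j + (a + i : ℕ) * p) ≤ 1 := by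
  refine h.sum_gap_le _ _ fun x hx y hy hxy => ?_
  rw [Finset.mem_range] at hx hy
  have := eq_of_modEq (by rw [abs_lt]; constructor <;> push_cast <;> omega)
    (h.coprime_dvd (Int.ModEq.add_left_cancel' _ hxy))
  omega

theorem sum_orbit (h : GapData f p q X) (j : ℤ) {n : ℕ} (hn : n ≤ 2 * q) :
    ∑ i ∈ Finset.range n, gap X (j + i * p) ≤ 2 := by
  have h0 : ∀ i : ℕ, 0 ≤ gap X (j + i * p) := fun i => (h.gap_pos _).le
  calc ∑ i ∈ Finset.range n, gap X (j + i * p)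
      ≤ ∑ i ∈ Finset.range (q + q), gap X (j + i * p) :=
        Finset.sum_le_sum_of_subset_of_nonneg (Finset.range_mono (by omega)) fun i _ _ => h0 i
    _ ≤ 1 + 1 := by
        rw [Finset.sum_range_add]
        have h1 := h.sum_window j 0 le_rfl
        simp only [zero_add] at h1
        exact add_le_add h1 (h.sum_window j q le_rfl)
    _ = 2 := by norm_num

/-- Bounded distortion along at most two periods. -/
theorem distortion (h : GapData f p q X) {K : ℝ} (hK : ∀ x, |deriv f.dlog x| ≤ K)
    {n : ℕ} (hn : n ≤ 2 * q) (κ : ℕ) (j : ℤ) {x y : ℝ} (hx : x ∈ Set.Icc (X j) (X (j + κ)))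
    (hy : y ∈ Set.Icc (X j) (X (j + κ))) : |(f ^ n).dlog x - (f ^ n).dlog y| ≤ 2 * κ * K := by
  have hK0 : 0 ≤ K := (abs_nonneg _).trans (hK 0)
  refine (h.abs_dlog_sub_le hK n κ j hx hy).trans ?_
  rw [Finset.sum_comm]
  have : ∑ c ∈ Finset.range κ, ∑ i ∈ Finset.range n, gap X (j + i * p + c) ≤
      ∑ c ∈ Finset.range κ, (2 : ℝ) := Finset.sum_le_sum fun c _ => by
    have := h.sum_orbit (j + c) hn
    simpa only [add_right_comm] using this
  rw [Finset.sum_const, Finset.card_range, nsmul_eq_mul] at this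
  nlinarith

theorem denjoy (h : GapData f p q X) {K : ℝ} (hK : ∀ x, |deriv f.dlog x| ≤ K) {s : ℕ} {p' : ℤ}
    (hs : 0 < s) (hc : IsCoprime p' (s : ℤ)) (hd : |s * p - p' * q| * (2 * s) < q) (j : ℤ) {x : ℝ}
    (hx : x ∈ Set.Icc (X j) (X (j + 1))) :
    Real.exp (-K) ≤ deriv (f ^ s : SLift) x * deriv ((f ^ s)⁻¹ : SLift) x := by
  have hK0 : 0 ≤ K := (abs_nonneg _).trans (hK 0)
  set d := s * p - p' * q with hdd
  have hq : (0 : ℤ) < q := by exact_mod_cast h.q_pos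
  have hs' : (0 : ℤ) < s := by exact_mod_cast hs
  set y := ((f ^ s)⁻¹ : SLift) x + p' with hy
  have hy1 : y ∈ Set.Icc (X (j - d)) (X (j - d + 1)) := by
    have e : ∀ k : ℤ, ((f ^ s)⁻¹ : SLift) (X k) + p' = X (k - d) := fun k => by
      rw [h.map_pow_inv, ← h.period_int, hdd]; ring_nf
    rw [show j - d + 1 = j + 1 - d by ring, ← e, ← e]
    have hm := ((f ^ s)⁻¹ : SLift).strictMono.monotone
    exact ⟨add_le_add_left (hm hx.1) _, add_le_add_left (hm hx.2) _⟩
  obtain ⟨j0, D, hj0⟩ : ∃ (j0 : ℤ) (D : ℕ), (D : ℤ) = |d| ∧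
      x ∈ Set.Icc (X j0) (X (j0 + (D + 1 : ℕ))) ∧ y ∈ Set.Icc (X j0) (X (j0 + (D + 1 : ℕ))) := by
    have hm := h.mono.monotone
    refine ⟨min j (j - d), d.natAbs, by simp, ⟨(hm (min_le_left _ _)).trans hx.1,
      hx.2.trans (hm ?_)⟩, ⟨(hm (min_le_right _ _)).trans hy1.1, hy1.2.trans (hm ?_)⟩⟩ <;>
    · push_cast
      rcases abs_cases d with h | h <;> omega
  obtain ⟨hD, hx0, hy0⟩ := hj0
  have key := h.abs_dlog_sub_le hK s (D + 1) j0 hx0 hy0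
  have hsum : ∑ i ∈ Finset.range s, ∑ c ∈ Finset.range (D + 1), gap X (j0 + i * p + c) ≤ 1 := by
    rw [← Finset.sum_product']
    refine h.sum_gap_le _ _ ?_
    rintro ⟨i, c⟩ hic ⟨i', c'⟩ hic' hmod
    simp only [Finset.mem_product, Finset.mem_range] at hic hic'
    obtain ⟨l, hl⟩ := hmod.dvd
    simp only at hl
    have h1 : s * ((c' : ℤ) - c) + (i' - i) * d = q * (s * l - (i' - i) * p') := by
      rw [hdd]; linear_combination (s : ℤ) * hl
    have h2 : |(s : ℤ) * ((c' : ℤ) - c) + (i' - i) * d| < q := by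
      have a1 : |(s : ℤ) * ((c' : ℤ) - c)| ≤ s * |d| := by
        rw [abs_mul, abs_of_pos hs']
        refine mul_le_mul_of_nonneg_left ?_ hs'.le
        rw [← hD, abs_le]; omega
      have a2 : |((i' : ℤ) - i) * d| ≤ s * |d| := by
        rw [abs_mul]
        refine mul_le_mul_of_nonneg_right ?_ (abs_nonneg _)
        rw [abs_le]; omega
      have := abs_add_le ((s : ℤ) * ((c' : ℤ) - c)) ((i' - i) * d)
      linarith
    have h3 := Int.eq_zero_of_abs_lt_dvd (Dvd.intro _ h1.symm) h2
    rw [h3] at h1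
    have h4 : (s : ℤ) * l - (i' - i) * p' = 0 := by
      rcases mul_eq_zero.1 h1.symm with h | h
      · omega
      · exact h
    have h5 : (s : ℤ) ∣ (i' - i) := hc.symm.dvd_of_dvd_mul_right ⟨l, by linarith⟩
    have h6 := Int.eq_zero_of_abs_lt_dvd h5 (by rw [abs_lt]; omega)
    rw [h6, zero_mul, add_zero] at h3
    have h7 : (c' : ℤ) - c = 0 := by
      rcases mul_eq_zero.1 h3 with h | h
      · omega
      · exact h
    rw [Prod.mk.injEq]
    omega
  have key2 : (f ^ s).dlog y - (f ^ s).dlog x ≤ K := by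
    have := (abs_le.1 key).1
    nlinarith
  have e1 : deriv ((f ^ s)⁻¹ : SLift) x = Real.exp (-(f ^ s).dlog y) := by
    rw [Real.exp_neg, SLift.exp_dlog, hy, SLift.deriv_add_int, SLift.deriv_inv]
  rw [e1, ← SLift.exp_dlog, ← Real.exp_add, Real.exp_le_exp]
  linarith

theorem two_exp_mul_gap_le (h : GapData f p q X) {K : ℝ} (hK : ∀ x, |deriv f.dlog x| ≤ K) {s : ℕ}
    {p' : ℤ} (hs : 0 < s) (hc : IsCoprime p' (s : ℤ)) (hd : |s * p - p' * q| * (2 * s) < q)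
    (j : ℤ) : Real.exp (-K) * gap X j ≤ gap X (j + s * p) + gap X (j - s * p) := by
  have hK0 : 0 ≤ K := (abs_nonneg _).trans (hK 0)
  have hu : ContDiff ℝ ∞ fun x => (f ^ s) x + ((f ^ s)⁻¹ : SLift) x :=
    (f ^ s).smooth.add ((f ^ s)⁻¹ : SLift).smooth
  have hlt := (h.gap_pos j).le
  have key := (convex_Icc (X j) (X (j + 1))).mul_sub_le_image_sub_of_le_deriv
    (C := Real.exp (-K)) hu.continuous.continuousOn (smooth_diff hu).differentiableOn
    (fun z hz => by
      have h1 := h.denjoy hK hs hc hd j (interior_subset hz)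
      have h2 := (f ^ s).dpos z
      have h3 := ((f ^ s)⁻¹ : SLift).dpos z
      rw [(((f ^ s).hasDeriv z).fun_add (((f ^ s)⁻¹ : SLift).hasDeriv z)).deriv]
      have h4 : Real.exp (-K) ≤ 1 := Real.exp_le_one_iff.2 (by linarith)
      have h5 := Real.exp_pos (-K)
      nlinarith [sq_nonneg (deriv (f ^ s : SLift) z - deriv ((f ^ s)⁻¹ : SLift) z)])
    (X j) (Set.left_mem_Icc.2 (sub_nonneg.1 hlt)) (X (j + 1))
    (Set.right_mem_Icc.2 (sub_nonneg.1 hlt)) (sub_nonneg.1 hlt)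
  simp only [h.map_pow, h.map_pow_inv] at key
  rw [gap, gap, gap, show j + s * p + 1 = j + 1 + s * p by ring,
    show j - s * p + 1 = j + 1 - s * p by ring]
  linarith

/-- On a gap, the derivative of an iterate is comparable to the ratio of lengths. -/
theorem deriv_pow_bounds (h : GapData f p q X) {K : ℝ} (hK : ∀ x, |deriv f.dlog x| ≤ K)
    {n : ℕ} (hn : n ≤ 2 * q) (κ : ℕ) (j : ℤ) {x : ℝ} (hx : x ∈ Set.Icc (X j) (X (j + κ)))
    {a b : ℝ} (ha : X j ≤ a) (hab : a ≤ b) (hb : b ≤ X (j + κ)) :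
    (f ^ n) b - (f ^ n) a ≤ Real.exp (2 * κ * K) * deriv (f ^ n : SLift) x * (b - a) ∧
    Real.exp (-(2 * κ * K)) * deriv (f ^ n : SLift) x * (b - a) ≤ (f ^ n) b - (f ^ n) a := by
  constructor
  · refine (f ^ n).sub_le_of_deriv_le hab fun z hz => ?_
    have := (abs_le.1 (h.distortion hK hn κ j ⟨ha.trans hz.1, hz.2.trans hb⟩ hx)).2
    rw [← SLift.exp_dlog, ← SLift.exp_dlog, ← Real.exp_add, Real.exp_le_exp]
    linarith
  · refine (f ^ n).le_sub_of_le_deriv hab fun z hz => ?_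
    have := (abs_le.1 (h.distortion hK hn κ j ⟨ha.trans hz.1, hz.2.trans hb⟩ hx)).1
    rw [← SLift.exp_dlog, ← SLift.exp_dlog, ← Real.exp_add, Real.exp_le_exp]
    linarith

theorem gap_map_pow (h : GapData f p q X) (n : ℕ) (j : ℤ) :
    (f ^ n) (X (j + 1)) - (f ^ n) (X j) = gap X (j + n * p) := by
  rw [h.map_pow, h.map_pow, gap, add_right_comm]

theorem exists_modEq (h : GapData f p q X) (j k : ℤ) :
    ∃ n : ℕ, n < q ∧ j + n * p ≡ k [ZMOD q] := by
  obtain ⟨a, b, hab⟩ := h.coprime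
  have hq : (0 : ℤ) < q := by exact_mod_cast h.q_pos
  refine ⟨((k - j) * a % q).toNat, ?_, ?_⟩
  · have h1 := Int.emod_nonneg ((k - j) * a) hq.ne'
    have h2 := Int.emod_lt_of_pos ((k - j) * a) hq
    omega
  · rw [Int.toNat_of_nonneg (Int.emod_nonneg _ hq.ne')]
    calc j + (k - j) * a % q * p ≡ j + (k - j) * a * p [ZMOD q] :=
          (((Int.mod_modEq _ _).mul_right _).add_left _)
      _ ≡ k [ZMOD q] := Int.modEq_iff_dvd.2 ⟨(k - j) * b, by linear_combination (j - k) * hab⟩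

theorem exists_max (h : GapData f p q X) : ∃ j, ∀ k, gap X k ≤ gap X j := by
  obtain ⟨i, -, hi⟩ := Finset.exists_max_image (Finset.range q) (fun i : ℕ => gap X i)
    ⟨0, Finset.mem_range.2 h.q_pos⟩
  refine ⟨i, fun k => ?_⟩
  obtain ⟨c, hc⟩ : ∃ c : ℕ, c < q ∧ (c : ℤ) ≡ k [ZMOD q] := by
    have hq : (0 : ℤ) < q := by exact_mod_cast h.q_pos
    refine ⟨(k % q).toNat, ?_, ?_⟩
    · have h1 := Int.emod_nonneg k hq.ne'
      have h2 := Int.emod_lt_of_pos k hq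
      omega
    · rw [Int.toNat_of_nonneg (Int.emod_nonneg _ hq.ne')]
      exact Int.mod_modEq _ _
  rw [← h.gap_congr hc.2]
  exact hi c (Finset.mem_range.2 hc.1)

theorem shift (h : GapData f p q X) (c : ℤ) : GapData f p q (fun j => X (j + c)) where
  q_pos := h.q_pos
  mono := fun a b hab => h.mono (by omega)
  period := fun j => by rw [add_right_comm, h.period]
  map := fun j => by rw [h.map, add_right_comm]
  coprime := h.coprime

end GapData

theorem exists_good_times {α : ℝ} (hα : Liouville α) (n : ℕ) : ∃ S : Finset ℕ, S.card = n ∧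
    ∃ δ, 0 < δ ∧ ∀ s ∈ S, 0 < s ∧ ∃ p' : ℤ, IsCoprime p' (s : ℤ) ∧
      ∀ x, |α - x| < δ → |s * x - p'| * (2 * s) < 1 := by
  induction n with
  | zero => exact ⟨∅, rfl, 1, one_pos, by simp⟩
  | succ n ih =>
    obtain ⟨S, hS, δ, hδ, h⟩ := ih
    obtain ⟨p', s, hs, hs0, hc, hlt⟩ := exists_coprime_near hα 3 (S.sup id + 2)
    have hs1 : (2 : ℝ) ≤ s := by exact_mod_cast (show 2 ≤ s by omega)
    have hlt' : |α - p' / s| < 1 / (2 * s ^ 2) := by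
      refine hlt.trans_le (one_div_le_one_div_of_le (by positivity) ?_)
      nlinarith [sq_nonneg (s : ℝ)]
    refine ⟨insert s S, ?_, min δ (1 / (2 * s ^ 2) - |α - p' / s|),
      lt_min hδ (sub_pos.2 hlt'), ?_⟩
    · rw [Finset.card_insert_of_notMem, hS]
      intro hmem
      have : s ≤ S.sup id := Finset.le_sup (f := id) hmem
      omega
    · intro s' hs'
      rcases Finset.mem_insert.1 hs' with rfl | hs'
      · refine ⟨hs0, p', hc, fun x hx => ?_⟩
        have h1 := hx.trans_le (min_le_right _ _)
        have h2 : |x - p' / s'| < 1 / (2 * s' ^ 2) := by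
          have := abs_sub_le x α (p' / s')
          rw [abs_sub_comm x α] at this
          linarith
        have h3 : (s' : ℝ) * x - p' = s' * (x - p' / s') := by field_simp
        rw [h3, abs_mul, Nat.abs_cast]
        rw [lt_div_iff₀ (by positivity)] at h2
        nlinarith
      · obtain ⟨h1, p'', h2, h3⟩ := h s' hs'
        exact ⟨h1, p'', h2, fun x hx => h3 x (hx.trans_le (min_le_left _ _))⟩

/-- The gaps of periodic orbits become uniformly small as the rotation number tends to `α`. -/
theorem exists_small_gaps {α : ℝ} (hα : Liouville α) (K : ℝ) {c : ℝ} (hc : 0 < c) :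
    ∃ δ, 0 < δ ∧ ∃ Q : ℕ, ∀ (f : SLift) (p : ℤ) (q : ℕ) (X : ℤ → ℝ), GapData f p q X →
      (∀ x, |deriv f.dlog x| ≤ K) → |α - p / q| < δ → Q ≤ q → ∀ j, gap X j < c := by
  obtain ⟨n, hn⟩ := exists_nat_gt (Real.exp K / c)
  obtain ⟨S, hS, δ, hδ, h⟩ := exists_good_times hα n
  refine ⟨δ, hδ, 2 * S.sup id + 1, fun f p q X hX hK hpq hq j => ?_⟩
  have hle : ∀ s ∈ S, s ≤ S.sup id := fun s hs => Finset.le_sup (f := id) hs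
  have hq0 : (0 : ℝ) < q := by exact_mod_cast hX.q_pos
  have h1 : ∀ s ∈ S, Real.exp (-K) * gap X j ≤ gap X (j + s * p) + gap X (j - s * p) := by
    intro s hs
    obtain ⟨hs0, p', hc, hx⟩ := h s hs
    refine hX.two_exp_mul_gap_le hK hs0 hc ?_ j
    have := hx _ hpq
    have e : (s : ℝ) * (p / q) - p' = (s * p - p' * q) / q := by field_simp
    rw [e, abs_div, abs_of_pos hq0, div_mul_eq_mul_div, div_lt_one hq0] at this
    exact_mod_cast this
  have h2 : ∑ s ∈ S, (gap X (j + s * p) + gap X (j - s * p)) ≤ 1 := by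
    have := hX.sum_gap_le (S ×ˢ (Finset.univ : Finset Bool))
      (fun a => j + (if a.2 then (a.1 : ℤ) else -(a.1 : ℤ)) * p) (by
        rintro ⟨s, b⟩ hs ⟨s', b'⟩ hs' hmod
        simp only [Finset.mem_product, Finset.mem_univ, and_true] at hs hs'
        have a1 := hle s hs
        have a2 := hle s' hs'
        have a3 := (h s hs).1
        have a4 := (h s' hs').1
        have := eq_of_modEq (by
          rw [abs_lt]
          constructor <;> simp only <;> split_ifs <;> omega)
          (hX.coprime_dvd (Int.ModEq.add_left_cancel' _ hmod))
        cases b <;> cases b' <;> simp at this ⊢ <;> omega)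
    rw [Finset.sum_product] at this
    refine le_of_eq_of_le (Finset.sum_congr rfl fun s _ => ?_) this
    simp [sub_eq_add_neg]
  have h3 : n * (Real.exp (-K) * gap X j) ≤ 1 := by
    rw [← hS, ← nsmul_eq_mul, ← Finset.sum_const]
    exact (Finset.sum_le_sum h1).trans h2
  have h4 := hX.gap_pos j
  rw [div_lt_iff₀ hc] at hn
  rw [Real.exp_neg] at h3
  have h5 := Real.exp_pos K
  by_contra! hcon
  have h6 : (n : ℝ) * gap X j ≤ Real.exp K := by
    have : (n : ℝ) * ((Real.exp K)⁻¹ * gap X j) = n * gap X j / Real.exp K := by field_simp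
    rw [this, div_le_one h5] at h3
    exact h3
  have : (n : ℝ) * c ≤ n * gap X j := by gcongr
  linarith

/-- The Schwarzian derivative. -/
def SLift.schwarz (f : SLift) (x : ℝ) : ℝ :=
  deriv (deriv f.dlog) x - 1 / 2 * deriv f.dlog x ^ 2

theorem SLift.smooth_schwarz (f : SLift) : ContDiff ℝ ∞ f.schwarz :=
  (smooth_deriv (smooth_deriv f.smooth_dlog)).sub
    (contDiff_const.mul ((smooth_deriv f.smooth_dlog).pow 2))

theorem SLift.deriv_deriv (f : SLift) (x : ℝ) :
    deriv (deriv f) x = deriv f.dlog x * deriv f x := by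
  have h := (smooth_hasDeriv f.smooth_dlog x).exp
  simp only [exp_dlog] at h
  exact h.deriv.trans (mul_comm _ _)

theorem SLift.dlog_mul (f g : SLift) : (f * g).dlog = fun x => f.dlog (g x) + g.dlog x := by
  funext x
  rw [dlog, deriv_mul, Real.log_mul (dpos _ _).ne' (dpos _ _).ne']
  rfl

theorem SLift.deriv_dlog_mul (f g : SLift) :
    deriv (f * g).dlog = fun x => deriv f.dlog (g x) * deriv g x + deriv g.dlog x := by
  funext x
  rw [dlog_mul]
  exact (((smooth_hasDeriv f.smooth_dlog (g x)).comp x (g.hasDeriv x)).fun_add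
    (smooth_hasDeriv g.smooth_dlog x)).deriv

theorem SLift.schwarz_mul (f g : SLift) (x : ℝ) :
    (f * g).schwarz x = f.schwarz (g x) * deriv g x ^ 2 + g.schwarz x := by
  have h : deriv (deriv (f * g).dlog) x = deriv (deriv f.dlog) (g x) * deriv g x * deriv g x +
      deriv f.dlog (g x) * (deriv g.dlog x * deriv g x) + deriv (deriv g.dlog) x := by
    rw [deriv_dlog_mul, ← deriv_deriv]
    exact ((((smooth_hasDeriv (smooth_deriv f.smooth_dlog) (g x)).comp x (g.hasDeriv x)).fun_mul
      (smooth_hasDeriv g.dsmooth x)).fun_add (smooth_hasDeriv (smooth_deriv g.smooth_dlog) x)).deriv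
  rw [schwarz, h, deriv_dlog_mul, schwarz, schwarz]
  ring

theorem SLift.schwarz_one : (1 : SLift).schwarz = fun _ => 0 := by
  have h : (1 : SLift).dlog = fun _ => 0 := by
    funext x
    rw [dlog, show deriv (1 : SLift) x = 1 from congrFun deriv_id_eq x, Real.log_one]
  funext x
  simp [schwarz, h]

theorem SLift.schwarz_pow (f : SLift) (n : ℕ) :
    (f ^ n).schwarz = fun x => ∑ i ∈ Finset.range n, f.schwarz ((f ^ i) x) *
      deriv (f ^ i : SLift) x ^ 2 := by
  funext x
  induction n with
  | zero => simp [schwarz_one]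
  | succ n ih => rw [Finset.sum_range_succ, ← ih, pow_succ', schwarz_mul, add_comm]

theorem SLift.deriv_dlog_periodic (f : SLift) : Function.Periodic (deriv f.dlog) 1 := fun x => by
  have := periodic_iteratedDeriv f.dlog_periodic 1 x
  rwa [iteratedDeriv_one] at this

/-- At the maximum of `|(log Df)'|`, the Schwarzian derivative controls `(log Df)'`. -/
theorem SLift.deriv_dlog_sq_le (f : SLift) {A : ℝ} (hA : ∀ x, |f.schwarz x| ≤ A) (x : ℝ) :
    deriv f.dlog x ^ 2 ≤ 2 * A := by
  have hs := smooth_deriv f.smooth_dlog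
  have hc : Continuous fun x => deriv f.dlog x ^ 2 := hs.continuous.pow 2
  obtain ⟨y, -, hy⟩ := (isCompact_Icc (a := (0 : ℝ)) (b := 1)).exists_isMaxOn
    ⟨0, by simp⟩ hc.continuousOn
  have hmax : ∀ z, deriv f.dlog z ^ 2 ≤ deriv f.dlog y ^ 2 := fun z => by
    have h1 : deriv f.dlog (Int.fract z) = deriv f.dlog z := by
      have := f.deriv_dlog_periodic.sub_zsmul_eq (x := z) ⌊z⌋
      rwa [zsmul_one] at this
    rw [← h1]
    exact hy ⟨Int.fract_nonneg z, (Int.fract_lt_one z).le⟩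
  have h0 : deriv (fun x => deriv f.dlog x ^ 2) y = 0 :=
    IsLocalMax.deriv_eq_zero (Eventually.of_forall hmax)
  have h1 := ((smooth_hasDeriv hs y).fun_pow 2).deriv
  rw [h0] at h1
  refine (hmax x).trans ?_
  have hA0 : 0 ≤ A := (abs_nonneg _).trans (hA 0)
  have h2 := (abs_le.1 (hA y)).1
  rw [schwarz] at h2
  rcases mul_eq_zero.1 h1.symm with h | h
  · have : deriv f.dlog y = 0 := by simpa using h
    rw [this]; nlinarith
  · rw [h] at h2
    linarith

namespace GapData

variable {f : SLift} {p : ℤ} {q : ℕ} {X : ℤ → ℝ}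

theorem gap_ratio (h : GapData f p q X) {K : ℝ} (hK : ∀ x, |deriv f.dlog x| ≤ K) (j : ℤ) :
    gap X (j + 1) ≤ Real.exp (8 * K) * gap X j ∧ gap X j ≤ Real.exp (8 * K) * gap X (j + 1) := by
  have key : ∀ (n : ℕ), n < q → ∃ D, 0 < D ∧
      (Real.exp (-(4 * K)) * D * gap X (j + 1) ≤ gap X (j + n * p + 1) ∧
      gap X (j + n * p + 1) ≤ Real.exp (4 * K) * D * gap X (j + 1)) ∧
      (Real.exp (-(4 * K)) * D * gap X j ≤ gap X (j + n * p) ∧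
      gap X (j + n * p) ≤ Real.exp (4 * K) * D * gap X j) := by
    intro n hn
    have hm := h.mono.monotone
    have h1 : X j ≤ X (j + 1) := hm (by omega)
    have h2 : X (j + 1) ≤ X (j + (2 : ℕ)) := hm (by push_cast; omega)
    have a1 := h.deriv_pow_bounds hK (n := n) (by omega) 2 j (x := X j) ⟨le_rfl, h1.trans h2⟩
      h1 h2 le_rfl
    have a2 := h.deriv_pow_bounds hK (n := n) (by omega) 2 j (x := X j) ⟨le_rfl, h1.trans h2⟩
      le_rfl h1 h2
    have e1 : (f ^ n) (X (j + (2 : ℕ))) - (f ^ n) (X (j + 1)) = gap X (j + n * p + 1) := by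
      have := h.gap_map_pow n (j + 1)
      rw [show j + n * p + 1 = j + 1 + n * p by ring, ← this]
      push_cast
      rw [add_assoc, one_add_one_eq_two]
    have e2 : X (j + (2 : ℕ)) - X (j + 1) = gap X (j + 1) := by
      rw [gap]; push_cast; rw [add_assoc, one_add_one_eq_two]
    rw [e1, e2] at a1
    rw [h.gap_map_pow, show X (j + 1) - X j = gap X j from rfl] at a2
    rw [show (2 : ℝ) * (2 : ℕ) * K = 4 * K by push_cast; ring] at a1 a2
    exact ⟨_, (f ^ n).dpos _, a1.symm, a2.symm⟩
  have hex : Real.exp (8 * K) = Real.exp (4 * K) * Real.exp (4 * K) := by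
    rw [← Real.exp_add]; ring_nf
  have hinv : Real.exp (4 * K) * Real.exp (-(4 * K)) = 1 := by
    rw [← Real.exp_add]; simp
  have hE := Real.exp_pos (4 * K)
  have hE' := Real.exp_pos (-(4 * K))
  have p1 := h.gap_pos j
  have p2 := h.gap_pos (j + 1)
  have concl : ∀ {D a b a' b' : ℝ}, 0 < D → Real.exp (-(4 * K)) * D * a ≤ a' → a' ≤ b' →
      b' ≤ Real.exp (4 * K) * D * b → a ≤ Real.exp (8 * K) * b := by
    intro D a b a' b' hD h1 h2 h3
    have h4 : Real.exp (-(4 * K)) * D * a ≤ Real.exp (4 * K) * D * b := h1.trans (h2.trans h3)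
    have h5 := mul_le_mul_of_nonneg_left h4 (show 0 ≤ Real.exp (4 * K) / D by positivity)
    rw [hex]
    have e1 : Real.exp (4 * K) / D * (Real.exp (-(4 * K)) * D * a) = a := by
      have : Real.exp (4 * K) / D * (Real.exp (-(4 * K)) * D * a) =
        (Real.exp (4 * K) * Real.exp (-(4 * K))) * a := by field_simp
      rw [this, hinv, one_mul]
    have e2 : Real.exp (4 * K) / D * (Real.exp (4 * K) * D * b) =
        Real.exp (4 * K) * Real.exp (4 * K) * b := by field_simp
    rwa [e1, e2] at h5
  constructor
  · obtain ⟨u, hu⟩ : ∃ u, gap X (u + 1) ≤ gap X u := by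
      obtain ⟨u, hu⟩ := h.exists_max
      exact ⟨u, hu _⟩
    obtain ⟨n, hn, hmod⟩ := h.exists_modEq j u
    obtain ⟨D, hD, a1, a2⟩ := key n hn
    refine concl hD a1.1 ?_ a2.2
    rw [h.gap_congr hmod, h.gap_congr (hmod.add_right 1)]
    exact hu
  · obtain ⟨u, hu⟩ : ∃ u, gap X u ≤ gap X (u + 1) := by
      obtain ⟨u, hu⟩ := h.exists_max
      exact ⟨u - 1, by rw [sub_add_cancel]; exact hu _⟩
    obtain ⟨n, hn, hmod⟩ := h.exists_modEq j u
    obtain ⟨D, hD, a1, a2⟩ := key n hn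
    refine concl hD a2.1 ?_ a1.2
    rw [h.gap_congr hmod, h.gap_congr (hmod.add_right 1)]
    exact hu

theorem deriv_pow_le (h : GapData f p q X) {K : ℝ} (hK : ∀ x, |deriv f.dlog x| ≤ K)
    {n : ℕ} (hn : n ≤ 2 * q) (j : ℤ) {x : ℝ} (hx : x ∈ Set.Icc (X j) (X (j + 1))) :
    deriv (f ^ n : SLift) x * gap X j ≤ Real.exp (2 * K) * gap X (j + n * p) ∧
    gap X (j + n * p) ≤ Real.exp (2 * K) * (deriv (f ^ n : SLift) x * gap X j) := by
  have h1 : X j ≤ X (j + 1) := h.mono.monotone (by omega)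
  have a := h.deriv_pow_bounds hK hn 1 j (x := x) (by exact_mod_cast hx) le_rfl h1 (by simp)
  rw [h.gap_map_pow, show X (j + 1) - X j = gap X j from rfl,
    show (2 : ℝ) * (1 : ℕ) * K = 2 * K by push_cast; ring] at a
  refine ⟨?_, by linarith [a.1]⟩
  have := mul_le_mul_of_nonneg_left a.2 (Real.exp_pos (2 * K)).le
  have hinv : Real.exp (2 * K) * Real.exp (-(2 * K)) = 1 := by
    rw [← Real.exp_add]; simp
  calc _ = Real.exp (2 * K) * Real.exp (-(2 * K)) * (deriv (f ^ n : SLift) x * gap X j) := by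
        rw [hinv, one_mul]
    _ ≤ _ := by linarith

theorem sum_deriv_sq_le (h : GapData f p q X) {K M : ℝ} (hK : ∀ x, |deriv f.dlog x| ≤ K)
    (hM : ∀ j, gap X j ≤ M) {n : ℕ} (hn : n ≤ 2 * q) (j : ℤ) {x : ℝ}
    (hx : x ∈ Set.Icc (X j) (X (j + 1))) :
    (∑ i ∈ Finset.range n, deriv (f ^ i : SLift) x ^ 2) * gap X j ^ 2 ≤
      2 * Real.exp (4 * K) * M := by
  have hj := h.gap_pos j
  have hM0 : 0 ≤ M := hj.le.trans (hM j)
  calc (∑ i ∈ Finset.range n, deriv (f ^ i : SLift) x ^ 2) * gap X j ^ 2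
      ≤ ∑ i ∈ Finset.range n, Real.exp (4 * K) * (M * gap X (j + i * p)) := by
        rw [Finset.sum_mul]
        refine Finset.sum_le_sum fun i hi => ?_
        rw [Finset.mem_range] at hi
        have h1 := (h.deriv_pow_le hK (n := i) (by omega) j hx).1
        have h2 := (f ^ i).dpos x
        have h3 := h.gap_pos (j + i * p)
        calc deriv (f ^ i : SLift) x ^ 2 * gap X j ^ 2
            = (deriv (f ^ i : SLift) x * gap X j) ^ 2 := by ring
          _ ≤ (Real.exp (2 * K) * gap X (j + i * p)) ^ 2 := by gcongr
          _ = Real.exp (4 * K) * (gap X (j + i * p) * gap X (j + i * p)) := by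
            rw [mul_pow, ← Real.exp_nat_mul, ← sq]; congr 2; push_cast; ring
          _ ≤ _ := by gcongr; exact hM _
    _ = Real.exp (4 * K) * M * ∑ i ∈ Finset.range n, gap X (j + i * p) := by
        rw [Finset.mul_sum]; exact Finset.sum_congr rfl fun _ _ => by ring
    _ ≤ Real.exp (4 * K) * M * 2 := by
        gcongr; exact h.sum_orbit j hn
    _ = _ := by ring

theorem exists_mem (h : GapData f p q X) (x : ℝ) : ∃ j, x ∈ Set.Icc (X j) (X (j + 1)) := by
  have hlow : ∃ b : ℤ, ∀ j, X j ≤ x → j ≤ b := by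
    refine ⟨(⌊x - X 0⌋ + 1) * q, fun j hj => ?_⟩
    by_contra! hcon
    have h1 := h.mono hcon
    have h2 := h.period_int 0 (⌊x - X 0⌋ + 1)
    rw [zero_add] at h2
    have := Int.lt_floor_add_one (x - X 0)
    push_cast at *
    linarith
  have hex : ∃ j, X j ≤ x := by
    refine ⟨⌊x - X 0⌋ * q, ?_⟩
    have h2 := h.period_int 0 ⌊x - X 0⌋
    rw [zero_add] at h2
    have := Int.floor_le (x - X 0)
    linarith
  obtain ⟨j, hj, hmax⟩ := Int.exists_greatest_of_bdd hlow hex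
  refine ⟨j, hj, ?_⟩
  by_contra! hcon
  have := hmax _ hcon.le
  omega

/-- Yoccoz's estimate for the nonlinearity of iterates up to one period. -/
theorem abs_deriv_dlog_pow_le (h : GapData f p q X) {K K' μ : ℝ}
    (hK : ∀ x, |deriv f.dlog x| ≤ K) (hK' : ∀ x, |f.schwarz x| ≤ K') (hμ : 0 < μ)
    (hM : ∀ j, gap X j ≤ μ ^ 2) {n : ℕ} (hn : n ≤ q) (j : ℤ) {x : ℝ}
    (hx : x ∈ Set.Icc (X j) (X (j + 1))) :
    |deriv (f ^ n).dlog x| * gap X j ≤ 2 * Real.exp (2 * K) *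
      Real.sqrt (4 * K' * Real.exp (4 * K)) * μ := by
  have hK'0 : 0 ≤ K' := (abs_nonneg _).trans (hK' 0)
  obtain ⟨u, hu⟩ : ∃ u, ∀ k, gap X u ≤ gap X k := by
    obtain ⟨i, -, hi⟩ := Finset.exists_min_image (Finset.range q) (fun i : ℕ => gap X (i * p))
      ⟨0, Finset.mem_range.2 h.q_pos⟩
    refine ⟨i * p, fun k => ?_⟩
    obtain ⟨c, hc, hck⟩ := h.exists_modEq 0 k
    rw [← h.gap_congr hck, zero_add]
    exact hi c (Finset.mem_range.2 hc)
  have hu0 := h.gap_pos u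
  have hglob : ∀ n ≤ 2 * q, ∀ x, |deriv (f ^ n).dlog x| * gap X u ≤
      Real.sqrt (4 * K' * Real.exp (4 * K)) * μ := by
    intro n hn x
    have hS : ∀ y, |(f ^ n).schwarz y| ≤ K' * (2 * Real.exp (4 * K) * μ ^ 2 / gap X u ^ 2) := by
      intro y
      obtain ⟨k, hk⟩ := h.exists_mem y
      rw [SLift.schwarz_pow]
      calc |∑ i ∈ Finset.range n, f.schwarz ((f ^ i) y) * deriv (f ^ i : SLift) y ^ 2|
          ≤ ∑ i ∈ Finset.range n, K' * deriv (f ^ i : SLift) y ^ 2 := by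
            refine (Finset.abs_sum_le_sum_abs _ _).trans (Finset.sum_le_sum fun i _ => ?_)
            rw [abs_mul, abs_of_nonneg (sq_nonneg (deriv (f ^ i : SLift) y))]
            gcongr
            exact hK' _
        _ = K' * ∑ i ∈ Finset.range n, deriv (f ^ i : SLift) y ^ 2 := by rw [Finset.mul_sum]
        _ ≤ _ := by
            gcongr
            rw [le_div_iff₀ (by positivity)]
            refine le_trans ?_ (h.sum_deriv_sq_le hK hM hn k hk)
            gcongr
            exact hu k
    have := (f ^ n).deriv_dlog_sq_le hS x
    refine abs_le_of_sq_le_sq' ?_ (by positivity) |>.2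
    rw [mul_pow, mul_pow, sq_abs, Real.sq_sqrt (by positivity)]
    calc _ ≤ 2 * (K' * (2 * Real.exp (4 * K) * μ ^ 2 / gap X u ^ 2)) * gap X u ^ 2 := by gcongr
      _ = _ := by field_simp; ring
  obtain ⟨i, hi, hmod⟩ := h.exists_modEq u j
  obtain ⟨c, hc⟩ := hmod.dvd
  have hxc : x - c ∈ Set.Icc (X (u + i * p)) (X (u + i * p + 1)) := by
    have e1 := h.period_int (u + i * p) c
    have e2 := h.period_int (u + i * p + 1) c
    rw [show u + i * p + c * q = j by linarith] at e1
    rw [show u + i * p + 1 + c * q = j + 1 by linarith] at e2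
    rw [e1, e2] at hx
    exact ⟨by linarith [hx.1], by linarith [hx.2]⟩
  set y := ((f ^ i)⁻¹ : SLift) (x - c) with hy
  have hfy : (f ^ i) y = x - c := (f ^ i).apply_inv_self _
  have hyu : y ∈ Set.Icc (X u) (X (u + 1)) := by
    rw [show u + i * p + 1 = u + 1 + i * p by ring, ← h.map_pow, ← h.map_pow, ← hfy] at hxc
    exact ⟨(f ^ i).strictMono.le_iff_le.1 hxc.1, (f ^ i).strictMono.le_iff_le.1 hxc.2⟩
  have e : deriv (f ^ (n + i)).dlog y = deriv (f ^ n).dlog x * deriv (f ^ i : SLift) y +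
      deriv (f ^ i).dlog y := by
    rw [pow_add, SLift.deriv_dlog_mul]
    simp only
    rw [hfy]
    have := (f ^ n).deriv_dlog_periodic.sub_zsmul_eq (x := x) c
    rw [show x - c = x - c • (1 : ℝ) by simp, this]
  have b1 := hglob (n + i) (by omega) y
  have b2 := hglob i (by omega) y
  have b3 := (h.deriv_pow_le hK (n := i) (by omega) u hyu).2
  rw [h.gap_congr hmod] at b3
  set S := Real.sqrt (4 * K' * Real.exp (4 * K)) * μ
  have b4 : |deriv (f ^ n).dlog x| * (deriv (f ^ i : SLift) y * gap X u) ≤ 2 * S := by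
    have := abs_sub (deriv (f ^ (n + i)).dlog y) (deriv (f ^ i).dlog y)
    rw [e, add_sub_cancel_right, ← e, abs_mul, abs_of_pos ((f ^ i).dpos y)] at this
    nlinarith
  calc |deriv (f ^ n).dlog x| * gap X j
      ≤ |deriv (f ^ n).dlog x| * (Real.exp (2 * K) * (deriv (f ^ i : SLift) y * gap X u)) := by
        gcongr
    _ = Real.exp (2 * K) * (|deriv (f ^ n).dlog x| * (deriv (f ^ i : SLift) y * gap X u)) := by
        ring
    _ ≤ Real.exp (2 * K) * (2 * S) := by gcongr
    _ = _ := by ring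

end GapData

theorem SLift.jetBound_schwarz {f : SLift} {k : ℕ} {K x : ℝ}
    (h : JetBound (k + 1) K 1 (deriv f.dlog) x) :
    JetBound k (K + 2 ^ k * K * K) 1 f.schwarz x := by
  have hs := smooth_deriv f.smooth_dlog
  have h1 := (jetBound_succ.1 h).2
  have h2 := h.of_le (Nat.le_succ k)
  have h3 := (h2.mul hs hs h2).const_mul (1 / 2)
  have h4 := h1.sub (smooth_deriv hs) (contDiff_const.mul (hs.mul hs)) h3
  have hK := h.nonneg
  have e : f.schwarz = fun y => deriv (deriv f.dlog) y -
      1 / 2 * (deriv f.dlog y * deriv f.dlog y) := by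
    funext y; rw [SLift.schwarz]; ring
  rw [e]
  refine h4.le zero_le_one ?_
  have : 0 ≤ (2 : ℝ) ^ k * K * K := by positivity
  rw [abs_of_pos (by norm_num)]
  linarith

/-- Yoccoz's estimates for all derivatives of the nonlinearity on the long gaps. -/
theorem exists_yoccoz (k : ℕ) (K : ℝ) {c : ℝ} (hc : 0 < c) : ∃ C : ℝ, 1 ≤ C ∧
    ∀ (f : SLift) (p : ℤ) (q : ℕ) (X : ℤ → ℝ) (μ : ℝ), GapData f p q X →
    (∀ x, JetBound (k + 1) K 1 (deriv f.dlog) x) → 0 < μ → μ ≤ 1 → (∀ j, gap X j ≤ μ ^ 2) →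
    ∀ n ≤ q, ∀ j, c * μ ^ 2 ≤ gap X j → ∀ x ∈ Set.Icc (X j) (X (j + 1)),
      JetBound k (C * μ⁻¹) μ⁻¹ (deriv (f ^ n).dlog) x := by
  induction k with
  | zero =>
    set K' := K + 2 ^ 0 * K * K
    set S := 2 * Real.exp (2 * K) * Real.sqrt (4 * K' * Real.exp (4 * K)) with hS
    refine ⟨max 1 (S / c), le_max_left _ _, fun f p q X μ h hK hμ hμ1 hM n hn j hj x hx => ?_⟩
    have h1 := h.abs_deriv_dlog_pow_le (fun x => (hK x).val)
      (fun x => (SLift.jetBound_schwarz (hK x)).val) hμ hM hn j hx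
    rw [jetBound_zero]
    refine le_trans ?_ (mul_le_mul_of_nonneg_right (le_max_right 1 (S / c)) (by positivity))
    have h2 : |deriv (f ^ n).dlog x| * (c * μ ^ 2) ≤ S * μ :=
      le_trans (by gcongr) h1
    rw [← div_eq_mul_inv, div_div, le_div_iff₀ (by positivity)]
    have h3 : |deriv (f ^ n).dlog x| * (c * μ) * μ ≤ S * μ := by nlinarith
    exact le_of_mul_le_mul_right h3 hμ
  | succ k ih =>
    obtain ⟨C, hC1, hC⟩ := ih
    obtain ⟨Ce, hCe1, hCe⟩ := jetBound_exp k C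
    obtain ⟨Cc, hCc1, hCc⟩ := jetBound_comp k (Ce * (Real.exp (2 * K) / c))
    set K' := K + 2 ^ k * K * K with hK'
    set A := 2 ^ k * (Cc * K') * (2 ^ k * Ce * Ce) with hA
    set A' := A * (2 * Real.exp (4 * K) / c ^ 2) + 2 ^ k * C * C with hA'
    refine ⟨max C A', hC1.trans (le_max_left _ _),
      fun f p q X μ h hK hμ hμ1 hM n hn j hj x hx => ?_⟩
    have hKk : ∀ x, JetBound (k + 1) K 1 (deriv f.dlog) x := fun x => (hK x).of_le (Nat.le_succ _)
    have ih : ∀ n ≤ q, JetBound k (C * μ⁻¹) μ⁻¹ (deriv (f ^ n).dlog) x := fun n hn =>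
      hC f p q X μ h hKk hμ hμ1 hM n hn j hj x hx
    have hB : 1 ≤ μ⁻¹ := (one_le_inv₀ hμ).2 hμ1
    have hB0 : 0 ≤ μ⁻¹ := zero_le_one.trans hB
    have hgap : 0 < gap X j := h.gap_pos j
    have hK0 : 0 ≤ K := (hK x).nonneg
    have hK'0 : 0 ≤ K' := by positivity
    have hA0 : 0 ≤ A := by positivity
    have hD : ∀ i ≤ q, JetBound k (Ce * deriv (f ^ i : SLift) x) μ⁻¹ (deriv (f ^ i : SLift)) x := by
      intro i hi
      have := hCe μ⁻¹ (f ^ i).dlog x hB0 (f ^ i).smooth_dlog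
          fun _ => (ih i hi).of_le (Nat.sub_le _ _)
      simpa only [SLift.exp_dlog] using this
    have hDle : ∀ i ≤ q, deriv (f ^ i : SLift) x ≤ Real.exp (2 * K) / c := by
      intro i hi
      have h1 := (h.deriv_pow_le (fun x => (hK x).val) (n := i) (by omega) j hx).1
      have h2 := (f ^ i).dpos x
      rw [le_div_iff₀ hc]
      have h3 : deriv (f ^ i : SLift) x * (c * μ ^ 2) ≤ Real.exp (2 * K) * μ ^ 2 :=
        calc _ ≤ deriv (f ^ i : SLift) x * gap X j := by gcongr
          _ ≤ _ := h1
          _ ≤ _ := by gcongr; exact hM _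
      exact le_of_mul_le_mul_right (by linarith) (show 0 < μ ^ 2 by positivity)
    have hσ : ∀ i ≤ q, JetBound k (Cc * K') μ⁻¹ (fun y => f.schwarz ((f ^ i) y)) x := by
      intro i hi
      refine hCc K' 1 μ⁻¹ f.schwarz (f ^ i : SLift) x one_pos hB0 f.smooth_schwarz (f ^ i).smooth
        (SLift.jetBound_schwarz (hKk _)) fun _ => ((hD i hi).of_le (Nat.sub_le _ _)).le hB0 ?_
      rw [div_one, mul_assoc]
      have := hDle i hi
      have h2 : 0 < Real.exp (2 * K) / c := by positivity
      gcongr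
      nlinarith
    have hsm : ∀ i, ContDiff ℝ ∞ (fun y => f.schwarz ((f ^ i) y)) := fun i =>
      f.smooth_schwarz.comp (f ^ i).smooth
    have hterm : ∀ i ∈ Finset.range n, JetBound k (A * deriv (f ^ i : SLift) x ^ 2) μ⁻¹
        (fun y => f.schwarz ((f ^ i) y) * deriv (f ^ i : SLift) y ^ 2) x := by
      intro i hi
      have hi : i ≤ q := by rw [Finset.mem_range] at hi; omega
      have := (hσ i hi).mul (hsm i) ((f ^ i).dsmooth.mul (f ^ i).dsmooth)
        ((hD i hi).mul (f ^ i).dsmooth (f ^ i).dsmooth (hD i hi))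
      simp only [← sq] at this
      refine this.le hB0 (le_of_eq ?_)
      rw [hA]; ring
    have hS := JetBound.sum (Finset.range n) (fun i _ => (hsm i).mul ((f ^ i).dsmooth.pow 2)) hterm
    rw [← SLift.schwarz_pow, ← Finset.mul_sum] at hS
    have hSle : A * ∑ i ∈ Finset.range n, deriv (f ^ i : SLift) x ^ 2 ≤
        A * (2 * Real.exp (4 * K) / c ^ 2) * (μ⁻¹ * μ⁻¹) := by
      rw [mul_assoc A]
      refine mul_le_mul_of_nonneg_left ?_ hA0
      have h1 := h.sum_deriv_sq_le (fun x => (hK x).val) hM (n := n) (by omega) j hx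
      have h2 : (∑ i ∈ Finset.range n, deriv (f ^ i : SLift) x ^ 2) * (c * μ ^ 2) ^ 2 ≤
          2 * Real.exp (4 * K) * μ ^ 2 := le_trans (by gcongr) h1
      have h3 := (le_div_iff₀ (by positivity)).2 h2
      refine h3.trans (le_of_eq ?_)
      field_simp
    have hn' := ih n hn
    have hs := smooth_deriv (f ^ n).smooth_dlog
    have hsq := (hn'.mul hs hs hn').const_mul (1 / 2)
    have hfin := hS.add (f ^ n).smooth_schwarz (contDiff_const.mul (hs.mul hs)) hsq
    have e : (fun y => (f ^ n).schwarz y + 1 / 2 * (deriv (f ^ n).dlog y * deriv (f ^ n).dlog y)) =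
        deriv (deriv (f ^ n).dlog) := by
      funext y; rw [SLift.schwarz]; ring
    rw [e] at hfin
    rw [jetBound_succ]
    constructor
    · refine hn'.val.trans ?_
      gcongr
      exact le_max_left _ _
    · refine hfin.le hB0 ?_
      rw [abs_of_pos (by norm_num : (0 : ℝ) < 1 / 2)]
      calc _ ≤ A * (2 * Real.exp (4 * K) / c ^ 2) * (μ⁻¹ * μ⁻¹) +
            2 ^ k * C * C * (μ⁻¹ * μ⁻¹) := by
            have : 0 ≤ 2 ^ k * C * C * (μ⁻¹ * μ⁻¹) := by positivity
            linarith
        _ = A' * (μ⁻¹ * μ⁻¹) := by rw [hA']; ring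
        _ ≤ max C A' * (μ⁻¹ * μ⁻¹) := by gcongr; exact le_max_right _ _
        _ = _ := by ring

/-- A smooth function with `N` zeros is controlled by its `N`-th derivative. -/
theorem abs_iteratedDeriv_le_of_zeros {N : ℕ} {a b S : ℝ} :
    ∀ {u : ℝ → ℝ}, ContDiff ℝ ∞ u → ∀ z : ℕ → ℝ, (∀ i, i + 1 < N → z i < z (i + 1)) →
    (∀ i < N, z i ∈ Set.Icc a b ∧ u (z i) = 0) →
    (∀ x ∈ Set.Icc a b, |iteratedDeriv N u x| ≤ S) →
    ∀ j ≤ N, ∀ x ∈ Set.Icc a b, |iteratedDeriv j u x| ≤ (b - a) ^ (N - j) * S := by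
  induction N with
  | zero =>
    intro u hu z hz hz0 h j hj x hx
    obtain rfl : j = 0 := by omega
    simpa using h x hx
  | succ N ih =>
    intro u hu z hz hz0 h j hj x hx
    have hex : ∀ i, ∃ y, i < N → y ∈ Set.Ioo (z i) (z (i + 1)) ∧ deriv u y = 0 := fun i => by
      by_cases hi : i < N
      · obtain ⟨y, hy, hy0⟩ := exists_deriv_eq_zero (f := u) (hz i (by omega))
          hu.continuous.continuousOn
          ((hz0 i (by omega)).2.trans (hz0 (i + 1) (by omega)).2.symm)
        exact ⟨y, fun _ => ⟨hy, hy0⟩⟩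
      · exact ⟨0, fun h => absurd h hi⟩
    choose y hy using hex
    have key := ih (u := deriv u) (smooth_deriv hu) y
      (fun i hi => ((hy i (by omega)).1.2).trans (hy (i + 1) hi).1.1)
      (fun i hi => ⟨⟨(hz0 i (by omega)).1.1.trans (hy i hi).1.1.le,
        (hy i hi).1.2.le.trans (hz0 (i + 1) (by omega)).1.2⟩, (hy i hi).2⟩)
      (fun x hx => by rw [← iteratedDeriv_succ']; exact h x hx)
    cases j with
    | succ j =>
      rw [iteratedDeriv_succ']
      simpa using key j (by omega) x hx
    | zero =>
      obtain ⟨h0, h1⟩ := hz0 0 (by omega)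
      have hle := abs_sub_le_of_deriv (smooth_diff hu) (x := x) (y := z 0)
        (K := (b - a) ^ N * S) fun w hw => by
          have := key 0 (by omega) w (Set.uIcc_subset_Icc hx h0 hw)
          simpa using this
      rw [h1, sub_zero] at hle
      rw [iteratedDeriv_zero]
      have hnn : 0 ≤ (b - a) ^ N * S := by
        have := key 0 (by omega) x hx
        exact (abs_nonneg _).trans (by simpa using this)
      have : |x - z 0| ≤ b - a := by
        rw [abs_le]; constructor <;> linarith [hx.1, hx.2, h0.1, h0.2]
      calc _ ≤ _ := hle
        _ ≤ (b - a) ^ N * S * (b - a) := by gcongr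
        _ = _ := by rw [Nat.sub_zero, pow_succ]; ring

/-- A periodic orbit whose longest gap has index `0` and length `μ ^ 2`. -/
structure Tower (κ : ℕ → ℝ) (f : SLift) (p : ℤ) (q : ℕ) (X : ℤ → ℝ) (μ : ℝ) : Prop where
  gd : GapData f p q X
  bound : ∀ k x, JetBound k (κ k) 1 (deriv f.dlog) x
  pos : 0 < μ
  le_one : μ ≤ 1
  gap_le : ∀ j, gap X j ≤ μ ^ 2
  gap_zero : gap X 0 = μ ^ 2

theorem GapData.exists_mem_of_mem {f : SLift} {p : ℤ} {q : ℕ} {X : ℤ → ℝ} (_h : GapData f p q X)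
    {a b : ℤ} (hab : a < b) {x : ℝ} (hx : x ∈ Set.Icc (X a) (X b)) :
    ∃ j, a ≤ j ∧ j < b ∧ x ∈ Set.Icc (X j) (X (j + 1)) := by
  obtain ⟨j, hj, hmax⟩ := Int.exists_greatest_of_bdd (P := fun j => j < b ∧ X j ≤ x)
    ⟨b, fun j hj => hj.1.le⟩ ⟨a, hab, hx.1⟩
  refine ⟨j, hmax a ⟨hab, hx.1⟩, hj.1, hj.2, ?_⟩
  by_contra! hcon
  by_cases hjb : j + 1 < b
  · have := hmax (j + 1) ⟨hjb, hcon.le⟩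
    omega
  · have hb : j + 1 = b := by omega
    rw [hb] at hcon
    linarith [hx.2]

namespace Tower

variable {κ : ℕ → ℝ} {f : SLift} {p : ℤ} {q : ℕ} {X : ℤ → ℝ} {μ : ℝ}

theorem one_le_inv (h : Tower κ f p q X μ) : 1 ≤ μ⁻¹ := (one_le_inv₀ h.pos).2 h.le_one

theorem abs_deriv_dlog_le (h : Tower κ f p q X μ) (x : ℝ) : |deriv f.dlog x| ≤ κ 0 :=
  (h.bound 0 x).val

theorem le_gap (h : Tower κ f p q X μ) (m : ℕ) : ∀ j : ℤ, |j| ≤ m →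
    Real.exp (-(8 * κ 0 * m)) * μ ^ 2 ≤ gap X j := by
  have e : ∀ m : ℕ, Real.exp (-(8 * κ 0 * (m + 1 : ℕ))) =
      (Real.exp (8 * κ 0))⁻¹ * Real.exp (-(8 * κ 0 * m)) := fun m => by
    rw [← Real.exp_neg, ← Real.exp_add]; push_cast; ring_nf
  have hinv : ∀ {a b : ℝ}, a ≤ Real.exp (8 * κ 0) * b → (Real.exp (8 * κ 0))⁻¹ * a ≤ b := by
    intro a b hab
    rwa [inv_mul_le_iff₀ (Real.exp_pos _)]
  have hK0 : 0 ≤ κ 0 := (abs_nonneg _).trans (h.abs_deriv_dlog_le 0)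
  induction m with
  | zero =>
    intro j hj
    obtain rfl : j = 0 := by simpa using hj
    simp [h.gap_zero]
  | succ m ih =>
    intro j hj
    rw [e, mul_assoc]
    by_cases hj' : |j| ≤ m
    · refine le_trans ?_ (ih j hj')
      refine mul_le_of_le_one_left (by positivity) (inv_le_one_of_one_le₀ ?_)
      exact Real.one_le_exp (by positivity)
    · rcases le_total 0 j with h0 | h0
      · rw [abs_of_nonneg h0] at hj hj'
        have h1 := ih (j - 1) (by rw [abs_le]; push_cast at hj; omega)
        have h2 := (h.gd.gap_ratio h.abs_deriv_dlog_le (j - 1)).2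
        rw [sub_add_cancel] at h2
        exact hinv (h1.trans h2)
      · rw [abs_of_nonpos h0] at hj hj'
        have h1 := ih (j + 1) (by rw [abs_le]; push_cast at hj; omega)
        exact hinv (h1.trans (h.gd.gap_ratio h.abs_deriv_dlog_le j).1)

end Tower

/-- Yoccoz's estimates on a neighbourhood of the longest gap. -/
theorem exists_yoccoz_hull (κ : ℕ → ℝ) (k m : ℕ) : ∃ C : ℝ, 1 ≤ C ∧
    ∀ (f : SLift) (p : ℤ) (q : ℕ) (X : ℤ → ℝ) (μ : ℝ), Tower κ f p q X μ → ∀ n ≤ q,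
    ∀ x ∈ Set.Icc (X (-m)) (X (m + 1)), JetBound k (C * μ⁻¹) μ⁻¹ (deriv (f ^ n).dlog) x ∧
      JetBound k C μ⁻¹ (deriv (f ^ n : SLift)) x := by
  obtain ⟨C, hC1, hC⟩ := exists_yoccoz k (κ (k + 1)) (Real.exp_pos (-(8 * κ 0 * m)))
  obtain ⟨Ce, hCe1, hCe⟩ := jetBound_exp k C
  have hexp := Real.exp_pos (-(8 * κ 0 * m))
  refine ⟨max C (Ce * (Real.exp (2 * κ 0) / Real.exp (-(8 * κ 0 * m)))),
    hC1.trans (le_max_left _ _), fun f p q X μ h n hn x hx => ?_⟩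
  obtain ⟨j, hj1, hj2, hj⟩ := h.gd.exists_mem_of_mem (by omega) hx
  have hB : 0 ≤ μ⁻¹ := zero_le_one.trans h.one_le_inv
  have hjm := h.le_gap m j (by rw [abs_le]; omega)
  have h1 := hC f p q X μ h.gd (h.bound _) h.pos h.le_one h.gap_le n hn j hjm x hj
  refine ⟨h1.le hB (by gcongr; exact le_max_left _ _), ?_⟩
  have h2 := hCe μ⁻¹ (f ^ n).dlog x hB (f ^ n).smooth_dlog fun _ => h1.of_le (Nat.sub_le _ _)
  simp only [SLift.exp_dlog] at h2
  refine h2.le hB (le_trans ?_ (le_max_right _ _))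
  have h3 := (h.gd.deriv_pow_le h.abs_deriv_dlog_le (n := n) (by omega) j hj).1
  have h4 := (f ^ n).dpos x
  have hμ := h.pos
  gcongr
  rw [le_div_iff₀ hexp]
  refine le_of_mul_le_mul_right ?_ (show 0 < μ ^ 2 by positivity)
  calc _ = deriv (f ^ n : SLift) x * (Real.exp (-(8 * κ 0 * m)) * μ ^ 2) := by ring
    _ ≤ deriv (f ^ n : SLift) x * gap X j := by gcongr
    _ ≤ _ := h3
    _ ≤ _ := by gcongr; exact h.gap_le _

theorem exists_near_identity (κ : ℕ → ℝ) (r P : ℕ) : ∃ C : ℝ, 1 ≤ C ∧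
    ∀ (f : SLift) (p : ℤ) (q : ℕ) (X : ℤ → ℝ) (μ : ℝ), Tower κ f p q X μ →
    ∀ x ∈ Set.Icc (X (-1)) (X 2),
      JetBound r (C * μ ^ (2 * P)) (μ ^ 2)⁻¹ (fun y => (f ^ q) y - p - y) x := by
  obtain ⟨m, hm1, hmr, hmP⟩ : ∃ m : ℕ, 1 ≤ m ∧ r ≤ m ∧ P ≤ m :=
    ⟨max 1 (max r P), le_max_left _ _, by simp, by simp⟩
  set N := 2 * m + 2 with hN
  obtain ⟨C, hC1, hC⟩ := exists_yoccoz_hull κ (N - 1) m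
  have hl1 : (1 : ℝ) ≤ 2 * m + 1 := by linarith [Nat.cast_nonneg (α := ℝ) m]
  refine ⟨(2 * m + 1) ^ N * C, one_le_mul_of_one_le_of_one_le (one_le_pow₀ hl1) hC1,
    fun f p q X μ h x hx => ?_⟩
  have hμ := h.pos
  set u : ℝ → ℝ := fun y => (f ^ q) y - p - y with hu
  have hus : ContDiff ℝ ∞ u := ((f ^ q).smooth.sub contDiff_const).sub contDiff_id
  have hdu : deriv u = fun y => deriv (f ^ q : SLift) y - 1 := by
    funext y
    exact ((((f ^ q).hasDeriv y).sub_const (p : ℝ)).fun_sub (hasDerivAt_id' y)).deriv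
  have hlen : X (m + 1) - X (-m) ≤ (2 * m + 1) * μ ^ 2 := by
    have := sum_gap X (-m) (2 * m + 1)
    rw [show (-m : ℤ) + (2 * m + 1 : ℕ) = m + 1 by push_cast; ring] at this
    rw [← this]
    refine (Finset.sum_le_sum fun c _ => h.gap_le _).trans (le_of_eq ?_)
    simp
  have hsub : x ∈ Set.Icc (X (-m)) (X (m + 1)) :=
    ⟨(h.gd.mono.monotone (by omega)).trans hx.1, hx.2.trans (h.gd.mono.monotone (by omega))⟩
  have hzero : ∀ j, u (X j) = 0 := fun j => by
    rw [hu]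
    simp only
    rw [h.gd.map_pow, mul_comm, h.gd.period_int]; ring
  have key := abs_iteratedDeriv_le_of_zeros (N := N) (a := X (-m)) (b := X (m + 1))
    (S := C * μ⁻¹ ^ (N - 1)) hus (fun i => X (-m + i))
    (fun i _ => h.gd.mono (by push_cast; omega))
    (fun i hi => ⟨⟨h.gd.mono.monotone (by omega), h.gd.mono.monotone (by omega)⟩, hzero _⟩)
    (fun y hy => by
      have h1 := (hC f p q X μ h q le_rfl y hy).2 (N - 1) le_rfl
      have e : iteratedDeriv N u y = iteratedDeriv (N - 1) (deriv (f ^ q : SLift)) y := by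
        rw [show N = N - 1 + 1 by omega, iteratedDeriv_succ', hdu,
          iteratedDeriv_fun_sub (smooth_at (f ^ q).dsmooth _ _) (smooth_at contDiff_const _ _),
          iteratedDeriv_const, if_neg (by omega), sub_zero, Nat.add_sub_cancel]
      rw [e]
      exact h1)
  intro j hj
  refine (key j (by omega) x hsub).trans ?_
  have hpos : 0 ≤ X (m + 1) - X (-m) := sub_nonneg.2 (h.gd.mono.monotone (by omega))
  calc (X (m + 1) - X (-m)) ^ (N - j) * (C * μ⁻¹ ^ (N - 1))
      ≤ ((2 * m + 1) * μ ^ 2) ^ (N - j) * (C * μ⁻¹ ^ (N - 1)) := by gcongr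
    _ = (2 * m + 1) ^ (N - j) * C * ((μ ^ 2) ^ (N - j) * μ⁻¹ ^ (N - 1)) := by rw [mul_pow]; ring
    _ ≤ (2 * m + 1) ^ N * C * (μ ^ (2 * P) * (μ ^ 2)⁻¹ ^ j) := by
        refine mul_le_mul (mul_le_mul_of_nonneg_right (pow_le_pow_right₀ hl1 (by omega))
          (by linarith)) ?_ (by positivity) (by positivity)
        have e : (μ ^ 2) ^ (N - j) * μ⁻¹ ^ (N - 1) = μ ^ (N + 1) * (μ ^ 2)⁻¹ ^ j := by
          have hj' : N - j + j = N := by omega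
          have hN' : N - 1 + 1 = N := by omega
          have h1 : (μ ^ 2) ^ (N - j) * (μ ^ 2) ^ j = (μ ^ 2) ^ N := by rw [← pow_add, hj']
          have h2 : μ ^ (N - 1) * μ = μ ^ N := by rw [← pow_succ, hN']
          rw [inv_pow, inv_pow, ← div_eq_mul_inv, ← div_eq_mul_inv,
            div_eq_div_iff (by positivity) (by positivity), h1, pow_succ μ N, ← h2]
          rw [← pow_mul, mul_comm 2 N, pow_mul, ← h2]; ring
        rw [e]
        gcongr ?_ * _
        exact pow_le_pow_of_le_one hμ.le h.le_one (by omega)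
    _ = _ := by ring

theorem Tower.sub_le {κ : ℕ → ℝ} {f : SLift} {p : ℤ} {q : ℕ} {X : ℤ → ℝ} {μ : ℝ}
    (h : Tower κ f p q X μ) (j : ℤ) (n : ℕ) : X (j + n) - X j ≤ n * μ ^ 2 := by
  rw [← sum_gap X j n]
  refine (Finset.sum_le_sum fun c _ => h.gap_le _).trans (le_of_eq ?_)
  simp

theorem Tower.hull_le {κ : ℕ → ℝ} {f : SLift} {p : ℤ} {q : ℕ} {X : ℤ → ℝ} {μ : ℝ}
    (h : Tower κ f p q X μ) : X 2 - X (-1) ≤ 3 * μ ^ 2 := by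
  simpa using h.sub_le (-1) 3

/-- The gaps adjacent to the longest one have almost the same length. -/
theorem exists_abs_gap_sub_le (κ : ℕ → ℝ) : ∃ C : ℝ, 1 ≤ C ∧
    ∀ (f : SLift) (p : ℤ) (q : ℕ) (X : ℤ → ℝ) (μ : ℝ), Tower κ f p q X μ →
    ∀ j : ℤ, -1 ≤ j → j ≤ 1 → |gap X j - μ ^ 2| ≤ C * μ ^ 3 := by
  obtain ⟨C, hC1, hC⟩ := exists_yoccoz_hull κ 0 1
  refine ⟨6 * C, by linarith, fun f p q X μ h j hj1 hj2 => ?_⟩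
  have hμ := h.pos
  rw [abs_sub_comm, abs_of_nonneg (sub_nonneg.2 (h.gap_le j))]
  obtain ⟨j₀, hj₀⟩ := h.gd.exists_max
  obtain ⟨n, hn, hmod⟩ := h.gd.exists_modEq j j₀
  have hle : gap X (0 + n * p) ≤ gap X (j + n * p) := by
    rw [h.gd.gap_congr hmod]; exact hj₀ _
  have hvar : ∀ x ∈ Set.Icc (X (-1)) (X 2), |(f ^ n).dlog x - (f ^ n).dlog (X 0)| ≤ 3 * C * μ := by
    intro x hx
    have hX0 : X 0 ∈ Set.Icc (X (-1)) (X 2) :=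
      ⟨h.gd.mono.monotone (by norm_num), h.gd.mono.monotone (by norm_num)⟩
    refine (abs_sub_le_of_deriv (smooth_diff (f ^ n).smooth_dlog) (K := C * μ⁻¹)
        fun z hz => ?_).trans ?_
    · have hz' := Set.uIcc_subset_Icc hx hX0 hz
      exact (hC f p q X μ h n hn.le z (by simpa using hz')).1.val
    · have h1 : |x - X 0| ≤ 3 * μ ^ 2 := by
        rw [abs_le]; have := h.hull_le
        constructor <;> linarith [hx.1, hx.2, hX0.1, hX0.2]
      have h0 : 0 ≤ C * μ⁻¹ := by positivity
      calc C * μ⁻¹ * |x - X 0| ≤ C * μ⁻¹ * (3 * μ ^ 2) := by gcongr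
        _ = _ := by field_simp
  set c := (f ^ n).dlog (X 0)
  have hlow : Real.exp (c - 3 * C * μ) * gap X 0 ≤ gap X (0 + n * p) := by
    rw [← h.gd.gap_map_pow]
    refine (f ^ n).le_sub_of_le_deriv (h.gd.mono.monotone (by norm_num)) fun z hz => ?_
    rw [← SLift.exp_dlog]
    gcongr
    have := hvar z ⟨(h.gd.mono.monotone (by norm_num)).trans hz.1,
      hz.2.trans (h.gd.mono.monotone (by norm_num))⟩
    linarith [(_root_.abs_le.1 this).1]
  have hup : gap X (j + n * p) ≤ Real.exp (c + 3 * C * μ) * gap X j := by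
    rw [← h.gd.gap_map_pow]
    refine (f ^ n).sub_le_of_deriv_le (h.gd.mono.monotone (by omega)) fun z hz => ?_
    rw [← SLift.exp_dlog]
    gcongr
    have := hvar z ⟨(h.gd.mono.monotone (by omega)).trans hz.1,
      hz.2.trans (h.gd.mono.monotone (by omega))⟩
    linarith [(_root_.abs_le.1 this).2]
  have h1 := hlow.trans (hle.trans hup)
  rw [h.gap_zero, show c - 3 * C * μ = (c + 3 * C * μ) + -(6 * C * μ) by ring, Real.exp_add,
    mul_assoc] at h1
  have h2 := le_of_mul_le_mul_left h1 (Real.exp_pos _)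
  have h3 := Real.add_one_le_exp (-(6 * C * μ))
  nlinarith [mul_le_mul_of_nonneg_right h3 (sq_nonneg μ)]

/-- Between gaps close to the longest one the iterates are close to translations. -/
theorem exists_near_translation (κ : ℕ → ℝ) (r : ℕ) : ∃ C : ℝ, 1 ≤ C ∧
    ∀ (f : SLift) (p : ℤ) (q : ℕ) (X : ℤ → ℝ) (μ : ℝ), Tower κ f p q X μ →
    ∀ i ≤ q, ∀ j s n : ℤ, -1 ≤ j → j ≤ 1 → -1 ≤ s → s ≤ 1 → j + i * p = s + n * q →
    ∀ x ∈ Set.Icc (X (-1)) (X 2),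
      JetBound r (C * μ ^ 3) (μ ^ 2)⁻¹ (fun y => (f ^ i) y - n - y - (s - j) * μ ^ 2) x := by
  obtain ⟨C₀, hC₀1, hC₀⟩ := exists_abs_gap_sub_le κ
  obtain ⟨C, hC1, hC⟩ := exists_yoccoz_hull κ r 1
  have hE := Real.exp_pos (-(8 * κ 0))
  set E := Real.exp (-(8 * κ 0)) with hEdef
  set C₁ := 2 * C₀ / E + 2 ^ r * C * C * 3 with hC₁
  have hpos1 : 0 ≤ 2 * C₀ / E := by positivity
  have h2r : (1 : ℝ) ≤ 2 ^ r := one_le_pow₀ (by norm_num)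
  have hCC : C * C ≤ 2 ^ r * C * C := by
    rw [mul_assoc]; exact le_mul_of_one_le_left (by positivity) h2r
  have hCC1 : 1 ≤ C * C := one_le_mul_of_one_le_of_one_le hC1 hC1
  refine ⟨2 * C₀ + 3 * C₁, by nlinarith, fun f p q X μ h i hi j s n hj1 hj2 hs1 hs2 hjs x hx => ?_⟩
  have hμ := h.pos
  have hμ1 := h.one_le_inv
  have hmem : ∀ l : ℤ, -1 ≤ l → l ≤ 2 → X l ∈ Set.Icc (X (-1)) (X 2) := fun l h1 h2 =>
    ⟨h.gd.mono.monotone h1, h.gd.mono.monotone h2⟩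
  have hlen : ∀ x ∈ Set.Icc (X (-1)) (X 2), ∀ y ∈ Set.Icc (X (-1)) (X 2), |x - y| ≤ 3 * μ ^ 2 := by
    intro x hx y hy
    have := h.hull_le
    rw [abs_le]; constructor <;> linarith [hx.1, hx.2, hy.1, hy.2]
  have hL : ∀ y ∈ Set.Icc (X (-1)) (X 2), JetBound r (C * μ⁻¹) μ⁻¹ (deriv (f ^ i).dlog) y ∧
      JetBound r C μ⁻¹ (deriv (f ^ i : SLift)) y := fun y hy =>
    hC f p q X μ h i hi y (by simpa using hy)
  set e : ℝ → ℝ := fun y => (f ^ i) y - n - y - (s - j) * μ ^ 2 with he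
  have hes : ContDiff ℝ ∞ e :=
    (((f ^ i).smooth.sub contDiff_const).sub contDiff_id).sub contDiff_const
  have hde : deriv e = fun y => deriv (f ^ i : SLift) y - 1 := by
    funext y
    exact (((((f ^ i).hasDeriv y).sub_const (n : ℝ)).fun_sub (hasDerivAt_id' y)).sub_const _).deriv
  have hdde : deriv (deriv e) = fun y => deriv (f ^ i).dlog y * deriv (f ^ i : SLift) y := by
    funext y
    rw [hde, ← SLift.deriv_deriv]
    exact deriv_sub_const _
  have h2 : ∀ y ∈ Set.Icc (X (-1)) (X 2),
      JetBound r (2 ^ r * (C * μ⁻¹) * C) μ⁻¹ (deriv (deriv e)) y := fun y hy => by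
    rw [hdde]
    exact JetBound.mul (smooth_deriv (f ^ i).smooth_dlog) (f ^ i).dsmooth (hL y hy).1 (hL y hy).2
  have hd : ∀ y ∈ Set.Icc (X (-1)) (X 2), |deriv e y| ≤ C₁ * μ := by
    have hle := h.le_gap 1 j (by rw [abs_le]; omega)
    rw [Nat.cast_one, mul_one, ← hEdef] at hle
    have hgj := h.gd.gap_pos j
    have hgs : gap X (j + i * p) = gap X s := h.gd.gap_congr (by
      rw [hjs]; exact (Int.modEq_iff_dvd.2 ⟨-n, by ring⟩))
    obtain ⟨ξ, hξ, hξ'⟩ := exists_deriv_eq_slope (f ^ i : SLift) (h.gd.mono (by omega : j < j + 1))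
      (f ^ i).continuous.continuousOn
      (fun y _ => ((f ^ i).hasDeriv y).differentiableAt.differentiableWithinAt)
    rw [h.gd.gap_map_pow, hgs] at hξ'
    change _ = gap X s / gap X j at hξ'
    have hξm : ξ ∈ Set.Icc (X (-1)) (X 2) :=
      ⟨(hmem j hj1 (by omega)).1.trans hξ.1.le,
      hξ.2.le.trans (hmem (j + 1) (by omega) (by omega)).2⟩
    have h3 : |deriv e ξ| ≤ 2 * C₀ / E * μ := by
      simp only [hde]
      rw [hξ', div_sub_one hgj.ne', abs_div, abs_of_pos hgj, div_le_iff₀ hgj]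
      have a1 := hC₀ f p q X μ h j hj1 hj2
      have a2 := hC₀ f p q X μ h s hs1 hs2
      calc |gap X s - gap X j| ≤ 2 * C₀ * μ ^ 3 := by
            rw [abs_le] at *; constructor <;> linarith [a1.1, a1.2, a2.1, a2.2]
        _ = 2 * C₀ / E * μ * (E * μ ^ 2) := by field_simp
        _ ≤ _ := by gcongr
    intro y hy
    have h4 : |deriv e y - deriv e ξ| ≤ 2 ^ r * (C * μ⁻¹) * C * |y - ξ| :=
      abs_sub_le_of_deriv (smooth_diff (smooth_deriv hes)) fun z hz =>
        (h2 z (Set.uIcc_subset_Icc hy hξm hz)).val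
    have h5 : 2 ^ r * (C * μ⁻¹) * C * |y - ξ| ≤ 2 ^ r * C * C * 3 * μ := by
      calc _ ≤ 2 ^ r * (C * μ⁻¹) * C * (3 * μ ^ 2) := by gcongr; exact hlen y hy ξ hξm
        _ = _ := by field_simp
    calc |deriv e y| ≤ |deriv e y - deriv e ξ| + |deriv e ξ| := by
          simpa using abs_add_le (deriv e y - deriv e ξ) (deriv e ξ)
      _ ≤ 2 ^ r * C * C * 3 * μ + 2 * C₀ / E * μ := add_le_add (h4.trans h5) h3
      _ = _ := by rw [hC₁]; ring
  have h0 : |e x| ≤ (2 * C₀ + 3 * C₁) * μ ^ 3 := by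
    have hj' : |e (X j)| ≤ 2 * C₀ * μ ^ 3 := by
      have b1 : e (X j) = X s - X j - (s - j) * μ ^ 2 := by
        simp only [he]; rw [h.gd.map_pow, hjs, h.gd.period_int]; ring
      have b2 := hC₀ f p q X μ h (-1) le_rfl (by norm_num)
      have b3 := hC₀ f p q X μ h 0 (by norm_num) (by norm_num)
      simp only [gap] at b2 b3
      norm_num at b2 b3
      have b5 : 0 ≤ C₀ * μ ^ 3 := by positivity
      rw [b1]
      rw [abs_le] at *
      obtain rfl | rfl | rfl : j = -1 ∨ j = 0 ∨ j = 1 := by omega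
      all_goals obtain rfl | rfl | rfl : s = -1 ∨ s = 0 ∨ s = 1 := by omega
      all_goals push_cast; constructor <;> linarith [b2.1, b2.2, b3.1, b3.2]
    have h4 : |e x - e (X j)| ≤ C₁ * μ * |x - X j| :=
      abs_sub_le_of_deriv (smooth_diff hes) fun z hz =>
        hd z (Set.uIcc_subset_Icc hx (hmem j hj1 (by omega)) hz)
    have h5 : C₁ * μ * |x - X j| ≤ 3 * C₁ * μ ^ 3 := by
      calc _ ≤ C₁ * μ * (3 * μ ^ 2) := by gcongr; exact hlen x hx _ (hmem j hj1 (by omega))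
        _ = _ := by ring
    calc |e x| ≤ |e x - e (X j)| + |e (X j)| := by
          simpa using abs_add_le (e x - e (X j)) (e (X j))
      _ ≤ _ := by linarith
  have hB : μ⁻¹ ≤ (μ ^ 2)⁻¹ := by
    gcongr; exact pow_le_of_le_one hμ.le h.le_one (by norm_num)
  refine JetBound.of_le (r := r + 2) ?_ (by omega)
  refine jetBound_succ.2 ⟨h0, jetBound_succ.2 ⟨(hd x hx).trans ?_, (h2 x hx).mono le_rfl ?_
    (by positivity) hB⟩⟩
  · calc C₁ * μ ≤ (2 * C₀ + 3 * C₁) * μ := by gcongr; nlinarith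
      _ = _ := by field_simp
  · calc 2 ^ r * (C * μ⁻¹) * C = 2 ^ r * C * C * μ⁻¹ := by ring
      _ ≤ (2 * C₀ + 3 * C₁) * μ⁻¹ := by gcongr; nlinarith
      _ = _ := by field_simp

/-- The `1`-periodic extension of a function supported in `[-1/4, 1/4]`. -/
def periodize (u : ℝ → ℝ) (s : ℝ) : ℝ := u (s - round s)

theorem periodize_eq {u : ℝ → ℝ} (hu : ∀ x, 1 / 4 ≤ |x| → u x = 0) {s : ℝ} {n : ℤ}
    (h : |s - n| < 3 / 4) : periodize u s = u (s - n) := by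
  unfold periodize
  by_cases hn : round s = n
  · rw [hn]
  have h1 : (1 : ℝ) ≤ |(round s : ℝ) - n| := by
    exact_mod_cast Int.one_le_abs (sub_ne_zero.2 hn)
  have h2 := abs_sub_round s
  have h3 : |(round s : ℝ) - n| ≤ |s - round s| + |s - n| := by
    rw [abs_sub_comm s (round s : ℝ)]; exact abs_sub_le _ _ _
  rw [hu _ (by linarith), hu _ (by linarith)]

theorem periodize_eventuallyEq {u : ℝ → ℝ} (hu : ∀ x : ℝ, 1 / 4 ≤ |x| → u x = 0) (s : ℝ) :
    periodize u =ᶠ[𝓝 s] fun y : ℝ => u (y - round s) := by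
  have h : ∀ᶠ y : ℝ in 𝓝 s, |y - round s| < 3 / 4 := by
    have hc : Continuous fun y : ℝ => |y - round s| := by fun_prop
    refine hc.continuousAt.eventually_lt continuousAt_const ?_
    linarith [abs_sub_round s]
  filter_upwards [h] with y hy using periodize_eq hu hy

theorem smooth_periodize {u : ℝ → ℝ} (hs : ContDiff ℝ ∞ u) (hu : ∀ x, 1 / 4 ≤ |x| → u x = 0) :
    ContDiff ℝ ∞ (periodize u) := by
  refine contDiff_iff_contDiffAt.2 fun s => ?_
  refine ContDiffAt.congr_of_eventuallyEq ?_ (periodize_eventuallyEq hu s)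
  exact (hs.comp (contDiff_id.sub contDiff_const)).contDiffAt

theorem periodize_add_one (u : ℝ → ℝ) (s : ℝ) : periodize u (s + 1) = periodize u s := by
  unfold periodize
  rw [round_add_one]; push_cast; congr 1; ring

theorem JetBound.sub_const_comp {r : ℕ} {K B x a : ℝ} {u : ℝ → ℝ} (h : JetBound r K B u (x - a)) :
    JetBound r K B (fun y => u (y - a)) x := by
  intro j hj
  rw [iteratedDeriv_comp_sub_const]
  exact h j hj

theorem jetBound_of_compactSupport {u : ℝ → ℝ} (hs : ContDiff ℝ ∞ u) (hc : HasCompactSupport u)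
    (r : ℕ) : ∃ K, 1 ≤ K ∧ ∀ x, JetBound r K 1 u x := by
  have h : ∀ j, ∃ K, ∀ x, |iteratedDeriv j u x| ≤ K := by
    intro j
    have : HasCompactSupport (iteratedDeriv j u) := by
      induction j with
      | zero => simpa using hc
      | succ j ih => rw [iteratedDeriv_succ]; exact ih.deriv
    simpa only [Real.norm_eq_abs] using
      (smooth_iter hs j).continuous.bounded_above_of_compact_support this
  choose K hK using h
  refine ⟨1 + ∑ j ∈ Finset.range (r + 1), |K j|, by
    have := Finset.sum_nonneg fun j (_ : j ∈ Finset.range (r + 1)) => abs_nonneg (K j)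
    linarith, fun x j hj => ?_⟩
  have h1 := Finset.single_le_sum (fun j (_ : j ∈ Finset.range (r + 1)) => abs_nonneg (K j))
    (Finset.mem_range.2 (Nat.lt_succ_of_le hj))
  rw [one_pow, mul_one]
  linarith [hK j x, le_abs_self (K j)]

/-- A periodic cutoff `χ` equal to `1` on `[x₀, x₀ + M]`, and a degree one map `φ` which is affine
with slope `N⁻¹` near `x₀`. -/
structure Cutoff (c : ℕ → ℝ) (x₀ M N : ℝ) (χ φ : ℝ → ℝ) : Prop where
  smooth : ContDiff ℝ ∞ χ
  smooth' : ContDiff ℝ ∞ φ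
  nonneg : ∀ y, 0 ≤ χ y
  period : ∀ y, χ (y + 1) = χ y
  period' : ∀ y, φ (y + 1) = φ y + 1
  one : ∀ y ∈ Set.Icc x₀ (x₀ + M), χ y = 1
  zero : ∀ y : ℝ, (∀ n : ℤ, y - n ∉ Set.Icc (x₀ - M / 4) (x₀ + 5 * M / 4)) → χ =ᶠ[𝓝 y] 0
  bound : ∀ r y, JetBound r (c r) M⁻¹ χ y
  affine : ∀ y, |y - x₀| ≤ 1 / 8 → φ y = (y - x₀) / N

theorem exists_cutoff : ∃ c : ℕ → ℝ, (∀ r, 1 ≤ c r) ∧ ∀ x₀ M N : ℝ, 0 < M → M ≤ 1 / 8 →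
    ∃ χ φ : ℝ → ℝ, Cutoff c x₀ M N χ φ := by
  let b : ContDiffBump (1 / 2 : ℝ) := ⟨1 / 2, 3 / 4, by norm_num, by norm_num⟩
  let b' : ContDiffBump (0 : ℝ) := ⟨1 / 8, 1 / 4, by norm_num, by norm_num⟩
  have hb : ContDiff ℝ ∞ b := b.contDiff
  choose c hc1 hc using jetBound_of_compactSupport hb b.hasCompactSupport
  have hbz : ∀ s : ℝ, s ∉ Set.Icc (-1 / 4 : ℝ) (5 / 4) → b s = 0 := by
    intro s hs
    apply b.zero_of_le_dist
    change 3 / 4 ≤ _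
    rw [Real.dist_eq, le_abs]
    by_contra! h
    exact hs ⟨by linarith [h.2], by linarith [h.1]⟩
  have hbo : ∀ s : ℝ, s ∈ Set.Icc (0 : ℝ) 1 → b s = 1 := by
    intro s hs
    apply b.one_of_mem_closedBall
    change dist s _ ≤ 1 / 2
    rw [Real.dist_eq, abs_le]
    constructor <;> linarith [hs.1, hs.2]
  refine ⟨c, hc1, fun x₀ M N hM hM8 => ?_⟩
  set v : ℝ → ℝ := fun s => b (M⁻¹ * s)
  have hv : ContDiff ℝ ∞ v := hb.comp (contDiff_const.mul contDiff_id)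
  have hvz : ∀ s, s ∉ Set.Icc (-(M / 4)) (5 * M / 4) → v s = 0 := by
    intro s hs
    refine hbz _ fun h => hs ?_
    rw [Set.mem_Icc, ← div_eq_inv_mul, le_div_iff₀ hM, div_le_iff₀ hM] at h
    constructor <;> linarith [h.1, h.2]
  have hv4 : ∀ s, 1 / 4 ≤ |s| → v s = 0 := by
    intro s hs
    refine hvz s fun h => ?_
    rcases le_abs.1 hs with h' | h' <;> linarith [h.1, h.2]
  set w : ℝ → ℝ := fun s => s * b' s
  have hw : ContDiff ℝ ∞ w := contDiff_id.mul b'.contDiff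
  have hw4 : ∀ s, 1 / 4 ≤ |s| → w s = 0 := by
    intro s hs
    have : b' s = 0 := by
      apply b'.zero_of_le_dist
      change 1 / 4 ≤ _
      rwa [Real.dist_eq, sub_zero]
    simp only [w, this, mul_zero]
  have hvp := smooth_periodize hv hv4
  have hwp := smooth_periodize hw hw4
  have hid : ContDiff ℝ ∞ fun y : ℝ => y - x₀ := contDiff_id.sub contDiff_const
  refine ⟨fun y => periodize v (y - x₀),
    fun y => (y - x₀) + (N⁻¹ - 1) * periodize w (y - x₀), hvp.comp hid,
    hid.add (contDiff_const.mul (hwp.comp hid)), fun y => b.nonneg, fun y => ?_, fun y => ?_,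
    fun y hy => ?_, fun y hy => ?_, fun r y => ?_, fun y hy => ?_⟩
  · rw [show y + 1 - x₀ = y - x₀ + 1 by ring, periodize_add_one]
  · rw [show y + 1 - x₀ = y - x₀ + 1 by ring, periodize_add_one]; ring
  · have h1 : |y - x₀ - (0 : ℤ)| < 3 / 4 := by
      rw [abs_lt]; constructor <;> push_cast <;> linarith [hy.1, hy.2]
    change periodize v (y - x₀) = 1
    rw [periodize_eq hv4 h1]
    refine hbo _ ?_
    rw [Set.mem_Icc, ← div_eq_inv_mul, le_div_iff₀ hM, div_le_iff₀ hM]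
    push_cast
    constructor <;> linarith [hy.1, hy.2]
  · set n := round (y - x₀) with hn
    have h1 : (fun z => periodize v (z - x₀)) =ᶠ[𝓝 y] fun z => v (z - x₀ - n) :=
      (continuous_sub_right x₀).continuousAt.tendsto.eventually (periodize_eventuallyEq hv4 _)
    refine h1.trans ?_
    have h2 : ∀ᶠ z : ℝ in 𝓝 y, z - n ∉ Set.Icc (x₀ - M / 4) (x₀ + 5 * M / 4) :=
      (continuous_sub_right (n : ℝ)).continuousAt.tendsto.eventually
        (isClosed_Icc.isOpen_compl.mem_nhds (hy n))
    filter_upwards [h2] with z hz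
    refine hvz _ fun h => hz ?_
    constructor <;> linarith [h.1, h.2]
  · have h1 : (fun z => periodize v (z - x₀)) =ᶠ[𝓝 y] fun z => v (z - (x₀ + round (y - x₀))) := by
      simp only [← sub_sub]
      exact (continuous_sub_right x₀).continuousAt.tendsto.eventually (periodize_eventuallyEq hv4 _)
    refine JetBound.congr (JetBound.sub_const_comp ?_) h1.symm
    intro j hj
    have h2 : iteratedDeriv j v = fun s => M⁻¹ ^ j * iteratedDeriv j b (M⁻¹ * s) :=
      iteratedDeriv_comp_const_mul (hb.of_le (by exact_mod_cast le_top)) M⁻¹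
    rw [h2]
    simp only [abs_mul, abs_pow, abs_inv, abs_of_pos hM]
    rw [mul_comm]
    gcongr
    simpa using hc r (M⁻¹ * (y - (x₀ + round (y - x₀)))) j hj
  · have h1 : |y - x₀ - (0 : ℤ)| < 3 / 4 := by push_cast; rw [sub_zero]; linarith
    rw [periodize_eq hw4 h1]
    have h2 : b' (y - x₀ - (0 : ℤ)) = 1 := by
      apply b'.one_of_mem_closedBall
      change dist _ _ ≤ 1 / 8
      rw [Real.dist_eq]
      simpa using hy
    simp only [w, h2]
    push_cast
    ring

/-- The total weight of the orbit segment `z, f z, …, f^(q-1) z` with respect to `χ`. -/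
def weight (f : SLift) (q : ℕ) (χ : ℝ → ℝ) (z : ℝ) : ℝ := ∑ i ∈ Finset.range q, χ ((f ^ i) z)

/-- The weighted average of `φ (f^i z) - i α` along an orbit segment. -/
def average (f : SLift) (q : ℕ) (χ φ : ℝ → ℝ) (α z : ℝ) : ℝ :=
  (∑ i ∈ Finset.range q, χ ((f ^ i) z) * (φ ((f ^ i) z) - i * α)) * (weight f q χ z)⁻¹

/-- A tower together with a cutoff adapted to its longest gap. -/
structure CutTower (κ c : ℕ → ℝ) (f : SLift) (p : ℤ) (q : ℕ) (X : ℤ → ℝ) (μ : ℝ)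
    (χ φ : ℝ → ℝ) : Prop where
  tower : Tower κ f p q X μ
  cutoff : Cutoff c (X 0) (μ ^ 2) (q * μ ^ 2) χ φ
  left : μ ^ 2 / 4 < gap X (-1)
  right : μ ^ 2 / 4 < gap X 1
  small : 3 * μ ^ 2 < 1 / 8

theorem GapData.pow_mem {f : SLift} {p : ℤ} {q : ℕ} {X : ℤ → ℝ} (h : GapData f p q X) (i : ℕ)
    {j : ℤ} {z : ℝ} (hz : z ∈ Set.Icc (X j) (X (j + 1))) :
    (f ^ i) z ∈ Set.Icc (X (j + i * p)) (X (j + i * p + 1)) := by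
  rw [← h.map_pow, show j + i * p + 1 = j + 1 + i * p by ring, ← h.map_pow]
  exact ⟨(f ^ i).strictMono.monotone hz.1, (f ^ i).strictMono.monotone hz.2⟩

theorem GapData.sub_int_mem {f : SLift} {p : ℤ} {q : ℕ} {X : ℤ → ℝ} (h : GapData f p q X) (n : ℤ)
    {j : ℤ} {z : ℝ} (hz : z ∈ Set.Icc (X j) (X (j + 1))) :
    z - n ∈ Set.Icc (X (j - n * q)) (X (j - n * q + 1)) := by
  have h1 := h.period_int (j - n * q) n
  have h2 := h.period_int (j - n * q + 1) n
  rw [sub_add_cancel] at h1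
  rw [show j - n * q + 1 + n * q = j + 1 by ring] at h2
  constructor <;> linarith [hz.1, hz.2]

namespace CutTower

variable {κ c : ℕ → ℝ} {f : SLift} {p : ℤ} {q : ℕ} {X : ℤ → ℝ} {μ : ℝ} {χ φ : ℝ → ℝ}

theorem gd (h : CutTower κ c f p q X μ χ φ) : GapData f p q X := h.tower.gd

theorem pos (h : CutTower κ c f p q X μ χ φ) : 0 < μ := h.tower.pos

theorem period_int (h : CutTower κ c f p q X μ χ φ) (y : ℝ) (n : ℤ) : χ (y - n) = χ y := by
  simpa using (show Function.Periodic χ 1 from h.cutoff.period).sub_zsmul_eq n (x := y)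

theorem period_int' (h : CutTower κ c f p q X μ χ φ) (y : ℝ) (n : ℤ) : φ (y - n) = φ y - n := by
  have : Function.Periodic (fun y => φ y - y) 1 := fun y => by
    simp only [h.cutoff.period']; ring
  have h2 := this.sub_zsmul_eq n (x := y)
  simp only [zsmul_eq_mul, mul_one] at h2
  linarith

theorem mem_hull (h : CutTower κ c f p q X μ χ φ) {j : ℤ} (h1 : -1 ≤ j) (h2 : j ≤ 2) :
    X j ∈ Set.Icc (X (-1)) (X 2) :=
  ⟨h.gd.mono.monotone h1, h.gd.mono.monotone h2⟩

theorem abs_sub_lt (h : CutTower κ c f p q X μ χ φ) {y : ℝ} (hy : y ∈ Set.Icc (X (-1)) (X 2)) :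
    |y - X 0| < 1 / 8 := by
  have h0 := h.mem_hull (j := 0) (by norm_num) (by norm_num)
  have h1 := h.tower.hull_le
  have h2 := h.small
  rw [abs_lt]
  constructor <;> linarith [hy.1, hy.2, h0.1, h0.2]

theorem mem_Ioo (h : CutTower κ c f p q X μ χ φ) {y : ℝ}
    (hy : y ∈ Set.Icc (X 0 - μ ^ 2 / 4) (X 0 + 5 * μ ^ 2 / 4)) : y ∈ Set.Ioo (X (-1)) (X 2) := by
  have h1 := h.left
  have h2 := h.right
  have h3 := h.tower.gap_zero
  simp only [gap] at h1 h2 h3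
  norm_num at h1 h2 h3
  constructor <;> linarith [hy.1, hy.2]

theorem eventually_zero (h : CutTower κ c f p q X μ χ φ) {y : ℝ}
    (hy : ∀ n : ℤ, y - n ∉ Set.Ioo (X (-1)) (X 2)) : χ =ᶠ[𝓝 y] 0 :=
  h.cutoff.zero y fun n hn => hy n (h.mem_Ioo hn)

/-- The times at which the interval between `X j` and `X (j + 1)` meets the support of `χ`. -/
def visits (p : ℤ) (q : ℕ) (j : ℤ) : Finset ℕ :=
  open Classical in
  {i ∈ Finset.range q | ∃ s n : ℤ, -1 ≤ s ∧ s ≤ 1 ∧ j + i * p = s + n * q}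

theorem card_visits_le (h : CutTower κ c f p q X μ χ φ) (j : ℤ) : (visits p q j).card ≤ 3 := by
  classical
  have hex : ∀ i ∈ visits p q j, ∃ s : ℤ, (-1 ≤ s ∧ s ≤ 1) ∧ ∃ n : ℤ, j + i * p = s + n * q := by
    intro i hi
    obtain ⟨-, s, n, h1, h2, h3⟩ := Finset.mem_filter.1 hi
    exact ⟨s, ⟨h1, h2⟩, n, h3⟩
  choose! s hs n hn using hex
  have := Finset.card_le_card_of_injOn (s := visits p q j) (t := Finset.Icc (-1 : ℤ) 1) s
    (fun i hi => by simpa using hs i hi) (fun i hi i' hi' hii => by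
      have e1 := hn i hi
      have e2 := hn i' hi'
      have hi2 := Finset.mem_range.1 (Finset.mem_filter.1 hi).1
      have hi2' := Finset.mem_range.1 (Finset.mem_filter.1 hi').1
      have e3 : (i : ℤ) * p ≡ i' * p [ZMOD q] := by
        refine Int.modEq_iff_dvd.2 ⟨n i' - n i, ?_⟩
        rw [hii] at e1
        linear_combination e2 - e1
      have e4 := h.gd.coprime_dvd e3
      exact Nat.ModEq.eq_of_lt_of_lt (Int.natCast_modEq_iff.1 e4) hi2 hi2')
  simpa using this

theorem comp_eventually_zero (h : CutTower κ c f p q X μ χ φ) {j : ℤ} {z : ℝ}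
    (hz : z ∈ Set.Icc (X j) (X (j + 1))) {i : ℕ} (hi : i < q) (hi' : i ∉ visits p q j) :
    (fun y => χ ((f ^ i) y)) =ᶠ[𝓝 z] 0 := by
  classical
  refine (f ^ i).continuous.continuousAt.tendsto.eventually (h.eventually_zero fun n hn => ?_)
  have h1 := h.gd.sub_int_mem n (h.gd.pow_mem i hz)
  have h2 := h.gd.mono.lt_iff_lt.1 (h1.1.trans_lt hn.2)
  have h3 := h.gd.mono.lt_iff_lt.1 (hn.1.trans_le h1.2)
  exact hi' (Finset.mem_filter.2 ⟨Finset.mem_range.2 hi, j + i * p - n * q, n, by omega, by omega,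
    by ring⟩)

theorem smooth_comp (h : CutTower κ c f p q X μ χ φ) (i : ℕ) :
    ContDiff ℝ ∞ fun y => χ ((f ^ i) y) := h.cutoff.smooth.comp (f ^ i).smooth

theorem smooth_comp' (h : CutTower κ c f p q X μ χ φ) (i : ℕ) :
    ContDiff ℝ ∞ fun y => φ ((f ^ i) y) := h.cutoff.smooth'.comp (f ^ i).smooth

theorem jetBound_sum_visits (h : CutTower κ c f p q X μ χ φ) {r : ℕ} {K B : ℝ} (hB : 0 ≤ B)
    (hK : 0 ≤ K) {j : ℤ} {z : ℝ} (hz : z ∈ Set.Icc (X j) (X (j + 1))) {G : ℕ → ℝ → ℝ}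
    (hG : ∀ i, ContDiff ℝ ∞ (G i))
    (hb : ∀ i ∈ visits p q j, JetBound r K B (fun y => χ ((f ^ i) y) * G i y) z) :
    JetBound r (3 * K) B (fun y => ∑ i ∈ Finset.range q, χ ((f ^ i) y) * G i y) z := by
  classical
  refine (JetBound.sum (Finset.range q) (K := fun i => if i ∈ visits p q j then K else 0)
    (fun i _ => (h.smooth_comp i).mul (hG i)) fun i hi => ?_).le hB ?_
  · split_ifs with hv
    · exact hb i hv
    · have h0 : JetBound r 0 B (fun _ => (0 : ℝ)) z := by
        simpa using jetBound_const r hB 0 z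
      refine h0.congr ?_
      filter_upwards [h.comp_eventually_zero hz (Finset.mem_range.1 hi) hv] with y hy
      rw [hy]; simp
  · rw [← Finset.sum_filter, Finset.sum_const, nsmul_eq_mul]
    gcongr
    have h1 : ((Finset.range q).filter fun i => i ∈ visits p q j).card ≤ 3 :=
      (Finset.card_le_card fun i hi => (Finset.mem_filter.1 hi).2).trans (h.card_visits_le j)
    exact_mod_cast h1

theorem one_le_weight (h : CutTower κ c f p q X μ χ φ) (z : ℝ) : 1 ≤ weight f q χ z := by
  obtain ⟨j, hj⟩ := h.gd.exists_mem z
  obtain ⟨i, hi, hmod⟩ := h.gd.exists_modEq j 0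
  obtain ⟨n, hn⟩ := hmod.symm.dvd
  have h1 := h.gd.sub_int_mem n (h.gd.pow_mem i hj)
  rw [show j + i * p - n * q = 0 by linear_combination hn] at h1
  have h2 : χ ((f ^ i) z) = 1 := by
    rw [← h.period_int _ n]
    refine h.cutoff.one _ ⟨h1.1, ?_⟩
    rw [← h.tower.gap_zero, gap]
    simpa using h1.2
  calc (1 : ℝ) = χ ((f ^ i) z) := h2.symm
    _ ≤ _ := Finset.single_le_sum (f := fun i => χ ((f ^ i) z)) (fun _ _ => h.cutoff.nonneg _)
        (Finset.mem_range.2 hi)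

theorem weight_pos (h : CutTower κ c f p q X μ χ φ) (z : ℝ) : 0 < weight f q χ z :=
  one_pos.trans_le (h.one_le_weight z)

theorem smooth_weight (h : CutTower κ c f p q X μ χ φ) : ContDiff ℝ ∞ (weight f q χ) :=
  ContDiff.sum fun i _ => h.smooth_comp i

theorem smooth_average (h : CutTower κ c f p q X μ χ φ) (α : ℝ) :
    ContDiff ℝ ∞ (average f q χ φ α) :=
  (ContDiff.sum fun i _ => (h.smooth_comp i).mul ((h.smooth_comp' i).sub contDiff_const)).mul
    (h.smooth_weight.inv fun z => (h.weight_pos z).ne')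

theorem weight_add_one (h : CutTower κ c f p q X μ χ φ) (z : ℝ) :
    weight f q χ (z + 1) = weight f q χ z := by
  unfold weight
  simp only [SLift.map_add_one, h.cutoff.period]

theorem average_add_one (h : CutTower κ c f p q X μ χ φ) (α z : ℝ) :
    average f q χ φ α (z + 1) = average f q χ φ α z + 1 := by
  have h1 : ∑ i ∈ Finset.range q, χ ((f ^ i) (z + 1)) * (φ ((f ^ i) (z + 1)) - i * α) =
      ∑ i ∈ Finset.range q, χ ((f ^ i) z) * (φ ((f ^ i) z) - i * α) + weight f q χ z := by
    simp only [weight, SLift.map_add_one, h.cutoff.period, h.cutoff.period',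
      ← Finset.sum_add_distrib]
    exact Finset.sum_congr rfl fun i _ => by ring
  rw [average, average, h.weight_add_one, h1, add_mul, mul_inv_cancel₀ (h.weight_pos z).ne']

end CutTower

namespace CutTower

variable {κ c : ℕ → ℝ} {f : SLift} {p : ℤ} {q : ℕ} {X : ℤ → ℝ} {μ : ℝ} {χ φ : ℝ → ℝ}

theorem weight_map (f : SLift) (q : ℕ) (χ : ℝ → ℝ) (z : ℝ) :
    weight f q χ (f z) = weight f q χ z + (χ ((f ^ q) z) - χ z) := by
  have h1 := Finset.sum_range_succ (fun i => χ ((f ^ i) z)) q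
  rw [Finset.sum_range_succ'] at h1
  simp only [pow_succ, SLift.mul_apply, pow_zero, SLift.one_apply] at h1
  simp only [weight]
  linear_combination h1

theorem average_map_sub (h : CutTower κ c f p q X μ χ φ) (α z : ℝ) :
    average f q χ φ α (f z) - α - average f q χ φ α z =
      (χ ((f ^ q) z) * (φ ((f ^ q) z) - φ z - q * α) +
        (χ ((f ^ q) z) - χ z) * (φ z - average f q χ φ α z)) * (weight f q χ (f z))⁻¹ := by
  have h1 := Finset.sum_range_succ (fun i => χ ((f ^ i) z) * (φ ((f ^ i) z) - i * α)) q
  rw [Finset.sum_range_succ'] at h1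
  simp only [pow_succ, SLift.mul_apply, pow_zero, SLift.one_apply, Nat.cast_zero, zero_mul,
    sub_zero, Nat.cast_add, Nat.cast_one] at h1
  have hA := (h.weight_pos z).ne'
  have hA' := (h.weight_pos (f z)).ne'
  have e1 : ∑ i ∈ Finset.range q, χ ((f ^ i) z) * (φ ((f ^ i) z) - i * α) =
      average f q χ φ α z * weight f q χ z := by
    rw [average, mul_assoc, inv_mul_cancel₀ hA, mul_one]
  have e2 : ∑ i ∈ Finset.range q, χ ((f ^ i) (f z)) * (φ ((f ^ i) (f z)) - i * α) =
      average f q χ φ α (f z) * weight f q χ (f z) := by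
    rw [average, mul_assoc, inv_mul_cancel₀ hA', mul_one]
  have e3 : ∑ i ∈ Finset.range q, χ ((f ^ i) (f z)) * (φ ((f ^ i) (f z)) - (i + 1) * α) =
      average f q χ φ α (f z) * weight f q χ (f z) - α * weight f q χ (f z) := by
    rw [← e2, weight, Finset.mul_sum, ← Finset.sum_sub_distrib]
    exact Finset.sum_congr rfl fun i _ => by ring
  rw [e1, e3] at h1
  rw [eq_mul_inv_iff_mul_eq₀ hA']
  have h2 := weight_map f q χ z
  linear_combination h1 - average f q χ φ α z * h2

theorem inv_sq_nonneg (h : CutTower κ c f p q X μ χ φ) : 0 ≤ (μ ^ 2)⁻¹ := by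
  have := h.pos; positivity

theorem inv_le_inv (h : CutTower κ c f p q X μ χ φ) : μ⁻¹ ≤ (μ ^ 2)⁻¹ := by
  have := h.pos
  gcongr; exact pow_le_of_le_one this.le h.tower.le_one (by norm_num)

/-- The return map `f^q - p` preserves the hull. -/
theorem return_mem (h : CutTower κ c f p q X μ χ φ) {a b : ℤ} {z : ℝ} :
    (f ^ q) z - p ∈ Set.Icc (X a) (X b) ↔ z ∈ Set.Icc (X a) (X b) := by
  have h1 : ∀ j : ℤ, (f ^ q) (X j) - p = X j := fun j => by
    rw [h.gd.map_pow, mul_comm, h.gd.period_int]; ring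
  rw [Set.mem_Icc, Set.mem_Icc, ← h1 a, ← h1 b, sub_le_sub_iff_right, sub_le_sub_iff_right,
    h1, h1, (f ^ q).strictMono.le_iff_le, (f ^ q).strictMono.le_iff_le]

theorem eventually_affine (h : CutTower κ c f p q X μ χ φ) {u : ℝ → ℝ} (hu : Continuous u)
    {z : ℝ} (hz : u z ∈ Set.Icc (X (-1)) (X 2)) :
    ∀ᶠ y in 𝓝 z, φ (u y) = (u y - X 0) / (q * μ ^ 2) := by
  have h1 : ∀ᶠ y in 𝓝 z, |u y - X 0| < 1 / 8 :=
    (hu.sub continuous_const).abs.continuousAt.eventually_lt continuousAt_const (h.abs_sub_lt hz)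
  filter_upwards [h1] with y hy using h.cutoff.affine _ hy.le

end CutTower

theorem exists_weight_bound (κ c : ℕ → ℝ) (r : ℕ) : ∃ C : ℝ, 1 ≤ C ∧
    ∀ (f : SLift) (p : ℤ) (q : ℕ) (X : ℤ → ℝ) (μ : ℝ) (χ φ : ℝ → ℝ),
    CutTower κ c f p q X μ χ φ → ∀ z ∈ Set.Icc (X (-1)) (X 2),
    (∀ i ≤ q, JetBound r C (μ ^ 2)⁻¹ (fun y => χ ((f ^ i) y)) z) ∧
      JetBound r C (μ ^ 2)⁻¹ (weight f q χ) z := by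
  obtain ⟨C, hC1, hC⟩ := exists_yoccoz_hull κ r 1
  obtain ⟨Cc, hCc1, hCc⟩ := jetBound_comp r C
  set C' := max 1 (Cc * c r)
  have hC'1 : 1 ≤ C' := le_max_left _ _
  refine ⟨3 * C', by linarith, fun f p q X μ χ φ h z hz => ?_⟩
  have hB := h.inv_sq_nonneg
  have hμ := h.pos
  have h1 : ∀ i ≤ q, JetBound r C' (μ ^ 2)⁻¹ (fun y => χ ((f ^ i) y)) z := by
    intro i hi
    refine (hCc (c r) (μ ^ 2)⁻¹ (μ ^ 2)⁻¹ χ (f ^ i : SLift) z (by positivity) hB h.cutoff.smooth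
      (f ^ i).smooth (h.cutoff.bound r _) fun _ => ?_).le hB (le_max_right _ _)
    rw [mul_div_assoc, div_self (by positivity), mul_one]
    exact (hC f p q X μ h.tower i hi z (by simpa using hz)).2.mono (Nat.sub_le _ _) le_rfl
      (by positivity) h.inv_le_inv
  refine ⟨fun i hi => (h1 i hi).le hB (by linarith), ?_⟩
  obtain ⟨j, -, -, hj⟩ := h.gd.exists_mem_of_mem (by norm_num) hz
  have h2 := h.jetBound_sum_visits hB (zero_le_one.trans hC'1) hj (r := r) (G := fun _ _ => 1)
    (fun _ => contDiff_const) (fun i hi => by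
      classical
      simpa using h1 i (Finset.mem_range.1 (Finset.mem_filter.1 hi).1).le)
  simp only [mul_one] at h2
  exact h2

theorem exists_average_bound (κ c : ℕ → ℝ) (r : ℕ) : ∃ C : ℝ, 1 ≤ C ∧
    ∀ (f : SLift) (p : ℤ) (q : ℕ) (X : ℤ → ℝ) (μ : ℝ) (χ φ : ℝ → ℝ),
    CutTower κ c f p q X μ χ φ → ∀ α : ℝ, q ^ 2 * μ ^ 2 * |α - p / q| ≤ μ ^ 3 →
    ∀ z ∈ Set.Icc (X (-1)) (X 2), JetBound r (C * μ ^ 3) (μ ^ 2)⁻¹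
      (fun y => q * μ ^ 2 * average f q χ φ α y - (y - X 0)) z := by
  obtain ⟨Cw, hCw1, hCw⟩ := exists_weight_bound κ c r
  obtain ⟨Ct, hCt1, hCt⟩ := exists_near_translation κ r
  obtain ⟨Ci, hCi0, hCi⟩ := jetBound_inv r Cw 1 one_pos
  set K := 2 ^ r * Cw * (Ct + 1) with hK
  have h2r : (1 : ℝ) ≤ 2 ^ r := one_le_pow₀ (by norm_num)
  refine ⟨max 1 (2 ^ r * (3 * K) * Ci), le_max_left _ _, fun f p q X μ χ φ h α hα z hz => ?_⟩
  have hB := h.inv_sq_nonneg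
  have hμ := h.pos
  have hq : (0 : ℝ) < q := by exact_mod_cast h.gd.q_pos
  obtain ⟨j, hj1, hj2, hj⟩ := h.gd.exists_mem_of_mem (by norm_num) hz
  set N : ℝ := q * μ ^ 2 with hN
  have hN0 : 0 < N := by positivity
  set G : ℕ → ℝ → ℝ := fun i y => N * (φ ((f ^ i) y) - i * α) - (y - X 0)
  have hG : ∀ i, ContDiff ℝ ∞ (G i) := fun i =>
    (contDiff_const.mul ((h.smooth_comp' i).sub contDiff_const)).sub
    (contDiff_id.sub contDiff_const)
  have hsum : JetBound r (3 * (K * μ ^ 3)) (μ ^ 2)⁻¹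
      (fun y => ∑ i ∈ Finset.range q, χ ((f ^ i) y) * G i y) z := by
    refine h.jetBound_sum_visits hB (by positivity) hj hG fun i hi => ?_
    classical
    obtain ⟨hiq, s, n, hs1, hs2, hsn⟩ := Finset.mem_filter.1 hi
    have hiq := Finset.mem_range.1 hiq
    have hGi : JetBound r ((Ct + 1) * μ ^ 3) (μ ^ 2)⁻¹ (G i) z := by
      have h1 := hCt f p q X μ h.tower i hiq.le j s n hj1 (by omega) hs1 hs2 hsn z hz
      have h2 := jetBound_const r hB (-(i * N * (α - p / q))) z
      have h3 := JetBound.add ((((f ^ i).smooth.sub contDiff_const).sub contDiff_id).sub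
        contDiff_const) contDiff_const h1 h2
      have h4 : |(-(i * N * (α - p / q)))| ≤ μ ^ 3 := by
        rw [abs_neg, abs_mul, abs_of_nonneg (by positivity)]
        refine le_trans ?_ hα
        have : (i : ℝ) ≤ q := by exact_mod_cast hiq.le
        calc (i : ℝ) * N * |α - p / q| ≤ q * N * |α - p / q| := by gcongr
          _ = _ := by rw [hN]; ring
      refine (h3.le hB (by linarith)).congr ?_
      have h5 : (f ^ i) z - n ∈ Set.Icc (X (-1)) (X 2) := by
        have h6 := h.gd.sub_int_mem n (h.gd.pow_mem i hj)
        rw [show j + i * p - n * q = s by linear_combination hsn] at h6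
        exact ⟨(h.mem_hull hs1 (by omega)).1.trans h6.1,
          h6.2.trans (h.mem_hull (j := s + 1) (by omega) (by omega)).2⟩
      filter_upwards [h.eventually_affine (u := fun y => (f ^ i) y - n)
        ((f ^ i).continuous.sub continuous_const) h5] with y hy
      rw [h.period_int'] at hy
      rw [← hN, eq_div_iff hN0.ne'] at hy
      have h7 : (j : ℝ) + i * p = s + n * q := by exact_mod_cast hsn
      have h8 : N * (p / q) = μ ^ 2 * p := by rw [hN]; field_simp
      simp only [G, id]
      linear_combination i * h8 + μ ^ 2 * h7 - hy - n * hN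
    refine (JetBound.mul (h.smooth_comp i) (hG i)
        ((hCw f p q X μ χ φ h z hz).1 i hiq.le) hGi).le hB ?_
    rw [hK]; exact le_of_eq (by ring)
  have hinv : JetBound r Ci (μ ^ 2)⁻¹ (fun y => (weight f q χ y)⁻¹) z :=
    hCi _ _ z hB h.smooth_weight h.weight_pos (h.one_le_weight z) (hCw f p q X μ χ φ h z hz).2
  have hprod := JetBound.mul (ContDiff.sum fun i _ => (h.smooth_comp i).mul (hG i))
    (h.smooth_weight.inv fun z => (h.weight_pos z).ne') hsum hinv
  have heq : (fun y => N * average f q χ φ α y - (y - X 0)) =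
      fun y => (∑ i ∈ Finset.range q, χ ((f ^ i) y) * G i y) * (weight f q χ y)⁻¹ := by
    funext y
    have hA := (h.weight_pos y).ne'
    have h1 : ∑ i ∈ Finset.range q, χ ((f ^ i) y) * G i y =
        N * ∑ i ∈ Finset.range q, χ ((f ^ i) y) * (φ ((f ^ i) y) - i * α) -
          weight f q χ y * (y - X 0) := by
      rw [weight, Finset.mul_sum, Finset.sum_mul, ← Finset.sum_sub_distrib]
      exact Finset.sum_congr rfl fun i _ => by simp only [G]; ring
    rw [h1, average]
    linear_combination (y - X 0) * mul_inv_cancel₀ hA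
  rw [heq]
  refine hprod.le hB ?_
  calc 2 ^ r * (3 * (K * μ ^ 3)) * Ci = 2 ^ r * (3 * K) * Ci * μ ^ 3 := by ring
    _ ≤ _ := by gcongr; exact le_max_right _ _

theorem exists_defect_bound (κ c : ℕ → ℝ) (r P : ℕ) : ∃ C : ℝ, 1 ≤ C ∧
    ∀ (f : SLift) (p : ℤ) (q : ℕ) (X : ℤ → ℝ) (μ : ℝ) (χ φ : ℝ → ℝ),
    CutTower κ c f p q X μ χ φ → ∀ α : ℝ, q ^ 2 * μ ^ 2 * |α - p / q| ≤ μ ^ (2 * P + 3) →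
    ∀ z ∈ Set.Icc (X (-1)) (X 2), JetBound r (C * μ ^ (2 * P)) (μ ^ 2)⁻¹
      (fun y => q * μ ^ 2 * (average f q χ φ α (f y) - α - average f q χ φ α y)) z := by
  obtain ⟨Cw, hCw1, hCw⟩ := exists_weight_bound κ c r
  obtain ⟨Ca, hCa1, hCa⟩ := exists_average_bound κ c r
  obtain ⟨Cn, hCn1, hCn⟩ := exists_near_identity κ r (P + 1)
  obtain ⟨Cy, hCy1, hCy⟩ := exists_yoccoz_hull κ r 1
  obtain ⟨Ci, hCi0, hCi⟩ := jetBound_inv r (3 * Cw) 1 one_pos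
  obtain ⟨Cs, hCs1, hCs⟩ := jetBound_comp_sub r Cy
  set K₁ := 2 ^ r * Cw * (Cn + 1) with hK₁
  set K₂ := 2 ^ r * (Cs * (max 1 (c (r + 1)) * Cn)) * Ca with hK₂
  have hc1 : 1 ≤ max 1 (c (r + 1)) := le_max_left _ _
  have hK₂0 : 0 ≤ K₂ := by positivity
  refine ⟨max 1 (2 ^ r * (K₁ + K₂) * Ci), le_max_left _ _, fun f p q X μ χ φ h α hα z hz => ?_⟩
  have hB := h.inv_sq_nonneg
  have hμ := h.pos
  have hμ1 := h.tower.le_one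
  have hq : (0 : ℝ) < q := by exact_mod_cast h.gd.q_pos
  set N : ℝ := q * μ ^ 2 with hN
  have hN0 : 0 < N := by positivity
  set τ : ℝ := N * (q * α - p) with hτ
  have hτ' : |τ| ≤ μ ^ (2 * P + 3) := by
    refine le_trans (le_of_eq ?_) hα
    have : τ = q ^ 2 * μ ^ 2 * (α - p / q) := by rw [hτ, hN]; field_simp
    rw [this, abs_mul, abs_of_nonneg (by positivity : 0 ≤ (q : ℝ) ^ 2 * μ ^ 2)]
  have hα3 : q ^ 2 * μ ^ 2 * |α - p / q| ≤ μ ^ 3 :=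
    hα.trans (pow_le_pow_of_le_one hμ.le hμ1 (by omega))
  set D : ℝ → ℝ := fun y => N * average f q χ φ α y - (y - X 0) with hD
  have hDs : ContDiff ℝ ∞ D :=
    (contDiff_const.mul (h.smooth_average α)).sub (contDiff_id.sub contDiff_const)
  have hDb : JetBound r (Ca * μ ^ 3) (μ ^ 2)⁻¹ D z := hCa f p q X μ χ φ h α hα3 z hz
  set u : ℝ → ℝ := fun y => (f ^ q) y - p - y with hu
  have hus : ContDiff ℝ ∞ u := ((f ^ q).smooth.sub contDiff_const).sub contDiff_id
  have hub : JetBound r (Cn * μ ^ (2 * (P + 1))) (μ ^ 2)⁻¹ u z := hCn f p q X μ h.tower z hz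
  have hχ := hCw f p q X μ χ φ h z hz
  have h0q : (fun y => χ ((f ^ 0 : SLift) y)) = χ := by simp only [pow_zero, SLift.one_apply]
  have hχ0 : JetBound r Cw (μ ^ 2)⁻¹ χ z := by simpa only [h0q] using hχ.1 0 (Nat.zero_le _)
  -- the first term
  have hut : JetBound r ((Cn + 1) * μ ^ (2 * P)) (μ ^ 2)⁻¹ (fun y => u y + -τ) z := by
    refine (JetBound.add hus contDiff_const hub (jetBound_const r hB (-τ) z)).le hB ?_
    have h1 : μ ^ (2 * (P + 1)) ≤ μ ^ (2 * P) := pow_le_pow_of_le_one hμ.le hμ1 (by omega)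
    have h2 : μ ^ (2 * P + 3) ≤ μ ^ (2 * P) := pow_le_pow_of_le_one hμ.le hμ1 (by omega)
    rw [abs_neg]
    nlinarith
  have hs1 : ContDiff ℝ ∞ fun y => u y + -τ := hus.add contDiff_const
  have t1 := JetBound.mul (h.smooth_comp q) hs1 (hχ.1 q le_rfl) hut
  -- the second term
  have hret : ContDiff ℝ ∞ fun y => (f ^ q) y - p := (f ^ q).smooth.sub contDiff_const
  have hχd : ∀ y, JetBound r (max 1 (c (r + 1)) * (μ ^ 2)⁻¹) (μ ^ 2)⁻¹ (deriv χ) y := fun y =>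
    ((jetBound_succ.1 (h.cutoff.bound (r + 1) y)).2).le hB (by gcongr; exact le_max_right _ _)
  have hdiff : JetBound r (Cs * (max 1 (c (r + 1)) * Cn) * μ ^ (2 * P)) (μ ^ 2)⁻¹
      (fun y => χ ((f ^ q) y) - χ y) z := by
    have h1 := hCs (max 1 (c (r + 1)) * (μ ^ 2)⁻¹) (μ ^ 2)⁻¹ (μ ^ 2)⁻¹ (Cn * μ ^ (2 * (P + 1)))
      χ (fun y => (f ^ q) y - p) (fun y => y) z (by positivity) hB h.cutoff.smooth hret contDiff_id
      (fun y _ => hχd y) (fun _ => ?_) (fun _ => ?_) hub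
    · simp only [h.period_int] at h1
      refine h1.le hB (le_of_eq ?_)
      have : μ ^ (2 * (P + 1)) = μ ^ (2 * P) * μ ^ 2 := by rw [← pow_add]; ring_nf
      rw [this]
      field_simp
    · rw [mul_div_assoc, div_self (by positivity), mul_one]
      have h2 : deriv (fun y => (f ^ q) y - (p : ℝ)) = deriv (f ^ q : SLift) := by
        funext y; exact deriv_sub_const _
      rw [h2]
      exact (hCy f p q X μ h.tower q le_rfl z (by simpa using hz)).2.mono (Nat.sub_le _ _) le_rfl
        (by have := h.pos; positivity) h.inv_le_inv
    · rw [mul_div_assoc, div_self (by positivity), mul_one, deriv_id_eq]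
      exact (jetBound_const _ hB 1 z).le hB (by simpa using hCy1)
  have hdiffs : ContDiff ℝ ∞ fun y => χ ((f ^ q) y) - χ y := (h.smooth_comp q).sub h.cutoff.smooth
  have hDn : JetBound r Ca (μ ^ 2)⁻¹ (fun y => -D y) z := by
    refine hDb.neg.le hB ?_
    exact mul_le_of_le_one_right (by linarith) (pow_le_one₀ hμ.le hμ1)
  have hDns : ContDiff ℝ ∞ fun y => -D y := hDs.neg
  have t2 := JetBound.mul hdiffs hDns hdiff hDn
  have t3 := JetBound.add ((h.smooth_comp q).mul hs1) (hdiffs.mul hDns) t1 t2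
  -- the denominator
  have hwf : JetBound r (3 * Cw) (μ ^ 2)⁻¹ (fun y => weight f q χ (f y)) z := by
    have h1 := JetBound.add h.smooth_weight hdiffs hχ.2
      (JetBound.sub (h.smooth_comp q) h.cutoff.smooth (hχ.1 q le_rfl) hχ0)
    simp only [CutTower.weight_map]
    exact h1.le hB (by linarith)
  have hwfs : ContDiff ℝ ∞ fun y => weight f q χ (f y) := h.smooth_weight.comp f.smooth
  have hinv := hCi _ _ z hB hwfs (fun y => h.weight_pos _) (h.one_le_weight _) hwf
  have t4 := JetBound.mul (((h.smooth_comp q).mul hs1).add (hdiffs.mul hDns))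
    (hwfs.inv fun y => (h.weight_pos _).ne') t3 hinv
  refine (t4.le hB ?_).congr ?_
  · calc _ = 2 ^ r * (K₁ + K₂) * Ci * μ ^ (2 * P) := by rw [hK₁, hK₂]; ring
      _ ≤ _ := by gcongr; exact le_max_right _ _
  · filter_upwards [h.eventually_affine (u := fun y => y) continuous_id hz,
      h.eventually_affine (u := fun y => (f ^ q) y - p) hret.continuous
        (h.return_mem.2 hz)] with y hy1 hy2
    rw [h.average_map_sub]
    rw [h.period_int'] at hy2
    rw [← hN, eq_div_iff hN0.ne'] at hy1 hy2
    simp only [hu, hD, Pi.inv_apply]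
    linear_combination (weight f q χ (f y))⁻¹ *
      (χ ((f ^ q) y) * hτ - χ ((f ^ q) y) * hy2 + χ y * hy1)

theorem SLift.deriv_sub_int_of_add_one {u : ℝ → ℝ} (hu : ∀ x, u (x + 1) = u x + 1) (x : ℝ) (n : ℤ) :
    deriv u (x - n) = deriv u x := by
  have h : Function.Periodic (deriv u) 1 := fun y => by
    rw [← deriv_comp_add_const, funext hu, deriv_add_const]
  simpa using h.sub_zsmul_eq n (x := x)

/-- If `N h` is close to a translation and `k` is close to `h`, with the same values at the
endpoints of an interval, then `k⁻¹ h` is close to the identity on that interval. -/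
theorem exists_correction_bound (r : ℕ) : ∃ C : ℝ, 1 ≤ C ∧
    ∀ (h k : SLift) (N B δ x₀ a b : ℝ), 0 < N → 0 < B → δ ≤ 1 / (4 * B) → h a = k a → h b = k b →
    (∀ z ∈ Set.Icc a b, JetBound (r + 1) (1 / (4 * B)) B (fun y => N * h y - (y - x₀)) z) →
    (∀ z ∈ Set.Icc a b, JetBound (r + 1) δ B (fun y => N * (k y - h y)) z) →
    ∀ z ∈ Set.Icc a b, JetBound r (C * δ) B (fun y => (k⁻¹ * h) y - y) z := by
  obtain ⟨Ci, hCi0, hCi⟩ := jetBound_inverse r 2 (1 / 2) (by norm_num)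
  obtain ⟨Cs, hCs1, hCs⟩ := jetBound_comp_sub r 2
  refine ⟨max 1 (Cs * Ci), le_max_left _ _, fun h k N B δ x₀ a b hN hB hδ ha hb hh hk z hz => ?_⟩
  have hδ0 : 0 ≤ δ := (hk z hz).nonneg
  have hsh : ContDiff ℝ ∞ fun y => N * h y := contDiff_const.mul h.smooth
  have hsk : ContDiff ℝ ∞ fun y => N * k y := contDiff_const.mul k.smooth
  have hsu : ContDiff ℝ ∞ fun y => k⁻¹ (N⁻¹ * y) :=
    k⁻¹.smooth.comp (contDiff_const.mul contDiff_id)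
  have hkpos : ∀ x, 0 < deriv (fun y => N * k y) x := fun x => by
    rw [deriv_const_mul _ (smooth_diff k.smooth x)]
    exact mul_pos hN (k.dpos x)
  have haff : ContDiff ℝ ∞ fun y : ℝ => y - x₀ := contDiff_id.sub contDiff_const
  have hderiv : ∀ (v : ℝ → ℝ) (K x : ℝ), ContDiff ℝ ∞ v → K ≤ 1 / (2 * B) →
      JetBound (r + 1) K B (fun y => v y - (y - x₀)) x →
      JetBound r 2 B (deriv v) x ∧ 1 / 2 ≤ deriv v x := by
    intro v K x hv hK hj
    have h1 := (jetBound_succ.1 hj).2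
    have h2 : deriv (fun y => v y - (y - x₀)) = fun y => deriv v y - 1 := by
      funext y
      rw [deriv_fun_sub (smooth_diff hv y) (smooth_diff haff y), deriv_sub_const]
      simp
    have h3 : K * B ≤ 1 / 2 := by
      calc K * B ≤ 1 / (2 * B) * B := by gcongr
        _ = 1 / 2 := by field_simp
    rw [h2] at h1
    refine ⟨?_, ?_⟩
    · have h4 := JetBound.add ((smooth_deriv hv).sub contDiff_const) contDiff_const h1
        (jetBound_const r hB.le 1 x)
      simp only [sub_add_cancel] at h4
      exact h4.mono le_rfl (by rw [abs_one]; linarith) hB.le le_rfl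
    · have h4 := abs_le.1 (h1.val)
      linarith [h4.1]
  have hkj : ∀ x ∈ Set.Icc a b,
      JetBound r 2 B (deriv fun y => N * k y) x ∧ 1 / 2 ≤ deriv (fun y => N * k y) x := by
    intro x hx
    refine hderiv _ (1 / (4 * B) + δ) x hsk ?_ ?_
    · have : 1 / (2 * B) = 1 / (4 * B) + 1 / (4 * B) := by field_simp; norm_num
      linarith
    · have h1 := JetBound.add (hsh.sub haff) (contDiff_const.mul (k.smooth.sub h.smooth))
        (hh x hx) (hk x hx)
      refine h1.congr (Filter.Eventually.of_forall fun y => ?_)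
      ring
  have hu : ∀ x ∈ Set.Icc a b, JetBound r Ci B (deriv fun y => k⁻¹ (N⁻¹ * y)) (N * k x) :=
    fun x hx => hCi B (fun y => N * k y) (fun y => k⁻¹ (N⁻¹ * y)) x hB hsk hsu hkpos
      (fun y => by simp only [SLift.apply_inv_self]; field_simp)
      (fun y => by rw [inv_mul_cancel_left₀ hN.ne', SLift.inv_apply_self]) (hkj x hx).2 (hkj x hx).1
  have hmain := hCs Ci B B δ (fun y => k⁻¹ (N⁻¹ * y)) (fun y => N * h y) (fun y => N * k y) z
    hB hB.le hsu hsh hsk ?_ ?_ ?_ ?_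
  · refine (hmain.congr (Filter.Eventually.of_forall fun y => ?_)).mono le_rfl ?_ hB.le le_rfl
    · simp only [inv_mul_cancel_left₀ hN.ne', SLift.inv_apply_self, SLift.mul_apply]
    · rw [← mul_assoc]
      exact mul_le_mul_of_nonneg_right (le_max_right _ _) hδ0
  · intro y hy
    have h1 : ∀ w ∈ Set.Icc (k a) (k b), N * w ∈ Set.Icc (N * k a) (N * k b) := fun w hw =>
      ⟨mul_le_mul_of_nonneg_left hw.1 hN.le, mul_le_mul_of_nonneg_left hw.2 hN.le⟩
    have h2 := Set.uIcc_subset_Icc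
      (h1 (h z) ⟨ha ▸ h.strictMono.monotone hz.1, hb ▸ h.strictMono.monotone hz.2⟩)
      (h1 (k z) ⟨k.strictMono.monotone hz.1, k.strictMono.monotone hz.2⟩) hy
    have h3 : y = N * k (k⁻¹ (N⁻¹ * y)) := by rw [SLift.apply_inv_self]; field_simp
    rw [h3] at h2 ⊢
    refine hu _ ⟨?_, ?_⟩
    · exact k.strictMono.le_iff_le.1 (le_of_mul_le_mul_left h2.1 hN)
    · exact k.strictMono.le_iff_le.1 (le_of_mul_le_mul_left h2.2 hN)
  · intro hr
    rw [mul_div_assoc, div_self hB.ne', mul_one]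
    refine (hderiv _ (1 / (4 * B)) z hsh ?_ (hh z hz)).1.mono (Nat.sub_le r 1) le_rfl hB.le le_rfl
    gcongr
    norm_num
  · intro hr
    rw [mul_div_assoc, div_self hB.ne', mul_one]
    exact (hkj z hz).1.mono (Nat.sub_le r 1) le_rfl hB.le le_rfl
  · refine ((hk z hz).neg.congr (Filter.Eventually.of_forall fun y => ?_)).mono
      (Nat.le_succ r) le_rfl hB.le le_rfl
    ring

namespace CutTower

variable {κ c : ℕ → ℝ} {f : SLift} {p : ℤ} {q : ℕ} {X : ℤ → ℝ} {μ : ℝ} {χ φ : ℝ → ℝ}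

theorem exists_visit (h : CutTower κ c f p q X μ χ φ) (z : ℝ) :
    ∃ i n, (f ^ i) z - (n : ℤ) ∈ Set.Icc (X (-1)) (X 2) := by
  obtain ⟨j, hj⟩ := h.gd.exists_mem z
  obtain ⟨i, hi, hmod⟩ := h.gd.exists_modEq j 0
  obtain ⟨n, hn⟩ := hmod.symm.dvd
  have h1 := h.gd.sub_int_mem n (h.gd.pow_mem i hj)
  rw [show j + i * p - n * q = 0 by linear_combination hn] at h1
  exact ⟨i, n, (h.mem_hull (by norm_num) (by norm_num)).1.trans h1.1,
    h1.2.trans (h.mem_hull (j := 0 + 1) (by norm_num) (by norm_num)).2⟩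

theorem return_mem_Ioo (h : CutTower κ c f p q X μ χ φ) {a b : ℤ} {z : ℝ} :
    (f ^ q) z - p ∈ Set.Ioo (X a) (X b) ↔ z ∈ Set.Ioo (X a) (X b) := by
  have h1 : ∀ j : ℤ, (f ^ q) (X j) - p = X j := fun j => by
    rw [h.gd.map_pow, mul_comm, h.gd.period_int]; ring
  rw [Set.mem_Ioo, Set.mem_Ioo, ← h1 a, ← h1 b, sub_lt_sub_iff_right, sub_lt_sub_iff_right,
    h1, h1, (f ^ q).strictMono.lt_iff_lt, (f ^ q).strictMono.lt_iff_lt]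

theorem eventually_average_map (h : CutTower κ c f p q X μ χ φ) (α : ℝ) {z : ℝ}
    (hz : ∀ n : ℤ, z - n ∉ Set.Ioo (X (-1)) (X 2)) :
    ∀ᶠ y in 𝓝 z, average f q χ φ α (f y) = average f q χ φ α y + α := by
  have h1 := h.eventually_zero hz
  have h2 : (fun y => χ ((f ^ q) y)) =ᶠ[𝓝 z] 0 := by
    refine (f ^ q).continuous.continuousAt.tendsto.eventually (h.eventually_zero fun n hn => ?_)
    refine hz (n - p) (h.return_mem_Ioo.1 ?_)
    rw [SLift.map_sub_int]
    push_cast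
    rwa [show (f ^ q) z - ((n : ℝ) - p) - p = (f ^ q) z - n by ring]
  filter_upwards [h1, h2] with y hy1 hy2
  have h3 := h.average_map_sub α y
  rw [hy1, hy2] at h3
  simp only [Pi.zero_apply, zero_mul, sub_self, add_zero] at h3
  linarith

theorem average_map_endpoint (h : CutTower κ c f p q X μ χ φ) (α : ℝ) {j : ℤ}
    (hj : j = -1 ∨ j = 2) :
    average f q χ φ α (f (X j)) = average f q χ φ α (X j) + α := by
  refine (h.eventually_average_map α fun n hn => ?_).self_of_nhds
  have h1 := h.gd.period_int (j - n * q) n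
  rw [sub_add_cancel] at h1
  rw [h1, add_sub_cancel_right] at hn
  have h2 := h.gd.mono.lt_iff_lt.1 hn.1
  have h3 := h.gd.mono.lt_iff_lt.1 hn.2
  have hq : (3 : ℤ) ≤ q := by
    have h4 := h.tower.sub_le 0 q
    rw [h.gd.period, add_sub_cancel_left] at h4
    have h5 := h.small
    have h6 : (0 : ℝ) ≤ q := Nat.cast_nonneg q
    have : (3 : ℝ) ≤ q := by nlinarith
    exact_mod_cast this
  rcases lt_trichotomy n 0 with hn0 | rfl | hn0
  · rcases hj with rfl | rfl <;> nlinarith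
  · rcases hj with rfl | rfl <;> simp at h2 h3
  · rcases hj with rfl | rfl <;> nlinarith

theorem deriv_average_pos (h : CutTower κ c f p q X μ χ φ) {α : ℝ}
    (hd : ∀ z ∈ Set.Icc (X (-1)) (X 2), 0 < deriv (average f q χ φ α) z) (z : ℝ) :
    0 < deriv (average f q χ φ α) z := by
  obtain ⟨l, n, hl⟩ := h.exists_visit z
  induction l generalizing z with
  | zero =>
    have h1 := hd _ hl
    have h2 := SLift.deriv_sub_int_of_add_one (h.average_add_one α) z n
    rwa [pow_zero, SLift.one_apply, h2] at h1
  | succ l ih =>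
    by_cases hz : ∃ m : ℤ, z - m ∈ Set.Icc (X (-1)) (X 2)
    · obtain ⟨m, hm⟩ := hz
      rw [← SLift.deriv_sub_int_of_add_one (h.average_add_one α) z m]
      exact hd _ hm
    · push Not at hz
      have h1 := h.eventually_average_map α fun m hm => hz m (Set.Ioo_subset_Icc_self hm)
      have h2 := Filter.EventuallyEq.deriv_eq h1
      rw [deriv_comp_eq (h.smooth_average α) f.smooth] at h2
      have h3 := ih (f z) (by rwa [pow_succ, SLift.mul_apply] at hl)
      have h4 := mul_pos h3 (f.dpos z)
      simp only [deriv_add_const] at h2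
      rw [h2] at h4
      exact h4

end CutTower

/-- A tower with small gaps can be corrected to a conjugate of a rotation by an irrational
angle. -/
theorem exists_conj_tower (κ : ℕ → ℝ) (r : ℕ) : ∃ C μ₀ : ℝ, 1 ≤ C ∧ 0 < μ₀ ∧
    ∀ (f : SLift) (p : ℤ) (q : ℕ) (X : ℤ → ℝ) (μ : ℝ), Tower κ f p q X μ → μ ≤ μ₀ →
    ∀ α : ℝ, q ^ 2 * μ ^ 2 * |α - p / q| ≤ μ ^ (2 * (r + 2) + 3) →
    ∃ H θ : SLift, conj H α 1 = f * θ ∧ ∀ z, JetBound r (C * μ) 1 (fun y => θ y - y) z := by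
  obtain ⟨c, hc1, hc⟩ := exists_cutoff
  obtain ⟨Cg, hCg1, hCg⟩ := exists_abs_gap_sub_le κ
  obtain ⟨Ca, hCa1, hCa⟩ := exists_average_bound κ c (r + 1)
  obtain ⟨Cd, hCd1, hCd⟩ := exists_defect_bound κ c (r + 1) (r + 2)
  obtain ⟨Cc, hCc1, hCc⟩ := exists_correction_bound r
  have hS : 0 < 8 * (Cg + Ca + Cd) := by linarith
  refine ⟨Cc * Cd, (8 * (Cg + Ca + Cd))⁻¹, one_le_mul_of_one_le_of_one_le hCc1 hCd1,
    inv_pos.2 hS, fun f p q X μ h hμ₀ α hα => ?_⟩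
  have hμ := h.pos
  have hμ1 : (Cg + Ca + Cd) * μ ≤ 1 / 8 := by
    have := mul_le_mul_of_nonneg_left hμ₀ hS.le
    rw [mul_inv_cancel₀ hS.ne'] at this
    linarith
  have hg1 : Cg * μ ≤ 1 / 8 := by nlinarith
  have ha1 : Ca * μ ≤ 1 / 8 := by nlinarith
  have hd1 : Cd * μ ≤ 1 / 8 := by nlinarith
  have hμ8 : μ ≤ 1 / 8 := by nlinarith
  obtain ⟨χ, φ, hcut⟩ := hc (X 0) (μ ^ 2) (q * μ ^ 2) (by positivity) (by nlinarith)
  have hgap : ∀ j, -1 ≤ j → j ≤ 1 → μ ^ 2 / 4 < gap X j := fun j h1 h2 => by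
    have h3 := (abs_le.1 (hCg f p q X μ h j h1 h2)).1
    nlinarith [mul_le_mul_of_nonneg_left hg1 (sq_nonneg μ), sq_pos_of_pos hμ]
  have ht : CutTower κ c f p q X μ χ φ :=
    ⟨h, hcut, hgap _ le_rfl (by norm_num), hgap _ (by norm_num) le_rfl, by nlinarith⟩
  have hq : (0 : ℝ) < q := Nat.cast_pos.2 h.gd.q_pos
  have hN : 0 < q * μ ^ 2 := by positivity
  have hB : 0 < (μ ^ 2)⁻¹ := by positivity
  have hav : ∀ z ∈ Set.Icc (X (-1)) (X 2), JetBound (r + 1) (1 / (4 * (μ ^ 2)⁻¹)) (μ ^ 2)⁻¹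
      (fun y => q * μ ^ 2 * average f q χ φ α y - (y - X 0)) z := fun z hz => by
    refine (hCa f p q X μ χ φ ht α (hα.trans ?_) z hz).mono le_rfl ?_ hB.le le_rfl
    · exact pow_le_pow_of_le_one hμ.le h.le_one (by omega)
    · rw [one_div, mul_inv, inv_inv]
      nlinarith [mul_le_mul_of_nonneg_right ha1 (sq_nonneg μ)]
  have hdef := fun z hz => hCd f p q X μ χ φ ht α hα z hz
  have hpos : ∀ z, 0 < deriv (average f q χ φ α) z := by
    refine ht.deriv_average_pos fun z hz => ?_
    have h1 := ((jetBound_succ.1 (hav z hz)).2).val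
    rw [deriv_fun_sub ((smooth_diff (ht.smooth_average α) z).const_mul _) (by fun_prop),
      deriv_const_mul _ (smooth_diff (ht.smooth_average α) z), deriv_sub_const, deriv_id''] at h1
    have h2 : 1 / (4 * (μ ^ 2)⁻¹) * (μ ^ 2)⁻¹ = 1 / 4 := by field_simp
    rw [h2] at h1
    exact pos_of_mul_pos_right (by linarith [(abs_le.1 h1).1]) hN.le
  obtain ⟨S, hS⟩ := SLift.exists_of (ht.smooth_average α) (ht.average_add_one α) hpos
  set k : SLift := SLift.rot (-α) * S * f with hk
  have hkv : ∀ y, k y = S (f y) - α := fun y => by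
    simp only [hk, SLift.mul_apply, SLift.rot_apply]; ring
  refine ⟨S⁻¹, k⁻¹ * S, ?_, fun z => ?_⟩
  · rw [conj, hk, inv_inv, mul_inv_rev, mul_inv_rev, SLift.rot_inv, neg_neg]
    simp [mul_assoc]
  by_cases hz : ∃ n : ℤ, z - n ∈ Set.Icc (X (-1)) (X 2)
  · obtain ⟨n, hn⟩ := hz
    have h1 := hCc S k (q * μ ^ 2) (μ ^ 2)⁻¹ (Cd * μ ^ (2 * (r + 2))) (X 0) (X (-1)) (X 2)
      hN hB ?_ ?_ ?_ ?_ ?_ (z - n) hn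
    · intro j hj
      have h2 := (JetBound.congr (JetBound.sub_const_comp h1)
        (v := fun y => (k⁻¹ * S) y - y) (Filter.Eventually.of_forall fun y => by
          simp only [SLift.map_sub_int]; ring)) j hj
      refine h2.trans ?_
      have h3 : μ ^ (2 * (r + 2)) * (μ ^ 2)⁻¹ ^ j ≤ μ := by
        have h4 : 2 * (r + 2) = 2 * (r - j) + 3 + 1 + 2 * j := by omega
        rw [h4, pow_add _ _ (2 * j), pow_mul μ 2 j, inv_pow, mul_assoc,
          mul_inv_cancel₀ (by positivity), mul_one, pow_succ]
        exact mul_le_of_le_one_left hμ.le (pow_le_one₀ hμ.le h.le_one)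
      calc _ = Cc * Cd * (μ ^ (2 * (r + 2)) * (μ ^ 2)⁻¹ ^ j) := by ring
        _ ≤ Cc * Cd * μ := by gcongr
        _ = _ := by rw [one_pow, mul_one]
    · have h3 : μ ^ (2 * (r + 2)) ≤ μ * μ ^ 2 := by
        rw [← pow_succ']
        exact pow_le_pow_of_le_one hμ.le h.le_one (by omega)
      calc Cd * μ ^ (2 * (r + 2)) ≤ Cd * (μ * μ ^ 2) := by gcongr
        _ = Cd * μ * μ ^ 2 := by ring
        _ ≤ 1 / 4 * μ ^ 2 := by gcongr; linarith
        _ = _ := by field_simp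
    · rw [hkv, hS, ht.average_map_endpoint α (Or.inl rfl), add_sub_cancel_right]
    · rw [hkv, hS, ht.average_map_endpoint α (Or.inr rfl), add_sub_cancel_right]
    · rw [hS]
      exact hav
    · intro y hy
      refine (hdef y hy).congr (Filter.Eventually.of_forall fun y => ?_)
      simp only [hkv, hS]
  · push Not at hz
    have h1 := ht.eventually_average_map α fun m hm => hz m (Set.Ioo_subset_Icc_self hm)
    refine JetBound.congr (u := fun _ => 0) ?_ ?_
    · exact (jetBound_const r zero_le_one 0 z).mono le_rfl (by rw [abs_zero]; positivity)
        zero_le_one le_rfl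
    · filter_upwards [h1] with y hy
      rw [← hS] at hy
      rw [SLift.mul_apply, show S y = k y by rw [hkv, hy]; ring, SLift.inv_apply_self, sub_self]

theorem SLift.deriv_rot_mul (t : ℝ) (g : SLift) : deriv (SLift.rot t * g : SLift) = deriv g := by
  funext x
  exact deriv_add_const t

theorem exists_pow_gap_bound {κ : ℕ → ℝ} {f : SLift} {p : ℤ} {q : ℕ} {X : ℤ → ℝ} {μ α : ℝ}
    (h : Tower κ f p q X μ) (n : ℕ) (hα : |α - p / q| ≤ 1 / (q : ℝ) ^ (n + 2)) :
    q ^ 2 * μ ^ 2 * |α - p / q| ≤ μ ^ (2 * n + 2) := by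
  have hq : (0 : ℝ) < q := Nat.cast_pos.2 h.gd.q_pos
  have hμ := h.pos
  have h1 : 1 ≤ q * μ ^ 2 := by
    have h2 := h.sub_le 0 q
    rwa [h.gd.period, add_sub_cancel_left] at h2
  have h3 : 1 / (q : ℝ) ^ n ≤ (μ ^ 2) ^ n := by
    rw [div_le_iff₀ (by positivity), ← mul_pow]
    exact one_le_pow₀ (by linarith)
  calc q ^ 2 * μ ^ 2 * |α - p / q| ≤ q ^ 2 * μ ^ 2 * (1 / (q : ℝ) ^ (n + 2)) := by gcongr
    _ = 1 / (q : ℝ) ^ n * μ ^ 2 := by rw [pow_add]; field_simp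
    _ ≤ (μ ^ 2) ^ n * μ ^ 2 := by gcongr
    _ = _ := by ring

/-- Conjugates of rotations by a Liouville angle are dense among the smooth circle
diffeomorphisms with that translation number. -/
theorem exists_conj_close {α : ℝ} (hα : Liouville α) (g : SLift) (hg : g.transl = α) (r : ℕ)
    {ε : ℝ} (hε : 0 < ε) : ∃ H : SLift, CloseTo r ε (conj H α 1) g := by
  choose κ hκ1 hκ using fun k => jets_bounded_of_periodic (smooth_deriv g.smooth_dlog)
    g.deriv_dlog_periodic k
  obtain ⟨C, μ₀, hC1, hμ₀, hC⟩ := exists_conj_tower κ r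
  obtain ⟨K, hK1, hK⟩ := g.jets_bounded r
  obtain ⟨Cs, hCs1, hCs⟩ := jetBound_comp_sub r 2
  have hT : 0 < Cs * (K * C) := by positivity
  set μ₁ := min (min μ₀ 1) (min C⁻¹ (ε / 2 / (Cs * (K * C)))) with hμ₁
  have hμ₁0 : 0 < μ₁ := lt_min (lt_min hμ₀ one_pos) (lt_min (by positivity) (by positivity))
  obtain ⟨δ₁, hδ₁, hrot⟩ := g.exists_rot_mul_periodic (by rw [hg]; exact hα.irrational)
    (half_pos hε)
  obtain ⟨δ₂, hδ₂, Q₂, hgaps⟩ := exists_small_gaps hα (κ 0) (pow_pos hμ₁0 2)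
  obtain ⟨Q₁, hQ₁⟩ := exists_nat_gt (1 / min δ₁ δ₂)
  have hδ : 0 < min δ₁ δ₂ := lt_min hδ₁ hδ₂
  obtain ⟨p, q, hQ, hq, hc, hpq⟩ := exists_coprime_near hα (r + 3 + 2) (max Q₁ Q₂)
  have hq' : (1 : ℝ) ≤ q := by exact_mod_cast hq
  have hpq' : |α - p / q| < min δ₁ δ₂ := by
    refine hpq.trans_le ?_
    have h1 : (Q₁ : ℝ) ≤ q := by exact_mod_cast (le_max_left _ _).trans hQ
    calc 1 / (q : ℝ) ^ (r + 3 + 2) ≤ 1 / (q : ℝ) :=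
          one_div_le_one_div_of_le (by linarith) (le_self_pow₀ hq' (by omega))
      _ ≤ min δ₁ δ₂ := by
          rw [one_div_le (by linarith) hδ]
          linarith
  obtain ⟨t, ht, hper⟩ := hrot p q hq (by rw [hg]; exact hpq'.trans_le (min_le_left _ _))
  set f := SLift.rot t * g with hf
  have hfv : ∀ y, f y = g y + t := fun y => by simp only [hf, SLift.mul_apply, SLift.rot_apply]
  have hfd : deriv f = deriv g := SLift.deriv_rot_mul t g
  have hlog : f.dlog = g.dlog := by
    funext x
    rw [SLift.dlog, hfd, SLift.dlog]
  obtain ⟨X, hX⟩ := GapData.exists_of_periodic f hq hc hper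
  obtain ⟨j, hj⟩ := hX.exists_max
  have hY := hX.shift j
  have hgj : gap X j < μ₁ ^ 2 := hgaps f p q X hX (fun x => by
    rw [hlog]; exact (hκ 0 x).val) (hpq'.trans_le (min_le_right _ _))
    ((le_max_right _ _).trans hQ) j
  have hgap0 : 0 < gap X j := hX.gap_pos j
  have hY' : ∀ k, gap (fun i => X (i + j)) k = gap X (k + j) := fun k => by
    simp only [gap]
    rw [add_right_comm]
  have hμle : √(gap X j) ≤ μ₁ := Real.sqrt_le_iff.2 ⟨hμ₁0.le, hgj.le⟩
  have hTow : Tower κ f p q (fun i => X (i + j)) √(gap X j) :=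
    { gd := hY
      bound := fun k x => by rw [hlog]; exact hκ k x
      pos := Real.sqrt_pos.2 hgap0
      le_one := hμle.trans ((min_le_left _ _).trans (min_le_right _ _))
      gap_le := fun k => by rw [Real.sq_sqrt hgap0.le, hY']; exact hj _
      gap_zero := by rw [Real.sq_sqrt hgap0.le, hY', zero_add] }
  set μ := √(gap X j) with hμ
  obtain ⟨H, θ, hH, hθ⟩ := hC f p q _ μ hTow
    (hμle.trans ((min_le_left _ _).trans (min_le_left _ _))) α
    ((exists_pow_gap_bound hTow (r + 3) hpq.le).trans
      (pow_le_pow_of_le_one hTow.pos.le hTow.le_one (by omega)))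
  have hCμ : C * μ ≤ 1 := by
    have h1 : μ ≤ C⁻¹ := hμle.trans ((min_le_right _ _).trans (min_le_left _ _))
    calc C * μ ≤ C * C⁻¹ := by gcongr
      _ = 1 := mul_inv_cancel₀ (by linarith)
  have hsmall : Cs * (K * (C * μ)) ≤ ε / 2 := by
    have h1 : μ ≤ ε / 2 / (Cs * (K * C)) :=
      hμle.trans ((min_le_right _ _).trans (min_le_right _ _))
    rw [le_div_iff₀ hT] at h1
    linarith
  refine ⟨H, fun x => ?_⟩
  have hdid : JetBound (r - 1) 1 1 (deriv fun y : ℝ => y) x := by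
    rw [deriv_id_eq]
    simpa using jetBound_const (r - 1) zero_le_one 1 x
  have hdθ : 0 < r → JetBound (r - 1) 2 1 (deriv θ) x := fun hr => by
    have h1 := hθ x
    rw [show r = r - 1 + 1 by omega] at h1
    have h2 := JetBound.add (smooth_deriv (θ.smooth.sub contDiff_id)) (smooth_deriv contDiff_id)
      (jetBound_succ.1 h1).2 hdid
    refine (h2.congr (Filter.Eventually.of_forall fun y => ?_)).mono le_rfl (by linarith)
      zero_le_one le_rfl
    change deriv (fun z => θ z - z) y + deriv (fun z : ℝ => z) y = deriv θ y
    rw [deriv_sub_eq θ.smooth (v := fun z => z) contDiff_id]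
    ring
  have h1 := hCs K 1 1 (C * μ) f θ (fun y => y) x one_pos zero_le_one f.smooth θ.smooth contDiff_id
    (fun y _ => by rw [hfd]; exact hK y) (fun hr => by simpa using hdθ hr)
    (fun _ => hdid.mono le_rfl (by norm_num) zero_le_one le_rfl) (hθ x)
  have h2 := JetBound.add ((f.smooth.comp θ.smooth).sub f.smooth) contDiff_const h1
    (jetBound_const r zero_le_one t x)
  refine (h2.congr (Filter.Eventually.of_forall fun y => ?_)).mono le_rfl ?_ zero_le_one le_rfl
  · simp only [hH, SLift.mul_apply, hfv, Function.comp_apply]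
    ring
  · linarith

theorem liouville_add_int {α : ℝ} (h : Liouville α) (k : ℤ) : Liouville (α + k) :=
  forall_liouvilleWith_iff.1 fun p => (forall_liouvilleWith_iff.2 h p).add_int k

namespace SLift

theorem iterate_eq (f : SLift) (n : ℕ) : (f : ℝ → ℝ)^[n] = (f ^ n : SLift) := by
  induction n with
  | zero => rfl
  | succ n ih =>
    funext x
    rw [Function.iterate_succ_apply', ih, pow_succ', mul_apply]

theorem invFun_eq (f : SLift) : Function.invFun (f : ℝ → ℝ) = (f⁻¹ : SLift) := by
  funext x
  have h := Function.leftInverse_invFun f.strictMono.injective (f⁻¹ x)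
  rwa [apply_inv_self] at h

theorem zpowLift_eq (f : SLift) (i : ℤ) : zpowLift f i = (f ^ i : SLift) := by
  rw [zpowLift]
  split_ifs with h
  · rw [iterate_eq, ← zpow_natCast, Int.toNat_of_nonneg h]
  · rw [invFun_eq, iterate_eq, ← zpow_natCast, Int.toNat_of_nonneg (by omega), inv_zpow, zpow_neg,
      inv_inv]

theorem exists_circle_family (f : SLift) :
    ∃ (Fz : ℤ → UnitAddCircle → UnitAddCircle) (D : ℤ → UnitAddCircle → ℝ),
      (∀ (i : ℤ) (x : ℝ), Fz i x = ((f ^ i) x : ℝ)) ∧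
      ∀ (i : ℤ) (x : ℝ), D i x = deriv (f ^ i : SLift) x := by
  choose e he using fun x : UnitAddCircle =>
    QuotientAddGroup.mk_surjective (s := AddSubgroup.zmultiples (1 : ℝ)) x
  refine ⟨fun i x => ((f ^ i) (e x) : ℝ), fun i x => deriv (f ^ i : SLift) (e x),
    fun i x => ?_, fun i x => ?_⟩
  · obtain ⟨n, hn⟩ := coe_eq_coe_add_int (he x)
    change (((f ^ i) (e x) : ℝ) : UnitAddCircle) = _
    rw [hn, map_add_int, AddCircle.coe_add]
    simp
  · obtain ⟨n, hn⟩ := coe_eq_coe_add_int (he x)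
    change deriv (f ^ i : SLift) (e x) = _
    rw [hn, deriv_add_int]

theorem hasRotationNumber_of_bounded {f : SLift} {α C : ℝ} {k : ℤ}
    (h : ∀ i : ℤ, |(f ^ i) 0 - i * (α + k)| ≤ C) : HasRotationNumber f α := by
  refine ⟨k, ?_⟩
  have h1 : Tendsto (fun n : ℕ => ((f ^ (n : ℤ)) 0 - n * (α + k)) / (n : ℝ)) atTop (𝓝 0) := by
    refine squeeze_zero_norm (fun n => ?_) (tendsto_const_div_atTop_nhds_zero_nat C)
    rw [norm_div, Real.norm_eq_abs, Real.norm_natCast]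
    gcongr
    exact_mod_cast h n
  rw [← zero_add (α + k : ℝ)]
  refine (h1.add_const (α + k)).congr' ?_
  filter_upwards [eventually_gt_atTop 0] with n hn
  have hn' : (n : ℝ) ≠ 0 := Nat.cast_ne_zero.2 hn.ne'
  rw [iterate_eq, zpow_natCast]
  field_simp
  ring

theorem transl_eq_of_tendsto {f : SLift} {β : ℝ}
    (h : Tendsto (fun n : ℕ => (f : ℝ → ℝ)^[n] 0 / (n : ℝ)) atTop (𝓝 β)) : f.transl = β :=
  f.toDeg1.translationNumber_eq_of_tendsto₀ h

end SLift

theorem crNorm_le {r : ℕ} {K : ℝ} {u : ℝ → ℝ} (h : ∀ x, JetBound r K 1 u x) : CrNorm r u ≤ K := by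
  refine Finset.sup'_le _ _ fun i hi => ciSup_le fun x => ?_
  simpa using h x i (by have := Finset.mem_range.1 hi; omega)

theorem liftDist_le {r : ℕ} {ε : ℝ} {f g : SLift} (h : CloseTo r ε f g)
    (h' : CloseTo r ε (f⁻¹ : SLift) (g⁻¹ : SLift)) : liftDist r f g ≤ ε := by
  rw [liftDist, SLift.invFun_eq, SLift.invFun_eq]
  exact max_le (crNorm_le h) (crNorm_le h')

end CircleIII

/-- For a Liouville number `α ∈ (0,1)` and `λ > 1`, type `III_λ` diffeomorphisms are
`C^∞`-dense in the set of smooth circle diffeomorphisms with rotation number `α`. -/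
theorem stmt_2 (α : ℝ) (hα0 : 0 < α) (hα1 : α < 1) (hL : Liouville α)
    (lam : ℝ) (hlam : 1 < lam)
    (g : ℝ → ℝ) (hg : IsCircleDiffeoLift g) (hρg : HasRotationNumber g α)
    (r : ℕ) (ε : ℝ) (hε : 0 < ε) :
    ∃ f : ℝ → ℝ, IsCircleDiffeoLift f ∧ HasRotationNumber f α ∧
      liftDist r f g < ε ∧
      ∃ Fz : ℤ → UnitAddCircle → UnitAddCircle, ∃ D : ℤ → UnitAddCircle → ℝ,
        (∀ i : ℤ, ∀ x : ℝ, Fz i ↑x = ↑(zpowLift f i x)) ∧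
        (∀ i : ℤ, ∀ x : ℝ, D i ↑x = deriv (zpowLift f i) x) ∧
        ratioSet Fz D = {t : ℝ | ∃ n : ℤ, t = lam ^ n} ∪ {0} := by
  obtain ⟨G, rfl⟩ := CircleIII.SLift.exists_of hg.1 hg.2.1 hg.2.2
  obtain ⟨k, hk⟩ := hρg
  have hβ := CircleIII.liouville_add_int hL k
  obtain ⟨δ, hδ, hinv⟩ := CircleIII.close_inv G r (ε / 2) (half_pos hε)
  have hη : 0 < min δ (ε / 2) := lt_min hδ (half_pos hε)
  obtain ⟨H, hH⟩ := CircleIII.exists_conj_close hβ G (CircleIII.SLift.transl_eq_of_tendsto hk)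
    (r + 1) (half_pos hη)
  obtain ⟨f, hf, -, ⟨C, hC⟩, hratio⟩ := CircleIII.exists_typeIII hβ hlam H (r + 1) (half_pos hη)
  obtain ⟨Fz, D, hFz, hD⟩ := f.exists_circle_family
  have hfG : CircleIII.CloseTo (r + 1) (min δ (ε / 2)) f G := by
    simpa using hf.trans f.smooth (CircleIII.SLift.smooth _) G.smooth hH
  refine ⟨f, ⟨f.smooth, f.map_add_one, f.dpos⟩,
    CircleIII.SLift.hasRotationNumber_of_bounded hC, ?_, Fz, D, ?_, ?_, hratio Fz D hFz hD⟩
  · exact (CircleIII.liftDist_le (hfG.mono (Nat.le_succ r) (min_le_right _ _))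
      (hinv f (hfG.mono le_rfl (min_le_left _ _)))).trans_lt (half_lt_self hε)
  · intro i x
    rw [hFz, f.zpowLift_eq]
  · intro i x
    rw [hD, f.zpowLift_eq]
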